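/- Say a rational prime p is totally ramified in a cubic field K if pO_K = 𝔭³ for a prime ideal 𝔭 of the ring of integers O_K. Then as X → ∞, the number of isomorphism classes of cubic fields K with 0 < Disc(K) < X in which no rational prime is totally ramified equals X/(2π²) + o(X), and the number of isomorphism classes of cubic fields K with −X < Disc(K) < 0 in which no rational prime is totally ramified equals 3X/(2π²) + o(X). -/

import Mathlib

open Filter

/-- The discriminant of a number field presented as a subfield of `ℂ`
(junk value `0` in the infinite-dimensional case). -/
noncomputable def fieldDisc (K : IntermediateField ℚ ℂ) : ℤ :=
  letI := Classical.dec (FiniteDimensional ℚ K)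
  if h : FiniteDimensional ℚ K then
    letI := h
    letI : NumberField K := ⟨⟩
    NumberField.discr K
  else 0

/-- The number of isomorphism classes of cubic fields `K` with `ξ < Disc K < η`. -/
noncomputable def cubicFieldCount (ξ η : ℝ) : ℕ :=
  Nat.card (Quot fun K L : { K : IntermediateField ℚ ℂ //
      Module.finrank ℚ K = 3 ∧ ξ < (fieldDisc K : ℝ) ∧ (fieldDisc K : ℝ) < η } =>
    Nonempty (↥K.1 ≃+* ↥L.1))

/-- No rational prime is totally ramified in `K`: there is no prime `p` and prime ideal
`𝔭` of the ring of integers with `p·O_K = 𝔭³`. -/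
def NowhereTotallyRamified (K : IntermediateField ℚ ℂ) : Prop :=
  ∀ p : ℕ, p.Prime →
    ¬∃ P : Ideal (NumberField.RingOfIntegers K), P.IsPrime ∧
        Ideal.span {(p : NumberField.RingOfIntegers K)} = P ^ 3

/-- The number of isomorphism classes of cubic fields `K` with `ξ < Disc K < η` in which
no rational prime is totally ramified. -/
noncomputable def cubicFieldCountNTR (ξ η : ℝ) : ℕ :=
  Nat.card (Quot fun K L : { K : IntermediateField ℚ ℂ //
      Module.finrank ℚ K = 3 ∧ NowhereTotallyRamified K ∧
        ξ < (fieldDisc K : ℝ) ∧ (fieldDisc K : ℝ) < η } =>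
    Nonempty (↥K.1 ≃+* ↥L.1))

namespace BCF

/-! ### Binary cubic forms -/

section Forms

variable {R : Type*} [CommRing R]

/-- The value `a x³ + b x² y + c x y² + d y³` of the binary cubic form `(a, b, c, d)`. -/
def eval (f : Fin 4 → R) (x y : R) : R :=
  f 0 * x ^ 3 + f 1 * x ^ 2 * y + f 2 * x * y ^ 2 + f 3 * y ^ 3

/-- The coefficients of `f (p x + q y, r x + s y)`. -/
def act (p q r s : R) (f : Fin 4 → R) : Fin 4 → R :=
  ![f 0 * p ^ 3 + f 1 * p ^ 2 * r + f 2 * p * r ^ 2 + f 3 * r ^ 3,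
    3 * f 0 * p ^ 2 * q + f 1 * (p ^ 2 * s + 2 * p * q * r) + f 2 * (2 * p * r * s + q * r ^ 2)
      + 3 * f 3 * r ^ 2 * s,
    3 * f 0 * p * q ^ 2 + f 1 * (2 * p * q * s + q ^ 2 * r) + f 2 * (p * s ^ 2 + 2 * q * r * s)
      + 3 * f 3 * r * s ^ 2,
    f 0 * q ^ 3 + f 1 * q ^ 2 * s + f 2 * q * s ^ 2 + f 3 * s ^ 3]

/-- The discriminant of a binary cubic form. -/
def disc (f : Fin 4 → R) : R :=
  f 1 ^ 2 * f 2 ^ 2 - 4 * f 0 * f 2 ^ 3 - 4 * f 1 ^ 3 * f 3 - 27 * f 0 ^ 2 * f 3 ^ 2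
    + 18 * f 0 * f 1 * f 2 * f 3

theorem ext4 {S : Type*} {f g : Fin 4 → S} (h0 : f 0 = g 0) (h1 : f 1 = g 1) (h2 : f 2 = g 2)
    (h3 : f 3 = g 3) : f = g := by
  funext i; fin_cases i <;> assumption

@[simp] theorem act_zero' (p q r s : R) (f : Fin 4 → R) : act p q r s f 0 =
    f 0 * p ^ 3 + f 1 * p ^ 2 * r + f 2 * p * r ^ 2 + f 3 * r ^ 3 := rfl

@[simp] theorem act_one' (p q r s : R) (f : Fin 4 → R) : act p q r s f 1 =
    3 * f 0 * p ^ 2 * q + f 1 * (p ^ 2 * s + 2 * p * q * r) + f 2 * (2 * p * r * s + q * r ^ 2)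
      + 3 * f 3 * r ^ 2 * s := rfl

@[simp] theorem act_two' (p q r s : R) (f : Fin 4 → R) : act p q r s f 2 =
    3 * f 0 * p * q ^ 2 + f 1 * (2 * p * q * s + q ^ 2 * r) + f 2 * (p * s ^ 2 + 2 * q * r * s)
      + 3 * f 3 * r * s ^ 2 := rfl

@[simp] theorem act_three' (p q r s : R) (f : Fin 4 → R) : act p q r s f 3 =
    f 0 * q ^ 3 + f 1 * q ^ 2 * s + f 2 * q * s ^ 2 + f 3 * s ^ 3 := rfl

theorem act_act (p q r s p' q' r' s' : R) (f : Fin 4 → R) :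
    act p' q' r' s' (act p q r s f) =
      act (p * p' + q * r') (p * q' + q * s') (r * p' + s * r') (r * q' + s * s') f := by
  apply ext4 <;> simp <;> ring

theorem act_id (f : Fin 4 → R) : act 1 0 0 1 f = f := by
  apply ext4 <;> simp

theorem act_neg_id (f : Fin 4 → R) : act (-1) 0 0 (-1) f = -f := by
  apply ext4 <;> simp <;> ring

theorem eval_act (p q r s : R) (f : Fin 4 → R) (x y : R) :
    eval (act p q r s f) x y = eval f (p * x + q * y) (r * x + s * y) := by
  simp [eval]; ring

theorem disc_act (p q r s : R) (f : Fin 4 → R) :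
    disc (act p q r s f) = (p * s - q * r) ^ 6 * disc f := by
  simp [disc]; ring

theorem act_inv (p q r s : R) (f : Fin 4 → R) (h : p * s - q * r = 1) :
    act s (-q) (-r) p (act p q r s f) = f := by
  rw [act_act]
  convert act_id f using 1
  congr 1 <;> first | linear_combination h | ring1

theorem act_inv' (p q r s : R) (f : Fin 4 → R) (h : p * s - q * r = -1) :
    act (-s) q r (-p) (act p q r s f) = f := by
  rw [act_act]
  convert act_id f using 1
  congr 1 <;> first | linear_combination -h | ring1

theorem act_map {S : Type*} [CommRing S] (φ : R →+* S) (p q r s : R) (f : Fin 4 → R) :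
    (fun i => φ (act p q r s f i)) = act (φ p) (φ q) (φ r) (φ s) (fun i => φ (f i)) := by
  apply ext4 <;> simp [map_ofNat]

theorem disc_map {S : Type*} [CommRing S] (φ : R →+* S) (f : Fin 4 → R) :
    φ (disc f) = disc (fun i => φ (f i)) := by
  simp [disc, map_ofNat]

end Forms

/-- Two integral binary cubic forms are equivalent under the group `GL₂(ℤ)`. -/
def GEquiv (f g : Fin 4 → ℤ) : Prop :=
  ∃ p q r s : ℤ, (p * s - q * r = 1 ∨ p * s - q * r = -1) ∧ g = act p q r s f

theorem GEquiv.refl (f : Fin 4 → ℤ) : GEquiv f f :=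
  ⟨1, 0, 0, 1, by simp, (act_id f).symm⟩

theorem GEquiv.symm {f g : Fin 4 → ℤ} (h : GEquiv f g) : GEquiv g f := by
  obtain ⟨p, q, r, s, h | h, rfl⟩ := h
  · exact ⟨s, -q, -r, p, Or.inl (by linarith), (act_inv p q r s f h).symm⟩
  · exact ⟨-s, q, r, -p, Or.inr (by linarith), (act_inv' p q r s f h).symm⟩

theorem GEquiv.trans {f g h : Fin 4 → ℤ} (h₁ : GEquiv f g) (h₂ : GEquiv g h) : GEquiv f h := by
  obtain ⟨p, q, r, s, hd, rfl⟩ := h₁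
  obtain ⟨p', q', r', s', hd', rfl⟩ := h₂
  refine ⟨_, _, _, _, ?_, act_act _ _ _ _ _ _ _ _ _⟩
  have : (p * p' + q * r') * (r * q' + s * s') - (p * q' + q * s') * (r * p' + s * r') =
    (p * s - q * r) * (p' * s' - q' * r') := by ring
  rw [this]
  rcases hd with hd | hd <;> rcases hd' with hd' | hd' <;> simp [hd, hd']

theorem GEquiv.disc_eq {f g : Fin 4 → ℤ} (h : GEquiv f g) : disc g = disc f := by
  obtain ⟨p, q, r, s, h | h, rfl⟩ := h <;> simp [disc_act, h]

/-- An integral binary cubic form without nontrivial rational zero. -/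
def Irr (f : Fin 4 → ℤ) : Prop := ∀ u v : ℤ, eval f u v = 0 → u = 0 ∧ v = 0

theorem Irr.act {f : Fin 4 → ℤ} (hf : Irr f) {p q r s : ℤ} (h : p * s - q * r ≠ 0) :
    Irr (act p q r s f) := by
  intro u v huv
  rw [eval_act] at huv
  obtain ⟨h1, h2⟩ := hf _ _ huv
  have hu : (p * s - q * r) * u = 0 := by linear_combination s * h1 - q * h2
  have hv : (p * s - q * r) * v = 0 := by linear_combination p * h2 - r * h1
  exact ⟨(mul_eq_zero.1 hu).resolve_left h, (mul_eq_zero.1 hv).resolve_left h⟩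

theorem Irr.gequiv {f g : Fin 4 → ℤ} (hf : Irr f) (h : GEquiv f g) : Irr g := by
  obtain ⟨p, q, r, s, h, rfl⟩ := h
  exact hf.act (by rcases h with h | h <;> simp [h])

theorem Irr.coeff_zero_ne {f : Fin 4 → ℤ} (hf : Irr f) : f 0 ≠ 0 := fun h => by
  simpa using (hf 1 0 (by simp [eval, h])).1

theorem Irr.coeff_three_ne {f : Fin 4 → ℤ} (hf : Irr f) : f 3 ≠ 0 := fun h => by
  simpa using (hf 0 1 (by simp [eval, h])).2

/-- `D` cannot be divided by the square of a prime so that it stays a discriminant. -/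
def Fund (D : ℤ) : Prop :=
  ∀ p : ℕ, p.Prime → ∀ E : ℤ, D = p ^ 2 * E → ¬(E % 4 = 0 ∨ E % 4 = 1)

theorem sq_add_four_mul_mod_four (x y : ℤ) :
    (x ^ 2 + 4 * y) % 4 = 0 ∨ (x ^ 2 + 4 * y) % 4 = 1 := by
  rw [Int.add_mul_emod_self_left]
  rcases Int.even_or_odd' x with ⟨k, rfl | rfl⟩
  · left; ring_nf; omega
  · right; ring_nf; omega

theorem disc_mod_four (f : Fin 4 → ℤ) : disc f % 4 = 0 ∨ disc f % 4 = 1 := by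
  have h : disc f = (f 1 * f 2 + f 0 * f 3) ^ 2
      + 4 * (- f 0 * f 2 ^ 3 - f 1 ^ 3 * f 3 - 7 * f 0 ^ 2 * f 3 ^ 2
        + 4 * f 0 * f 1 * f 2 * f 3) := by
    simp only [disc]; ring
  rw [h]
  exact sq_add_four_mul_mod_four _ _

/-- The form is divisible to the second order at `p` along the vector `(1, 0)`. -/
def BadCoeff (p : ℕ) (f : Fin 4 → ℤ) : Prop :=
  (p : ℤ) ∣ f 0 ∧ (p : ℤ) ∣ f 1 ∧ ((p : ℤ) ^ 2 ∣ f 0 ∨ (p : ℤ) ∣ f 2)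

/-- The form is divisible to the second order at `p` along some vector of `ℙ¹(𝔽_p)`. -/
def BadAt (p : ℕ) (f : Fin 4 → ℤ) : Prop :=
  BadCoeff p f ∨ ∃ k : ℤ, BadCoeff p (act k (-1) 1 0 f)

theorem exists_double_root_field {F : Type*} [Field F] (h2 : (2 : F) ≠ 0) (h3 : (3 : F) ≠ 0)
    (f : Fin 4 → F) (hD : disc f = 0) : ∃ u v : F, (u ≠ 0 ∨ v ≠ 0) ∧
      3 * f 0 * u ^ 2 + 2 * f 1 * u * v + f 2 * v ^ 2 = 0 ∧
      f 1 * u ^ 2 + 2 * f 2 * u * v + 3 * f 3 * v ^ 2 = 0 := by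
  simp only [disc] at hD
  generalize f 0 = a at *
  generalize f 1 = b at *
  generalize f 2 = c at *
  generalize f 3 = d at *
  by_cases hPQ : b * c - 9 * a * d ≠ 0 ∨ 2 * (b ^ 2 - 3 * a * c) ≠ 0
  · refine ⟨-(b * c - 9 * a * d), 2 * (b ^ 2 - 3 * a * c), ?_, ?_, ?_⟩
    · rwa [neg_ne_zero]
    · linear_combination (-9 * a) * hD
    · linear_combination (-3 * b) * hD
  push Not at hPQ
  obtain ⟨hQ, hP⟩ := hPQ
  have hP' : b ^ 2 - 3 * a * c = 0 := (mul_eq_zero.1 hP).resolve_left h2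
  by_cases hR : c ^ 2 - 3 * b * d = 0
  · by_cases ha : a = 0
    · subst ha
      have hb : b = 0 := by simpa using hP'
      subst hb
      exact ⟨1, 0, by simp, by simp, by simp⟩
    · refine ⟨-b, 3 * a, Or.inr (mul_ne_zero h3 ha), ?_, ?_⟩
      · linear_combination (-3 * a) * hP'
      · linear_combination b * hP' -3 * a * hQ
  · have hb : b = 0 := by
      have : b * (c ^ 2 - 3 * b * d) = 0 := by linear_combination c * hQ - 3 * d * hP'
      exact (mul_eq_zero.1 this).resolve_right hR
    subst hb
    have hc : c ≠ 0 := by rintro rfl; simp at hR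
    have ha : a = 0 := by
      have : 3 * (a * c) = 0 := by linear_combination -hP'
      simpa [h3, hc] using this
    subst ha
    exact ⟨1, 0, by simp, by simp, by simp⟩

theorem exists_double_root_two : ∀ a b c d : ZMod 2, b ^ 2 * c ^ 2 - 4 * a * c ^ 3 - 4 * b ^ 3 * d
    - 27 * a ^ 2 * d ^ 2 + 18 * a * b * c * d = 0 → ∃ u v : ZMod 2, (u ≠ 0 ∨ v ≠ 0) ∧
    a * u ^ 3 + b * u ^ 2 * v + c * u * v ^ 2 + d * v ^ 3 = 0 ∧
    3 * a * u ^ 2 + 2 * b * u * v + c * v ^ 2 = 0 ∧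
    b * u ^ 2 + 2 * c * u * v + 3 * d * v ^ 2 = 0 := by decide

theorem exists_double_root_three : ∀ a b c d : ZMod 3, b ^ 2 * c ^ 2 - 4 * a * c ^ 3 - 4 * b ^ 3 * d
    - 27 * a ^ 2 * d ^ 2 + 18 * a * b * c * d = 0 → ∃ u v : ZMod 3, (u ≠ 0 ∨ v ≠ 0) ∧
    a * u ^ 3 + b * u ^ 2 * v + c * u * v ^ 2 + d * v ^ 3 = 0 ∧
    3 * a * u ^ 2 + 2 * b * u * v + c * v ^ 2 = 0 ∧
    b * u ^ 2 + 2 * c * u * v + 3 * d * v ^ 2 = 0 := by decide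

theorem exists_double_root {p : ℕ} [Fact p.Prime] (f : Fin 4 → ZMod p) (hD : disc f = 0) :
    ∃ u v : ZMod p, (u ≠ 0 ∨ v ≠ 0) ∧ eval f u v = 0 ∧
      3 * f 0 * u ^ 2 + 2 * f 1 * u * v + f 2 * v ^ 2 = 0 ∧
      f 1 * u ^ 2 + 2 * f 2 * u * v + 3 * f 3 * v ^ 2 = 0 := by
  by_cases hp2 : p = 2
  · subst hp2
    exact exists_double_root_two _ _ _ _ hD
  by_cases hp3 : p = 3
  · subst hp3
    exact exists_double_root_three _ _ _ _ hD
  have h2 : (2 : ZMod p) ≠ 0 := by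
    intro h
    have : ((2 : ℕ) : ZMod p) = 0 := by exact_mod_cast h
    rw [ZMod.natCast_eq_zero_iff] at this
    exact hp2 ((Nat.prime_dvd_prime_iff_eq Fact.out Nat.prime_two).1 this)
  have h3 : (3 : ZMod p) ≠ 0 := by
    intro h
    have : ((3 : ℕ) : ZMod p) = 0 := by exact_mod_cast h
    rw [ZMod.natCast_eq_zero_iff] at this
    exact hp3 ((Nat.prime_dvd_prime_iff_eq Fact.out Nat.prime_three).1 this)
  obtain ⟨u, v, huv, hx, hy⟩ := exists_double_root_field h2 h3 f hD
  refine ⟨u, v, huv, ?_, hx, hy⟩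
  have : 3 * eval f u v = 0 := by
    simp only [eval]; linear_combination u * hx + v * hy
  exact (mul_eq_zero.1 this).resolve_left h3

theorem badCoeff_of_disc {p : ℕ} (hp : p.Prime) (f : Fin 4 → ℤ) {E : ℤ}
    (hD : disc f = p ^ 2 * E) (hE : E % 4 = 0 ∨ E % 4 = 1) (h0 : (p : ℤ) ∣ f 0)
    (h1 : (p : ℤ) ∣ f 1) : BadCoeff p f := by
  refine ⟨h0, h1, ?_⟩
  obtain ⟨a, ha⟩ := h0
  obtain ⟨b, hb⟩ := h1
  have hpp : Prime (p : ℤ) := Nat.prime_iff_prime_int.1 hp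
  simp only [disc] at hD
  rw [ha, hb] at hD
  rw [ha, pow_two]
  generalize f 2 = c at *
  generalize f 3 = d at *
  suffices h : (p : ℤ) ∣ a ∨ (p : ℤ) ∣ c from h.imp (mul_dvd_mul_left _) id
  by_cases hp2 : p = 2
  · subst hp2
    have hE' : E = b ^ 2 * c ^ 2 - 2 * a * c ^ 3 - 8 * b ^ 3 * d - 27 * a ^ 2 * d ^ 2
        + 18 * a * b * c * d := by push_cast at hD; linarith
    have key : ∀ a b c d e : ZMod 4, e = b ^ 2 * c ^ 2 - 2 * a * c ^ 3 - 8 * b ^ 3 * d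
        - 27 * a ^ 2 * d ^ 2 + 18 * a * b * c * d → (e = 0 ∨ e = 1) → 2 * a = 0 ∨ 2 * c = 0 := by
      decide
    have := key a b c d E (by rw [hE']; push_cast; ring) (by
      refine hE.imp (fun h => ?_) (fun h => ?_)
      · exact (ZMod.intCast_zmod_eq_zero_iff_dvd E 4).2 (by omega) 
      · have := (ZMod.intCast_eq_intCast_iff E 1 4).2 (by unfold Int.ModEq; omega)
        simpa using this)
    refine this.imp (fun h => ?_) (fun h => ?_)
    · have h' : ((2 * a : ℤ) : ZMod 4) = 0 := by push_cast; exact h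
      have := (ZMod.intCast_zmod_eq_zero_iff_dvd _ 4).1 h'
      push_cast at *; omega
    · have h' : ((2 * c : ℤ) : ZMod 4) = 0 := by push_cast; exact h
      have := (ZMod.intCast_zmod_eq_zero_iff_dvd _ 4).1 h'
      push_cast at *; omega
  · have hdvd : (p : ℤ) ∣ 4 * a * c ^ 3 := by
      have hp0 : (p : ℤ) ≠ 0 := hpp.ne_zero
      refine ⟨b ^ 2 * c ^ 2 - 4 * p * b ^ 3 * d - 27 * a ^ 2 * d ^ 2
        + 18 * a * b * c * d - E, ?_⟩
      apply mul_left_cancel₀ hp0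
      linear_combination -hD
    have h4 : ¬ (p : ℤ) ∣ 4 := by
      intro h
      have : p ∣ 2 ^ 2 := by exact_mod_cast h
      exact hp2 ((Nat.prime_dvd_prime_iff_eq hp Nat.prime_two).1 (hp.dvd_of_dvd_pow this))
    rcases hpp.dvd_or_dvd hdvd with h | h
    · exact Or.inl ((hpp.dvd_or_dvd h).resolve_left h4)
    · exact Or.inr (hpp.dvd_of_dvd_pow h)

theorem badAt_of_disc {p : ℕ} (hp : p.Prime) (f : Fin 4 → ℤ) {E : ℤ}
    (hD : disc f = p ^ 2 * E) (hE : E % 4 = 0 ∨ E % 4 = 1) : BadAt p f := by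
  have : Fact p.Prime := ⟨hp⟩
  set φ := Int.castRingHom (ZMod p) with hφ
  have hdv : ∀ n : ℤ, φ n = 0 → (p : ℤ) ∣ n := fun n hn =>
    (ZMod.intCast_zmod_eq_zero_iff_dvd n p).1 hn
  obtain ⟨u, v, huv, h0, hx, hy⟩ := exists_double_root (fun i => φ (f i)) (by
    rw [← disc_map, hD]; simp)
  by_cases hv : v = 0
  · subst hv
    have hu : u ≠ 0 := by simpa using huv
    simp [eval, hu] at h0 hy
    exact Or.inl (badCoeff_of_disc hp f hD hE (hdv _ (by simpa using h0)) (hdv _ (by simpa using hy)))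
  · obtain ⟨k, hk⟩ := ZMod.intCast_surjective (u / v)
    have hk' : u = φ k * v := by rw [hφ]; simp [hk, hv]
    refine Or.inr ⟨k, badCoeff_of_disc hp _ (E := E) ?_ hE ?_ ?_⟩
    · rw [disc_act, hD]; ring
    · apply hdv
      have : v ^ 3 * φ (act k (-1) 1 0 f 0) = 0 := by
        rw [← h0, hk']; simp [eval]; ring
      exact (mul_eq_zero.1 this).resolve_left (pow_ne_zero _ hv)
    · apply hdv
      have : v ^ 2 * φ (act k (-1) 1 0 f 1) = 0 := by
        rw [hk'] at hx
        rw [show φ (act k (-1) 1 0 f 1) = act (φ k) (φ (-1)) (φ 1) (φ 0) (fun i => φ (f i)) 1 from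
          congrFun (act_map φ k (-1) 1 0 f) 1]
        simp only [act_one', map_neg, map_one, map_zero]
        linear_combination -hx
      exact (mul_eq_zero.1 this).resolve_left (pow_ne_zero _ hv)

theorem BadCoeff.disc_eq {p : ℕ} {f : Fin 4 → ℤ} (h : BadCoeff p f) :
    ∃ E : ℤ, disc f = p ^ 2 * E ∧ (E % 4 = 0 ∨ E % 4 = 1) := by
  obtain ⟨h0, ⟨b, hb⟩, ⟨a, ha⟩ | ⟨c, hc⟩⟩ := h
  · refine ⟨disc ![a, b, f 2, p * f 3], ?_, disc_mod_four _⟩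
    simp [disc, ha, hb]; ring
  · obtain ⟨a, ha⟩ := h0
    refine ⟨_, ?_, sq_add_four_mul_mod_four (p * b * c + a * f 3)
      (-p ^ 2 * a * c ^ 3 - p * b ^ 3 * f 3 - 7 * a ^ 2 * f 3 ^ 2 + 4 * p * a * b * c * f 3)⟩
    simp [disc, ha, hb, hc]; ring

theorem BadAt.disc_eq {p : ℕ} {f : Fin 4 → ℤ} (h : BadAt p f) :
    ∃ E : ℤ, disc f = p ^ 2 * E ∧ (E % 4 = 0 ∨ E % 4 = 1) := by
  obtain h | ⟨k, h⟩ := h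
  · exact h.disc_eq
  · simpa [disc_act] using h.disc_eq

theorem fund_disc_iff (f : Fin 4 → ℤ) : Fund (disc f) ↔ ∀ p : ℕ, p.Prime → ¬BadAt p f := by
  constructor
  · intro h p hp hb
    obtain ⟨E, hE, hE'⟩ := hb.disc_eq
    exact h p hp E hE hE'
  · intro h p hp E hE hE'
    exact h p hp (badAt_of_disc hp f hE hE')

end BCF

namespace BCF

/-! ### The cubic ring attached to a form -/

section Ring

variable {A : Type*} [CommRing A]

/-- The Delone–Faddeev multiplication table of the form `f`. -/
structure IsTriple (f : Fin 4 → ℤ) (ω θ : A) : Prop where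
  sq : ω ^ 2 = -((f 0 : A) * f 2) + f 1 * ω - f 0 * θ
  mul : ω * θ = -((f 0 : A) * f 3)
  sq' : θ ^ 2 = -((f 1 : A) * f 3) + f 3 * ω - f 2 * θ

/-- `1, ω, θ` are linearly independent over `ℤ`. -/
def Indep (ω θ : A) : Prop :=
  ∀ k l m : ℤ, (k : A) + l * ω + m * θ = 0 → k = 0 ∧ l = 0 ∧ m = 0

theorem Indep.eq {ω θ : A} (h : Indep ω θ) {k l m k' l' m' : ℤ}
    (e : (k : A) + l * ω + m * θ = k' + l' * ω + m' * θ) : k = k' ∧ l = l' ∧ m = m' := by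
  have := h (k - k') (l - l') (m - m') (by push_cast; linear_combination e)
  omega

theorem IsTriple.index {f g : Fin 4 → ℤ} {ω θ ω₀ θ₀ : A} (hf : IsTriple f ω θ)
    (hg : IsTriple g ω₀ θ₀) (hi : Indep ω₀ θ₀) {n₁ n₂ p q r s : ℤ}
    (h₁ : ω = n₁ + p * ω₀ + r * θ₀) (h₂ : θ = n₂ + q * ω₀ + s * θ₀) :
    (fun i => (p * s - q * r) * f i) = act p q r s g := by
  obtain ⟨-, e1, e2⟩ := hi.eq (k := n₁ ^ 2 - p ^ 2 * (g 0 * g 2) - 2 * p * r * (g 0 * g 3)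
      - r ^ 2 * (g 1 * g 3)) (l := 2 * n₁ * p + p ^ 2 * g 1 + r ^ 2 * g 3)
    (m := 2 * n₁ * r - p ^ 2 * g 0 - r ^ 2 * g 2) (k' := -(f 0 * f 2) + f 1 * n₁ - f 0 * n₂)
    (l' := f 1 * p - f 0 * q) (m' := f 1 * r - f 0 * s) (by
      push_cast
      have h := hf.sq
      rw [h₁, h₂] at h
      linear_combination h - p ^ 2 * hg.sq - 2 * p * r * hg.mul - r ^ 2 * hg.sq')
  obtain ⟨-, e3, e4⟩ := hi.eq (k := n₁ * n₂ - p * q * (g 0 * g 2) - (p * s + q * r) * (g 0 * g 3)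
      - r * s * (g 1 * g 3)) (l := n₁ * q + n₂ * p + p * q * g 1 + r * s * g 3)
    (m := n₁ * s + n₂ * r - p * q * g 0 - r * s * g 2) (k' := -(f 0 * f 3))
    (l' := 0) (m' := 0) (by
      push_cast
      have h := hf.mul
      rw [h₁, h₂] at h
      linear_combination h - p * q * hg.sq - (p * s + q * r) * hg.mul - r * s * hg.sq')
  obtain ⟨-, e5, e6⟩ := hi.eq (k := n₂ ^ 2 - q ^ 2 * (g 0 * g 2) - 2 * q * s * (g 0 * g 3)
      - s ^ 2 * (g 1 * g 3)) (l := 2 * n₂ * q + q ^ 2 * g 1 + s ^ 2 * g 3)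
    (m := 2 * n₂ * s - q ^ 2 * g 0 - s ^ 2 * g 2) (k' := -(f 1 * f 3) + f 3 * n₁ - f 2 * n₂)
    (l' := f 3 * p - f 2 * q) (m' := f 3 * r - f 2 * s) (by
      push_cast
      have h := hf.sq'
      rw [h₁, h₂] at h
      linear_combination h - q ^ 2 * hg.sq - 2 * q * s * hg.mul - s ^ 2 * hg.sq')
  apply ext4 <;> simp only [act_zero', act_one', act_two', act_three']
  · linear_combination p * e2 - r * e1
  · linear_combination q * e2 - s * e1 + 2 * p * e4 - 2 * r * e3
  · linear_combination p * e6 - r * e5 - 2 * s * e3 + 2 * q * e4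
  · linear_combination q * e6 - s * e5

theorem IsTriple.act {f : Fin 4 → ℤ} {ω θ : A} (hf : IsTriple f ω θ) (p q r s : ℤ) :
    IsTriple (act p q r s f)
      ((f 0 * p ^ 2 * q + f 1 * p * q * r + f 2 * p * r * s + f 3 * r ^ 2 * s : ℤ)
        + ((p * s - q * r) * p : ℤ) * ω + ((p * s - q * r) * r : ℤ) * θ)
      ((-(f 0 * p * q ^ 2 + f 1 * p * q * s + f 2 * q * r * s + f 3 * r * s ^ 2) : ℤ)
        + ((p * s - q * r) * q : ℤ) * ω + ((p * s - q * r) * s : ℤ) * θ) := by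
  have e1 := hf.sq
  have e2 := hf.mul
  have e3 := hf.sq'
  constructor
  · simp only [act_zero', act_one', act_two']
    push_cast
    linear_combination (p * s - q * r : A) ^ 2 * (p ^ 2 * e1 + 2 * p * r * e2 + r ^ 2 * e3)
  · simp only [act_zero', act_three']
    push_cast
    linear_combination (p * s - q * r : A) ^ 2 * (p * q * e1 + (p * s + q * r) * e2 + r * s * e3)
  · simp only [act_one', act_two', act_three']
    push_cast
    linear_combination (p * s - q * r : A) ^ 2 * (q ^ 2 * e1 + 2 * q * s * e2 + s ^ 2 * e3)

theorem IsTriple.irr [IsDomain A] {f : Fin 4 → ℤ} {ω θ : A} (hf : IsTriple f ω θ)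
    (hi : Indep ω θ) : Irr f := by
  have key : ∀ p q r s : ℤ, p * s - q * r ≠ 0 → eval f p r ≠ 0 := by
    intro p q r s hN h0
    have h := (hf.act p q r s).mul
    have h0' : BCF.act p q r s f 0 = 0 := by rw [← h0]; simp [eval]
    rw [h0', Int.cast_zero, zero_mul, neg_zero] at h
    rcases mul_eq_zero.1 h with h | h
    · obtain ⟨-, h1, h2⟩ := hi _ _ _ h
      have h1 := (mul_eq_zero.1 h1).resolve_left hN
      have h2 := (mul_eq_zero.1 h2).resolve_left hN
      simp [h1, h2] at hN
    · obtain ⟨-, h1, h2⟩ := hi _ _ _ h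
      have h1 := (mul_eq_zero.1 h1).resolve_left hN
      have h2 := (mul_eq_zero.1 h2).resolve_left hN
      simp [h1, h2] at hN
  intro u v huv
  by_contra hne
  by_cases hu : u = 0
  · exact key u 1 v 0 (by simpa [hu] using hne) huv
  · exact key u 0 v 1 (by simpa using hu) huv

/-- `1, ω, θ` span the ring and have the multiplication table of `f`. -/
structure IsTripleBasis (f : Fin 4 → ℤ) (ω θ : A) : Prop extends IsTriple f ω θ where
  indep : Indep ω θ
  span : ∀ x : A, ∃ k l m : ℤ, x = k + l * ω + m * θ

theorem IsTripleBasis.act {f : Fin 4 → ℤ} {ω θ : A} (hf : IsTripleBasis f ω θ) {p q r s : ℤ}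
    (h : (p * s - q * r) ^ 2 = 1) : IsTripleBasis (act p q r s f)
      ((f 0 * p ^ 2 * q + f 1 * p * q * r + f 2 * p * r * s + f 3 * r ^ 2 * s : ℤ)
        + ((p * s - q * r) * p : ℤ) * ω + ((p * s - q * r) * r : ℤ) * θ)
      ((-(f 0 * p * q ^ 2 + f 1 * p * q * s + f 2 * q * r * s + f 3 * r * s ^ 2) : ℤ)
        + ((p * s - q * r) * q : ℤ) * ω + ((p * s - q * r) * s : ℤ) * θ) := by
  refine ⟨hf.toIsTriple.act p q r s, ?_, ?_⟩
  · intro k l m e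
    set P := f 0 * p ^ 2 * q + f 1 * p * q * r + f 2 * p * r * s + f 3 * r ^ 2 * s
    set Q := -(f 0 * p * q ^ 2 + f 1 * p * q * s + f 2 * q * r * s + f 3 * r * s ^ 2)
    obtain ⟨h0, h1, h2⟩ := hf.indep (k + l * P + m * Q)
      ((p * s - q * r) * (l * p + m * q)) ((p * s - q * r) * (l * r + m * s)) (by
        push_cast at e ⊢; linear_combination e)
    have hl : l = 0 := by linear_combination s * h1 - q * h2 - l * h
    have hm : m = 0 := by linear_combination p * h2 - r * h1 - m * h
    simpa [hl, hm] using h0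
  · intro x
    set P := f 0 * p ^ 2 * q + f 1 * p * q * r + f 2 * p * r * s + f 3 * r ^ 2 * s
    set Q := -(f 0 * p * q ^ 2 + f 1 * p * q * s + f 2 * q * r * s + f 3 * r * s ^ 2)
    obtain ⟨k, l, m, rfl⟩ := hf.span x
    refine ⟨k - (s * l - q * m) * P - (p * m - r * l) * Q, s * l - q * m, p * m - r * l, ?_⟩
    have h' : (p * s - q * r : A) ^ 2 = 1 := by exact_mod_cast congrArg (Int.cast : ℤ → A) h
    push_cast
    linear_combination (-l * ω - m * θ) * h'

theorem IsTripleBasis.gequiv {f g : Fin 4 → ℤ} {ω θ : A} (hf : IsTripleBasis f ω θ)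
    (h : GEquiv f g) : ∃ ω' θ' : A, IsTripleBasis g ω' θ' := by
  obtain ⟨p, q, r, s, h, rfl⟩ := h
  exact ⟨_, _, hf.act (by rcases h with h | h <;> simp [h])⟩

theorem IsTripleBasis.gequiv_of_index {f g : Fin 4 → ℤ} {ω θ ω₀ θ₀ : A} (hf : IsTriple f ω θ)
    (hg : IsTripleBasis g ω₀ θ₀) {n₁ n₂ p q r s : ℤ}
    (h₁ : ω = n₁ + p * ω₀ + r * θ₀) (h₂ : θ = n₂ + q * ω₀ + s * θ₀)
    (h : p * s - q * r = 1 ∨ p * s - q * r = -1) : GEquiv g f := by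
  have := hf.index hg.toIsTriple hg.indep h₁ h₂
  rcases h with h | h
  · refine ⟨p, q, r, s, Or.inl h, ?_⟩
    simpa [h] using this
  · refine ⟨-p, -q, -r, -s, Or.inr (by linarith), ?_⟩
    have e : BCF.act (-p) (-q) (-r) (-s) g = -BCF.act p q r s g := by
      apply ext4 <;> simp <;> ring
    rw [e, ← this, h]
    funext i
    simp

theorem Indep.index_ne_zero {ω θ ω₀ θ₀ : A}
    (hi : Indep ω θ) {n₁ n₂ p q r s : ℤ}
    (h₁ : ω = n₁ + p * ω₀ + r * θ₀) (h₂ : θ = n₂ + q * ω₀ + s * θ₀) : p * s - q * r ≠ 0 := by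
  intro h
  have h' : (p : A) * s - q * r = 0 := by exact_mod_cast congrArg (Int.cast : ℤ → A) h
  obtain ⟨-, hs, hr⟩ := hi (r * n₂ - s * n₁) s (-r) (by
    push_cast; rw [h₁, h₂]; linear_combination ω₀ * h')
  obtain ⟨-, hq, hp⟩ := hi (p * n₂ - q * n₁) q (-p) (by
    push_cast; rw [h₁, h₂]; linear_combination -θ₀ * h')
  obtain rfl : r = 0 := by linarith
  obtain rfl : p = 0 := by linarith
  have := hi n₁ (-1) 0 (by push_cast; rw [h₁]; push_cast; ring)
  omega

theorem IsTripleBasis.gequiv_basis {f g : Fin 4 → ℤ} {ω θ ω₀ θ₀ : A}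
    (hf : IsTripleBasis f ω θ) (hg : IsTripleBasis g ω₀ θ₀) : GEquiv g f := by
  obtain ⟨n₁, p, r, h₁⟩ := hg.span ω
  obtain ⟨n₂, q, s, h₂⟩ := hg.span θ
  obtain ⟨m₁, p', r', h₃⟩ := hf.span ω₀
  obtain ⟨m₂, q', s', h₄⟩ := hf.span θ₀
  refine hg.gequiv_of_index hf.toIsTriple h₁ h₂ (Int.isUnit_iff.1 ?_)
  refine IsUnit.of_mul_eq_one (p' * s' - q' * r') ?_
  obtain ⟨-, a1, a2⟩ := hf.indep.eq (k := n₁ + p * m₁ + r * m₂) (l := p * p' + r * q')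
    (m := p * r' + r * s') (k' := 0) (l' := 1) (m' := 0) (by
      push_cast; linear_combination -h₁ - p * h₃ - r * h₄)
  obtain ⟨-, a3, a4⟩ := hf.indep.eq (k := n₂ + q * m₁ + s * m₂) (l := q * p' + s * q')
    (m := q * r' + s * s') (k' := 0) (l' := 0) (m' := 1) (by
      push_cast; linear_combination -h₂ - q * h₃ - s * h₄)
  linear_combination a1 * (q * r' + s * s') + a4 - a2 * (q * p' + s * q')

theorem IsTriple.map {B : Type*} [CommRing B] (φ : A →+* B) {f : Fin 4 → ℤ} {ω θ : A}
    (h : IsTriple f ω θ) : IsTriple f (φ ω) (φ θ) := by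
  constructor
  · simpa using congrArg φ h.sq
  · simpa using congrArg φ h.mul
  · simpa using congrArg φ h.sq'

theorem IsTripleBasis.map {B : Type*} [CommRing B] (φ : A ≃+* B) {f : Fin 4 → ℤ} {ω θ : A}
    (h : IsTripleBasis f ω θ) : IsTripleBasis f (φ ω) (φ θ) := by
  refine ⟨h.toIsTriple.map φ.toRingHom, fun k l m e => ?_, fun x => ?_⟩
  · apply h.indep
    apply φ.injective
    simpa using e
  · obtain ⟨k, l, m, e⟩ := h.span (φ.symm x)
    exact ⟨k, l, m, by simpa using congrArg φ e⟩

theorem IsTripleBasis.ringEquiv {B : Type*} [CommRing B] {f : Fin 4 → ℤ} {ω θ : A} {ω' θ' : B}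
    (h : IsTripleBasis f ω θ) (h' : IsTripleBasis f ω' θ') : Nonempty (A ≃+* B) := by
  choose k l m e using h.span
  have ek : ∀ a b c : ℤ, k (a + b * ω + c * θ) = a ∧ l (a + b * ω + c * θ) = b ∧
      m (a + b * ω + c * θ) = c := fun a b c => h.indep.eq (e _).symm
  let φ : A → B := fun x => k x + l x * ω' + m x * θ'
  have hφ : ∀ a b c : ℤ, φ (a + b * ω + c * θ) = a + b * ω' + c * θ' := fun a b c => by
    simp only [φ, ek]
  have hmul : ∀ x y, φ (x * y) = φ x * φ y := by
    intro x y
    obtain ⟨a, b, c, rfl⟩ := h.span x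
    obtain ⟨a', b', c', rfl⟩ := h.span y
    have e1 : (a + b * ω + c * θ) * (a' + b' * ω + c' * θ) =
      (a * a' - b * b' * (f 0 * f 2) - (b * c' + b' * c) * (f 0 * f 3)
        - c * c' * (f 1 * f 3) : ℤ) + (a * b' + a' * b + b * b' * f 1 + c * c' * f 3 : ℤ) * ω
        + (a * c' + a' * c - b * b' * f 0 - c * c' * f 2 : ℤ) * θ := by
      push_cast
      linear_combination b * b' * h.sq + (b * c' + b' * c) * h.mul + c * c' * h.sq'
    rw [e1, hφ, hφ, hφ]
    push_cast
    linear_combination -b * b' * h'.sq - (b * c' + b' * c) * h'.mul - c * c' * h'.sq'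
  have hadd : ∀ x y, φ (x + y) = φ x + φ y := by
    intro x y
    obtain ⟨a, b, c, rfl⟩ := h.span x
    obtain ⟨a', b', c', rfl⟩ := h.span y
    rw [show a + b * ω + c * θ + (a' + b' * ω + c' * θ) =
      (a + a' : ℤ) + (b + b' : ℤ) * ω + (c + c' : ℤ) * θ by push_cast; ring, hφ, hφ, hφ]
    push_cast
    ring
  have hone : φ 1 = 1 := by simpa using hφ 1 0 0
  refine ⟨RingEquiv.ofBijective (RingHom.mk' ⟨⟨φ, hone⟩, hmul⟩ hadd)
    ⟨(injective_iff_map_eq_zero _).2 fun x hx => ?_, fun y => ?_⟩⟩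
  · obtain ⟨a, b, c, rfl⟩ := h.span x
    obtain ⟨rfl, rfl, rfl⟩ := h'.indep _ _ _ ((hφ a b c).symm.trans hx)
    simp
  · obtain ⟨a, b, c, rfl⟩ := h'.span y
    exact ⟨a + b * ω + c * θ, hφ a b c⟩

end Ring
end BCF

namespace BCF

open NumberField Module

theorem exists_isTriple {A : Type*} [CommRing A] {α β : A} (hi : Indep α β)
    (hs : ∀ x : A, ∃ k l m : ℤ, x = k + l * α + m * β) :
    ∃ (f : Fin 4 → ℤ) (ω θ : A), IsTripleBasis f ω θ := by
  obtain ⟨n₀, n₁, n₂, h⟩ := hs (α * β)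
  set ω := α - n₂ with hω
  set θ := β - n₁ with hθ
  have hi' : Indep ω θ := by
    intro k l m e
    obtain ⟨h1, h2, h3⟩ := hi (k - l * n₂ - m * n₁) l m (by
      rw [hω, hθ] at e; push_cast; linear_combination e)
    subst h2 h3
    simpa using h1
  have hs' : ∀ x : A, ∃ k l m : ℤ, x = k + l * ω + m * θ := by
    intro x
    obtain ⟨k, l, m, rfl⟩ := hs x
    exact ⟨k + l * n₂ + m * n₁, l, m, by rw [hω, hθ]; push_cast; ring⟩
  have hmul : ω * θ = ((n₀ + n₁ * n₂ : ℤ) : A) := by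
    rw [hω, hθ]; push_cast; linear_combination h
  generalize n₀ + n₁ * n₂ = n at hmul
  obtain ⟨m, b, a, h1⟩ := hs' (ω ^ 2)
  obtain ⟨l, d, c, h2⟩ := hs' (θ ^ 2)
  obtain ⟨-, e1, e2⟩ := hi'.eq (k := b * n + a * l) (l := a * d) (m := m + a * c)
    (k' := 0) (l' := n) (m' := 0) (by
      push_cast; linear_combination ω * hmul - b * hmul - θ * h1 - a * h2)
  obtain ⟨-, e3, e4⟩ := hi'.eq (k := d * m + c * n) (l := l + d * b) (m := d * a)
    (k' := 0) (l' := 0) (m' := n) (by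
      push_cast; linear_combination θ * hmul - c * hmul - ω * h2 - d * h1)
  refine ⟨![-a, b, -c, d], ω, θ, ⟨?_, ?_, ?_⟩, hi', hs'⟩
  · simp
    rw [h1]
    have : (m : A) + a * c = 0 := by exact_mod_cast congrArg (Int.cast : ℤ → A) e2
    linear_combination this
  · simp
    rw [hmul]
    exact_mod_cast congrArg (Int.cast : ℤ → A) e1.symm
  · simp
    rw [h2]
    have : (l : A) + d * b = 0 := by exact_mod_cast congrArg (Int.cast : ℤ → A) e3
    linear_combination this

section NumberField

variable {K : Type*} [Field K] [NumberField K]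

theorem top_le_span {A : Type*} [CommRing A] {α β : A}
    (hs : ∀ x : A, ∃ k l m : ℤ, x = k + l * α + m * β) :
    ⊤ ≤ Submodule.span ℤ (Set.range ![1, α, β]) := by
  intro x _
  obtain ⟨k, l, m, rfl⟩ := hs x
  rw [Submodule.mem_span_range_iff_exists_fun]
  exact ⟨![k, l, m], by simp [Fin.sum_univ_three]⟩

theorem indep_of_span (h3 : finrank ℚ K = 3) {α β : 𝓞 K}
    (hs : ∀ x : 𝓞 K, ∃ k l m : ℤ, x = k + l * α + m * β) : Indep α β := by
  have h := linearIndependent_of_top_le_span_of_card_eq_finrank (top_le_span hs)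
    (by rw [RingOfIntegers.rank, h3]; rfl)
  intro k l m e
  have := Fintype.linearIndependent_iff.1 h ![k, l, m] (by simpa [Fin.sum_univ_three] using e)
  exact ⟨this 0, this 1, this 2⟩

theorem exists_span (h3 : finrank ℚ K = 3) :
    ∃ α β : 𝓞 K, ∀ x : 𝓞 K, ∃ k l m : ℤ, x = k + l * α + m * β := by
  set S := Submodule.span ℤ {(1 : 𝓞 K)} with hS
  have hS1 : finrank ℤ S = 1 := by
    rw [← (LinearEquiv.toSpanNonzeroSingleton ℤ (𝓞 K) 1 one_ne_zero).finrank_eq, finrank_self]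
  have hQ : finrank ℤ (𝓞 K ⧸ S) = 2 := by
    have := Submodule.finrank_quotient_add_finrank S
    rw [hS1, RingOfIntegers.rank, h3] at this
    omega
  have htf : IsTorsionFree ℤ (𝓞 K ⧸ S) := by
    rw [Module.isTorsionFree_iff_smul_eq_zero]
    intro n x
    obtain ⟨x, rfl⟩ := Submodule.Quotient.mk_surjective S x
    rw [← Submodule.Quotient.mk_smul, Submodule.Quotient.mk_eq_zero, Submodule.Quotient.mk_eq_zero]
    intro h
    refine or_iff_not_imp_left.2 fun hn => ?_
    obtain ⟨k, hk⟩ := Submodule.mem_span_singleton.1 h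
    have hk' : (k : K) = n * algebraMap (𝓞 K) K x := by
      simpa using congrArg (algebraMap (𝓞 K) K) hk
    have hn' : (n : K) ≠ 0 := by exact_mod_cast hn
    have hx : algebraMap (𝓞 K) K x = algebraMap ℚ K (k / n) := by
      rw [map_div₀]; simp [hk', hn']
    have h_integral : IsIntegral ℤ (k / n : ℚ) := by
      have := x.isIntegral_coe
      rw [hx] at this
      exact (isIntegral_algebraMap_iff (algebraMap ℚ K).injective).1 this
    obtain ⟨j, hj⟩ := IsIntegrallyClosed.isIntegral_iff.1 h_integral
    refine Submodule.mem_span_singleton.2 ⟨j, ?_⟩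
    apply RingOfIntegers.coe_injective
    rw [hx, ← hj]
    simp
  have : Module.Free ℤ (𝓞 K ⧸ S) := inferInstance
  let b := Module.finBasisOfFinrankEq ℤ (𝓞 K ⧸ S) hQ
  obtain ⟨α, hα⟩ := Submodule.Quotient.mk_surjective S (b 0)
  obtain ⟨β, hβ⟩ := Submodule.Quotient.mk_surjective S (b 1)
  refine ⟨α, β, fun x => ?_⟩
  have hx := b.sum_repr (Submodule.Quotient.mk x)
  rw [Fin.sum_univ_two, ← hα, ← hβ, ← Submodule.Quotient.mk_smul, ← Submodule.Quotient.mk_smul,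
    ← Submodule.Quotient.mk_add, eq_comm, Submodule.Quotient.eq] at hx
  obtain ⟨k, hk⟩ := Submodule.mem_span_singleton.1 hx
  rw [eq_sub_iff_add_eq, ← add_assoc] at hk
  simp only [zsmul_eq_mul, mul_one] at hk
  exact ⟨k, _, _, hk.symm⟩

theorem exists_isTripleBasis (h3 : finrank ℚ K = 3) :
    ∃ (f : Fin 4 → ℤ) (ω θ : 𝓞 K), IsTripleBasis f ω θ := by
  obtain ⟨α, β, hs⟩ := exists_span (K := K) h3
  exact exists_isTriple (indep_of_span h3 hs) hs

theorem IsTripleBasis.discr_eq {f : Fin 4 → ℤ} {ω θ : 𝓞 K} (h : IsTripleBasis f ω θ)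
    (h3 : finrank ℚ K = 3) : discr K = disc f := by
  let b := basisOfTopLeSpanOfCardEqFinrank ![1, ω, θ] (top_le_span h.span)
    (by rw [RingOfIntegers.rank, h3]; rfl)
  have hb : ⇑b = ![1, ω, θ] := coe_basisOfTopLeSpanOfCardEqFinrank _ _ _
  have hrepr : ∀ k l m : ℤ, ⇑(b.repr (k + l * ω + m * θ)) = ![k, l, m] := by
    intro k l m
    rw [← b.repr_sum_self ![k, l, m], hb]
    simp [Fin.sum_univ_three]
  have htr : ∀ x : 𝓞 K, Algebra.trace ℤ (𝓞 K) x =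
      b.repr x 0 + b.repr (x * ω) 1 + b.repr (x * θ) 2 := by
    intro x
    rw [Algebra.trace_eq_matrix_trace b, Matrix.trace_fin_three]
    simp [Algebra.leftMulMatrix_eq_repr_mul, hb]
  have t0 : ∀ k : ℤ, Algebra.trace ℤ (𝓞 K) (k : 𝓞 K) = 3 * k := by
    intro k
    have := Algebra.trace_algebraMap (S := 𝓞 K) k
    rw [RingOfIntegers.rank, h3] at this
    simpa using this
  have t1 : Algebra.trace ℤ (𝓞 K) ω = f 1 := by
    rw [htr, ← pow_two, h.sq, h.mul]
    have e1 := hrepr 0 1 0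
    have e2 := hrepr (-(f 0 * f 2)) (f 1) (-f 0)
    have e3 := hrepr (-(f 0 * f 3)) 0 0
    push_cast at e1 e2 e3
    simp only [zero_mul, add_zero, one_mul, zero_add] at e1 e3
    simp only [neg_mul, ← sub_eq_add_neg] at e2
    rw [e1, e2, e3]
    simp
  have t2 : Algebra.trace ℤ (𝓞 K) θ = -f 2 := by
    rw [htr, ← pow_two, h.sq', mul_comm, h.mul]
    have e1 := hrepr 0 0 1
    have e2 := hrepr (-(f 1 * f 3)) (f 3) (-f 2)
    have e3 := hrepr (-(f 0 * f 3)) 0 0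
    push_cast at e1 e2 e3
    simp only [zero_mul, add_zero, one_mul, zero_add] at e1 e3
    simp only [neg_mul, ← sub_eq_add_neg] at e2
    rw [e1, e2, e3]
    simp
  have tlin : ∀ k l m : ℤ, Algebra.trace ℤ (𝓞 K) (k + l * ω + m * θ) = 3 * k + l * f 1 - m * f 2 := by
    intro k l m
    rw [map_add, map_add, t0, ← zsmul_eq_mul, ← zsmul_eq_mul, map_zsmul, map_zsmul, t1, t2]
    simp
    ring
  have t11 : Algebra.trace ℤ (𝓞 K) (ω * ω) = f 1 ^ 2 - 2 * f 0 * f 2 := by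
    have := tlin (-(f 0 * f 2)) (f 1) (-f 0)
    rw [← pow_two, h.sq]
    push_cast at this
    rw [neg_mul, ← sub_eq_add_neg] at this
    rw [this]; ring
  have t12 : Algebra.trace ℤ (𝓞 K) (ω * θ) = - 3 * f 0 * f 3 := by
    have := t0 (-(f 0 * f 3))
    rw [h.mul]
    push_cast at this
    rw [this]; ring
  have t22 : Algebra.trace ℤ (𝓞 K) (θ * θ) = f 2 ^ 2 - 2 * f 1 * f 3 := by
    have := tlin (-(f 1 * f 3)) (f 3) (-f 2)
    rw [← pow_two, h.sq']
    push_cast at this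
    rw [neg_mul, ← sub_eq_add_neg] at this
    rw [this]; ring
  have t00 : Algebra.trace ℤ (𝓞 K) 1 = 3 := by simpa using t0 1
  rw [← discr_eq_discr K b, Algebra.discr_def, Matrix.det_fin_three]
  simp only [Algebra.traceMatrix_apply, Algebra.traceForm_apply, hb]
  simp only [Matrix.cons_val, mul_one, one_mul, mul_comm θ ω, t00, t1, t2, t11, t12, t22, disc]
  ring

theorem IsTripleBasis.fieldEquiv {L : Type*} [Field L] [NumberField L] {f : Fin 4 → ℤ}
    {ω θ : 𝓞 K} {ω' θ' : 𝓞 L} (h : IsTripleBasis f ω θ) (h' : IsTripleBasis f ω' θ') :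
    Nonempty (K ≃+* L) := by
  obtain ⟨e⟩ := h.ringEquiv h'
  exact ⟨IsFractionRing.ringEquivOfRingEquiv e⟩

end NumberField
end BCF

namespace BCF

open NumberField Module

theorem isIntegral_of_cubic {R : Type*} [CommRing R] {x : R} {u v w : ℤ}
    (h : x ^ 3 + u * x ^ 2 + v * x + w = 0) : IsIntegral ℤ x := by
  refine ⟨Polynomial.X ^ 3 + Polynomial.C u * Polynomial.X ^ 2 + Polynomial.C v * Polynomial.X
    + Polynomial.C w, by monicity!, ?_⟩
  simp only [Polynomial.eval₂_add, Polynomial.eval₂_mul, Polynomial.eval₂_C, Polynomial.eval₂_X,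
    Polynomial.eval₂_pow]
  exact h

theorem exists_field {f : Fin 4 → ℤ} (hf : Irr f) : ∃ K : IntermediateField ℚ ℂ,
    finrank ℚ K = 3 ∧ ∃ ω θ : 𝓞 K, IsTriple f ω θ ∧ Indep ω θ := by
  have ha : f 0 ≠ 0 := hf.coeff_zero_ne
  have hd : f 3 ≠ 0 := hf.coeff_three_ne
  let P : Cubic ℚ := ⟨f 0, f 1, f 2, f 3⟩
  have hPa : P.a ≠ 0 := Int.cast_ne_zero.2 ha
  have hdeg : P.toPoly.natDegree = 3 := Cubic.natDegree_of_a_ne_zero hPa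
  have hirr : Irreducible P.toPoly := by
    refine Polynomial.irreducible_of_degree_le_three_of_not_isRoot (by simp [hdeg]) fun x hx => ?_
    have h0 : eval f x.num x.den = 0 := by
      have h1 : (f 0 : ℚ) * x ^ 3 + f 1 * x ^ 2 + f 2 * x + f 3 = 0 := by
        simpa [Polynomial.IsRoot, Cubic.toPoly, P] using hx
      have hx' : x * x.den = x.num := Rat.mul_den_eq_num x
      have : ((eval f x.num x.den : ℤ) : ℚ) = 0 := by
        simp only [eval]
        push_cast
        rw [← hx']
        linear_combination (x.den : ℚ) ^ 3 * h1
      exact_mod_cast this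
    exact x.den_nz (by exact_mod_cast (hf _ _ h0).2)
  obtain ⟨t, ht⟩ := IsAlgClosed.exists_aeval_eq_zero ℂ P.toPoly
    (by rw [Polynomial.degree_eq_natDegree hirr.ne_zero, hdeg]; norm_num)
  have hmin : (minpoly ℚ t).natDegree = 3 := by
    rw [← minpoly.eq_of_irreducible hirr ht, Polynomial.natDegree_mul_C, hdeg]
    simp [hirr.ne_zero]
  have htint : IsIntegral ℚ t := by
    by_contra h
    simp [minpoly.eq_zero h] at hmin
  have ht' : (f 0 : ℂ) * t ^ 3 + f 1 * t ^ 2 + f 2 * t + f 3 = 0 := by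
    simpa [Cubic.toPoly, P] using ht
  have ht0 : t ≠ 0 := by
    rintro rfl
    simp at ht'
    exact hd ht'
  set K := IntermediateField.adjoin ℚ {t} with hK
  have htK : t ∈ K := IntermediateField.mem_adjoin_simple_self ℚ t
  have hωint : IsIntegral ℤ (-f 0 * t : ℂ) :=
    isIntegral_of_cubic (u := -f 1) (v := f 0 * f 2) (w := -(f 0 ^ 2 * f 3)) (by
      push_cast; linear_combination -(f 0 : ℂ) ^ 2 * ht')
  have hθint : IsIntegral ℤ (f 3 / t : ℂ) :=
    isIntegral_of_cubic (u := f 2) (v := f 1 * f 3) (w := f 0 * f 3 ^ 2) (by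
      push_cast; field_simp; linear_combination (f 3 : ℂ) ^ 2 * ht')
  have hωK : (-f 0 * t : ℂ) ∈ K := K.mul_mem (K.neg_mem (intCast_mem K _)) htK
  have hθK : (f 3 / t : ℂ) ∈ K := K.div_mem (intCast_mem K _) htK
  let ω : 𝓞 K := ⟨⟨_, hωK⟩, (isIntegral_algebraMap_iff (algebraMap K ℂ).injective).1 hωint⟩
  let θ : 𝓞 K := ⟨⟨_, hθK⟩, (isIntegral_algebraMap_iff (algebraMap K ℂ).injective).1 hθint⟩
  let ι : 𝓞 K →+* ℂ := (algebraMap K ℂ).comp (algebraMap (𝓞 K) K)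
  have hι : Function.Injective ι := (algebraMap K ℂ).injective.comp RingOfIntegers.coe_injective
  have hω : ι ω = -f 0 * t := rfl
  have hθ : ι θ = f 3 / t := rfl
  refine ⟨K, (IntermediateField.adjoin.finrank htint).trans hmin, ω, θ, ⟨?_, ?_, ?_⟩, ?_⟩
  · apply hι
    simp only [map_add, map_sub, map_mul, map_neg, map_pow, map_intCast, hω, hθ]
    field_simp
    linear_combination ht'
  · apply hι
    simp only [map_mul, map_neg, map_intCast, hω, hθ]
    field_simp
  · apply hι
    simp only [map_add, map_sub, map_mul, map_neg, map_pow, map_intCast, hω, hθ]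
    field_simp
    linear_combination ht'
  · intro k l m e
    have e := congrArg ι e
    simp only [map_add, map_mul, map_intCast, hω, hθ, map_zero] at e
    have e' : (-(l * f 0) : ℂ) * t ^ 2 + k * t + m * f 3 = 0 := by
      field_simp at e
      linear_combination e
    let Q : Cubic ℚ := ⟨0, -(l * f 0), k, m * f 3⟩
    have hQ : Polynomial.aeval t Q.toPoly = 0 := by
      simpa [Cubic.toPoly, Q] using e'
    have hQ0 : Q.toPoly = 0 := by
      refine Polynomial.eq_zero_of_dvd_of_natDegree_lt (minpoly.dvd ℚ t hQ) ?_
      rw [hmin]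
      exact (Cubic.natDegree_of_a_eq_zero rfl).trans_lt (by norm_num)
    rw [Cubic.toPoly_eq_zero_iff, Cubic.ext_iff] at hQ0
    obtain ⟨-, h1, h2, h3⟩ := hQ0
    have h1 : -((l : ℚ) * f 0) = 0 := h1
    have h2 : (k : ℚ) = 0 := h2
    have h3 : (m : ℚ) * f 3 = 0 := h3
    refine ⟨by exact_mod_cast h2, ?_, ?_⟩
    · simpa [ha] using h1
    · simpa [hd] using h3

theorem Fund.isTripleBasis {f g : Fin 4 → ℤ} (hF : Fund (disc f)) {A : Type*} [CommRing A]
    {ω θ ω₀ θ₀ : A} (hf : IsTriple f ω θ) (hi : Indep ω θ) (hg : IsTripleBasis g ω₀ θ₀) :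
    ∃ ω' θ' : A, IsTripleBasis f ω' θ' := by
  obtain ⟨n₁, p, r, h₁⟩ := hg.span ω
  obtain ⟨n₂, q, s, h₂⟩ := hg.span θ
  have hN := hi.index_ne_zero h₁ h₂
  have hidx := hf.index hg.toIsTriple hg.indep h₁ h₂
  refine hg.gequiv (hg.gequiv_of_index hf h₁ h₂ (Int.isUnit_iff.1 ?_))
  set N := p * s - q * r with hNdef
  have hD : disc f = N ^ 2 * disc g := by
    have e := congrArg disc hidx
    rw [disc_act, ← hNdef] at e
    have e' : disc (fun i => N * f i) = N ^ 4 * disc f := by simp only [disc]; ring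
    rw [e'] at e
    apply mul_left_cancel₀ (pow_ne_zero 4 hN)
    rw [e]; ring
  by_contra hu
  obtain ⟨l, hl, hlN⟩ := Nat.exists_prime_and_dvd (n := N.natAbs) (fun h => hu (Int.isUnit_iff_natAbs_eq.2 h))
  obtain ⟨M, hM⟩ : (l : ℤ) ∣ N := Int.natCast_dvd.2 hlN
  refine hF l hl (M ^ 2 * disc g) (by rw [hD, hM]; ring) ?_
  have h1 := disc_mod_four g
  have h2 := sq_add_four_mul_mod_four M 0
  rw [mul_zero, add_zero] at h2
  rw [Int.mul_emod]
  rcases h1 with h1 | h1 <;> rcases h2 with h2 | h2 <;> simp [h1, h2]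

end BCF

namespace BCF

open NumberField Module

section NumberField

variable {K : Type*} [Field K]

theorem not_mul_eq {A : Type*} [CommRing A] {f : Fin 4 → ℤ} {ω θ : A} (h : IsTripleBasis f ω θ)
    {p : ℕ} {k l m : ℤ} (hd : (p : A) ∣ k + l * ω + m * θ) :
    (p : ℤ) ∣ k ∧ (p : ℤ) ∣ l ∧ (p : ℤ) ∣ m := by
  obtain ⟨x, hx⟩ := hd
  obtain ⟨a, b, c, rfl⟩ := h.span x
  obtain ⟨e1, e2, e3⟩ := h.indep.eq (k' := p * a) (l' := p * b) (m' := p * c)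
    (hx.trans (by push_cast; ring))
  exact ⟨⟨_, e1⟩, ⟨_, e2⟩, ⟨_, e3⟩⟩

theorem not_dvd_left {A : Type*} [CommRing A] {f : Fin 4 → ℤ} {ω θ : A} (h : IsTripleBasis f ω θ)
    {p : ℕ} (hp : p.Prime) : ¬ (p : A) ∣ ω := by
  intro hd
  have := (not_mul_eq h (k := 0) (l := 1) (m := 0) (by simpa using hd)).2.1
  exact hp.one_lt.ne' (Nat.dvd_one.1 (by exact_mod_cast this))

variable [NumberField K]

theorem dvd_of_cubic {p : ℕ} (hp : p.Prime) {x : 𝓞 K} {u v w : ℤ}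
    (h : x ^ 3 + (p * u : ℤ) * x ^ 2 + (p ^ 2 * v : ℤ) * x + (p ^ 3 * w : ℤ) = 0) :
    (p : 𝓞 K) ∣ x := by
  have hp0 : (p : K) ≠ 0 := by exact_mod_cast hp.ne_zero
  have h' : (x : K) ^ 3 + (p * u : ℤ) * x ^ 2 + (p ^ 2 * v : ℤ) * x + (p ^ 3 * w : ℤ) = 0 := by
    have := congrArg (algebraMap (𝓞 K) K) h
    simp only [map_add, map_mul, map_pow, map_intCast, map_zero] at this
    exact this
  have hi : IsIntegral ℤ ((x : K) / p) := isIntegral_of_cubic (u := u) (v := v) (w := w) (by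
    push_cast at h'
    field_simp
    linear_combination h')
  obtain ⟨y, hy⟩ := IsIntegralClosure.isIntegral_iff (A := 𝓞 K).1 hi
  refine ⟨y, RingOfIntegers.coe_injective ?_⟩
  rw [map_mul, map_natCast, hy]
  exact (mul_div_cancel₀ _ hp0).symm

theorem BadCoeff.totallyRamified {p : ℕ} (hp : p.Prime) {f : Fin 4 → ℤ} {ω θ : 𝓞 K}
    (h : IsTripleBasis f ω θ) (hb : BadCoeff p f) :
    ∃ P : Ideal (𝓞 K), P.IsPrime ∧ Ideal.span {(p : 𝓞 K)} = P ^ 3 := by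
  obtain ⟨⟨a, ha⟩, ⟨b, hb⟩, hac⟩ := hb
  have hcub : ω ^ 3 - f 1 * ω ^ 2 + f 0 * f 2 * ω - f 0 ^ 2 * f 3 = 0 := by
    linear_combination ω * h.sq - f 0 * h.mul
  have hcub' : θ ^ 3 + f 2 * θ ^ 2 + f 1 * f 3 * θ + f 0 * f 3 ^ 2 = 0 := by
    linear_combination θ * h.sq' + f 3 * h.mul
  have hpp : Prime (p : ℤ) := Nat.prime_iff_prime_int.1 hp
  have hpa : ¬ (p : ℤ) ^ 2 ∣ f 0 := by
    rintro ⟨a', ha'⟩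
    refine not_dvd_left h hp (dvd_of_cubic hp (u := -b) (v := a' * f 2) (w := -(p * a' ^ 2 * f 3)) ?_)
    rw [ha', hb] at hcub
    push_cast at hcub ⊢
    linear_combination hcub
  obtain ⟨c, hc⟩ := hac.resolve_left hpa
  have hpd : ¬ (p : ℤ) ∣ f 3 := by
    rintro ⟨d, hd⟩
    refine not_dvd_left h hp (dvd_of_cubic hp (u := -b) (v := a * c) (w := -(a ^ 2 * d)) ?_)
    rw [ha, hb, hc, hd] at hcub
    push_cast at hcub ⊢
    linear_combination hcub
  rw [ha, hb, hc] at hcub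
  rw [ha, hb, hc] at hcub'
  have e1 := h.sq
  have e2 := h.mul
  have e3 := h.sq'
  rw [ha, hb, hc] at e1
  rw [hb, hc] at e3
  rw [ha] at e2
  push_cast at hcub hcub' e1 e2 e3
  have hne : Ideal.span {(p : 𝓞 K)} ≠ ⊤ := by
    rw [Ne, Ideal.span_singleton_eq_top]
    intro hu
    exact not_dvd_left h hp (hu.dvd)
  obtain ⟨P, hP, hle⟩ := Ideal.exists_le_maximal _ hne
  have hpP : (p : 𝓞 K) ∈ P := hle (Ideal.mem_span_singleton_self _)
  have hdP : ∀ x : 𝓞 K, (p : 𝓞 K) ∣ x → x ∈ P := fun x hx => P.mem_of_dvd hx hpP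
  have hPp := hP.isPrime
  have hωP : ω ∈ P := hPp.mem_of_pow_mem 3 (hdP _
    ⟨b * ω ^ 2 - p * a * c * ω + p * a ^ 2 * f 3, by linear_combination hcub⟩)
  have hθP : θ ∈ P := hPp.mem_of_pow_mem 3 (hdP _
    ⟨-c * θ ^ 2 - b * f 3 * θ - a * f 3 ^ 2, by linear_combination hcub'⟩)
  have hmem : ∀ x ∈ P, ∃ k l m : ℤ, x = p * k + l * ω + m * θ := by
    intro x hx
    obtain ⟨k, l, m, rfl⟩ := h.span x
    suffices hk : (p : ℤ) ∣ k by
      obtain ⟨k', rfl⟩ := hk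
      exact ⟨k', l, m, by push_cast; ring⟩
    have hkP : (k : 𝓞 K) ∈ P := by
      have := P.sub_mem (P.sub_mem hx (P.mul_mem_left (l : 𝓞 K) hωP))
        (P.mul_mem_left (m : 𝓞 K) hθP)
      ring_nf at this
      exact this
    by_contra hk
    obtain ⟨u, v, huv⟩ := (Prime.coprime_iff_not_dvd hpp).2 hk
    apply hP.ne_top
    rw [Ideal.eq_top_iff_one]
    have e : (1 : 𝓞 K) = u * p + v * k := by exact_mod_cast congrArg (Int.cast : ℤ → 𝓞 K) huv.symm
    rw [e]
    exact P.add_mem (P.mul_mem_left _ hpP) (P.mul_mem_left _ hkP)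
  have hP3 : P ^ 3 ≤ Ideal.span {(p : 𝓞 K)} := by
    rw [pow_succ, pow_two, Ideal.mul_le]
    have hz : ∀ z ∈ P, ∀ x ∈ P * P, (p : 𝓞 K) ∣ x * z := by
      intro z hz x hx
      induction hx using Submodule.mul_induction_on' with
      | mem_mul_mem x hx y hy =>
        obtain ⟨k, l, m, rfl⟩ := hmem x hx
        obtain ⟨k', l', m', rfl⟩ := hmem y hy
        obtain ⟨k'', l'', m'', rfl⟩ := hmem z hz
        rw [← Ideal.mem_span_singleton, ← Ideal.Quotient.eq_zero_iff_mem]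
        set q := Ideal.Quotient.mk (Ideal.span {(p : 𝓞 K)}) with hq
        have hqp : q p = 0 := Ideal.Quotient.eq_zero_iff_mem.2 (Ideal.mem_span_singleton_self _)
        have q1 := congrArg q e1
        have q2 := congrArg q e2
        have q3 := congrArg q e3
        simp only [map_add, map_sub, map_mul, map_neg, map_pow, hqp, zero_mul, mul_zero] at q1 q2 q3 ⊢
        generalize q ω = ω at *
        generalize q θ = θ at *
        simp only [zero_add, neg_zero, sub_zero] at q1 q2 q3 ⊢
        have q4 : θ ^ 3 = 0 := by linear_combination θ * q3 + q (f 3) * q2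
        linear_combination q l * q l' * q l'' * ω * q1
          + (q l * q l' * q m'' + q l * q m' * q l'' + q m * q l' * q l'') * ω * q2
          + (q l * q m' * q m'' + q m * q l' * q m'' + q m * q m' * q l'') * θ * q2
          + q m * q m' * q m'' * q4
      | add x hx y hy h1 h2 => rw [add_mul]; exact dvd_add h1 h2
    intro x hx z hz'
    exact Ideal.mem_span_singleton.2 (hz z hz' x hx)
  have hP0 : P ≠ ⊥ := by
    rintro rfl
    exact hp.ne_zero (by exact_mod_cast (Ideal.mem_bot.1 hpP))
  obtain ⟨i, hi, hPi⟩ := (dvd_prime_pow (Ideal.prime_of_isPrime hP0 hPp) 3).1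
    (Ideal.dvd_iff_le.2 hP3)
  have hPi := associated_iff_eq.1 hPi
  refine ⟨P, hPp, ?_⟩
  interval_cases i
  · exact (hne (by simpa using hPi)).elim
  · rw [pow_one] at hPi
    rw [← hPi] at hωP
    exact (not_dvd_left h hp (Ideal.mem_span_singleton.1 hωP)).elim
  · have : θ ^ 2 ∈ P ^ 2 := Ideal.pow_mem_pow hθP 2
    rw [← hPi, Ideal.mem_span_singleton, h.sq'] at this
    have := not_mul_eq h (p := p) (k := -(f 1 * f 3)) (l := f 3) (m := -f 2)
      (by push_cast; convert this using 1; ring)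
    exact (hpd this.2.1).elim
  · exact hPi

theorem exists_int_sub_mem (h3 : finrank ℚ K = 3) {p : ℕ} (hp : p.Prime) {P : Ideal (𝓞 K)}
    (hP : P.IsPrime) (hpP : Ideal.span {(p : 𝓞 K)} = P ^ 3) (x : 𝓞 K) : ∃ n : ℤ, x - n ∈ P := by
  have : Fact p.Prime := ⟨hp⟩
  have hN : Ideal.absNorm P = p := by
    have h1 := congrArg Ideal.absNorm hpP
    have h2 := Algebra.norm_algebraMap (S := 𝓞 K) (p : ℤ)
    rw [RingOfIntegers.rank, h3] at h2
    rw [map_pow, Ideal.absNorm_span_singleton, show (p : 𝓞 K) = algebraMap ℤ (𝓞 K) p by simp,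
      h2, Int.natAbs_pow, Int.natAbs_natCast] at h1
    exact (Nat.pow_left_injective (n := 3) (by norm_num) h1).symm
  rw [Ideal.absNorm_apply, Submodule.cardQuot_apply] at hN
  have h1 : (1 : 𝓞 K ⧸ P) ≠ 0 := by
    rw [Ne, ← map_one (Ideal.Quotient.mk P), Ideal.Quotient.eq_zero_iff_mem]
    exact fun h => hP.ne_top ((Ideal.eq_top_iff_one P).2 h)
  have htop := zmultiples_eq_top_of_prime_card (G := 𝓞 K ⧸ P) hN h1
  obtain ⟨n, hn⟩ := AddSubgroup.mem_zmultiples_iff.1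
    (htop ▸ AddSubgroup.mem_top (Ideal.Quotient.mk P x))
  refine ⟨n, ?_⟩
  rw [← Ideal.Quotient.eq_zero_iff_mem, map_sub, ← hn]
  simp

theorem badCoeff_of_mem_sq {A : Type*} [CommRing A] {p : ℕ} (hp : p.Prime) {f : Fin 4 → ℤ}
    {ω θ : A} (h : IsTripleBasis f ω θ) {P : Ideal A} (hpP : Ideal.span {(p : A)} = P ^ 3)
    {n n' : ℤ} (hω : ω + n ∈ P ^ 2) (hθ : θ + n' ∈ P) : BadCoeff p f := by
  have hpp : Prime (p : ℤ) := Nat.prime_iff_prime_int.1 hp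
  have hdv : ∀ x : A, x ∈ P ^ 3 → (p : A) ∣ x := fun x hx => by
    rwa [← hpP, Ideal.mem_span_singleton] at hx
  have hdP : ∀ x : A, (p : A) ∣ x → x ∈ P ^ 3 := fun x hx => by
    rwa [← hpP, Ideal.mem_span_singleton]
  have hpow : P ^ 3 ≤ P ^ 2 := Ideal.pow_le_pow_right (by norm_num)
  have hpow' : P ^ 2 ≤ P := Ideal.pow_le_self (by norm_num)
  obtain ⟨-, hn', hn⟩ := not_mul_eq h (p := p) (k := -(f 0 * f 3) + n * n') (l := n') (m := n) (by
    have := hdv _ (pow_succ P 2 ▸ Ideal.mul_mem_mul hω hθ)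
    convert this using 1
    push_cast
    linear_combination -h.mul)
  have h_integral : ∀ k : ℤ, (p : ℤ) ∣ k → (k : A) ∈ P ^ 3 := fun k hk => by
    obtain ⟨c, rfl⟩ := hk
    exact hdP _ ⟨c, by push_cast; ring⟩
  have hω' : ω ∈ P ^ 2 := by
    have := (P ^ 2).sub_mem hω (hpow (h_integral n hn))
    rwa [add_sub_cancel_right] at this
  have hθ' : θ ∈ P := by
    have := P.sub_mem hθ (hpow' (hpow (h_integral n' hn')))
    rwa [add_sub_cancel_right] at this
  obtain ⟨-, h1, h0⟩ := not_mul_eq h (p := p) (k := -(f 0 * f 2)) (l := f 1) (m := -f 0) (by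
    have : ω ^ 2 ∈ P ^ 4 := by
      have := Ideal.pow_mem_pow hω' 2
      rwa [← pow_mul] at this
    have := hdv _ (Ideal.pow_le_pow_right (by norm_num) this)
    rw [h.sq] at this
    push_cast
    convert this using 1
    ring)
  obtain ⟨-, -, h2⟩ := not_mul_eq h (p := p) (k := f 1 * f 2 * f 3 - f 0 * f 3 ^ 2)
    (l := -(f 2 * f 3)) (m := f 2 ^ 2 - f 1 * f 3) (by
    have := hdv _ (Ideal.pow_mem_pow hθ' 3)
    convert this using 1
    push_cast
    linear_combination (f 2 - θ) * h.sq' - f 3 * h.mul)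
  refine ⟨(dvd_neg.1 h0), h1, Or.inr ?_⟩
  exact hpp.dvd_of_dvd_pow ((dvd_sub_left (dvd_mul_of_dvd_left h1 _)).1 h2)

theorem badAt_of_totallyRamified (h3 : finrank ℚ K = 3) {p : ℕ} (hp : p.Prime) {f : Fin 4 → ℤ}
    {ω θ : 𝓞 K} (h : IsTripleBasis f ω θ) {P : Ideal (𝓞 K)} (hP : P.IsPrime)
    (hpP : Ideal.span {(p : 𝓞 K)} = P ^ 3) : BadAt p f := by
  have hpp : Prime (p : ℤ) := Nat.prime_iff_prime_int.1 hp
  have hp0 : (p : 𝓞 K) ≠ 0 := by exact_mod_cast hp.ne_zero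
  have hpow : P ^ 3 ≤ P ^ 2 := Ideal.pow_le_pow_right (by norm_num)
  have hpow' : P ^ 2 ≤ P := Ideal.pow_le_self (by norm_num)
  have hp3 : (p : 𝓞 K) ∈ P ^ 3 := hpP ▸ Ideal.mem_span_singleton_self _
  have hP0 : P ≠ ⊥ := by
    rintro rfl
    exact hp0 (by simpa using hp3)
  obtain ⟨x, hx2, hx3⟩ : ∃ x ∈ P ^ 2, x ∉ P ^ 3 := Ideal.exists_mem_pow_notMem_pow_succ P hP0 hP.ne_top 2
  have hres := exists_int_sub_mem h3 hp hP hpP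
  obtain ⟨k, l, m, rfl⟩ := h.span x
  have inv : ∀ j : ℤ, ¬ (p : ℤ) ∣ j → ∃ i i' : ℤ, i * j = 1 + i' * p := by
    intro j hj
    obtain ⟨u, v, huv⟩ := (Prime.coprime_iff_not_dvd hpp).2 hj
    exact ⟨v, -u, by linear_combination huv⟩
  by_cases hm : (p : ℤ) ∣ m
  · obtain ⟨m', hm'⟩ := hm
    by_cases hl : (p : ℤ) ∣ l
    · obtain ⟨l', hl'⟩ := hl
      exfalso
      apply hx3
      have hk : (p : ℤ) ∣ k := by
        by_contra hk
        obtain ⟨i, i', hi⟩ := inv k hk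
        have hi : (i : 𝓞 K) * k = 1 + i' * p := by exact_mod_cast congrArg (Int.cast : ℤ → 𝓞 K) hi
        apply hP.ne_top
        rw [Ideal.eq_top_iff_one]
        have e : (1 : 𝓞 K) = i * (k + l * ω + m * θ) - (i' + i * (l' * ω + m' * θ)) * p := by
          rw [hl', hm']; push_cast; linear_combination -hi
        rw [e]
        exact P.sub_mem (P.mul_mem_left _ (hpow' hx2)) (P.mul_mem_left _ (hpow' (hpow hp3)))
      obtain ⟨k', hk'⟩ := hk
      rw [hk', hl', hm']
      have e : (((p * k' : ℤ) : 𝓞 K) + (p * l' : ℤ) * ω + (p * m' : ℤ) * θ) =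
        (k' + l' * ω + m' * θ) * p := by push_cast; ring
      rw [e]
      exact (P ^ 3).mul_mem_left _ hp3
    · obtain ⟨i, i', hi⟩ := inv l hl
      have hi : (i : 𝓞 K) * l = 1 + i' * p := by exact_mod_cast congrArg (Int.cast : ℤ → 𝓞 K) hi
      obtain ⟨n', hn'⟩ := hres θ
      refine Or.inl (badCoeff_of_mem_sq hp h hpP (n := i * k) (n' := -n') ?_ (by
        push_cast; rwa [← sub_eq_add_neg]))
      have e : ω + (i * k : ℤ) = i * (k + l * ω + m * θ) - (i' * ω + i * m' * θ) * p := by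
        rw [hm']; push_cast; linear_combination -ω * hi
      rw [e]
      exact (P ^ 2).sub_mem ((P ^ 2).mul_mem_left _ hx2) ((P ^ 2).mul_mem_left _ (hpow hp3))
  · obtain ⟨i, i', hi⟩ := inv m hm
    have hi : (i : 𝓞 K) * m = 1 + i' * p := by exact_mod_cast congrArg (Int.cast : ℤ → 𝓞 K) hi
    have hmem : (i * l : ℤ) * ω + θ + (i * k : ℤ) ∈ P ^ 2 := by
      have e : (i * l : ℤ) * ω + θ + (i * k : ℤ) = i * (k + l * ω + m * θ) - (i' * θ) * p := by
        push_cast; linear_combination -θ * hi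
      rw [e]
      exact (P ^ 2).sub_mem ((P ^ 2).mul_mem_left _ hx2) ((P ^ 2).mul_mem_left _ (hpow hp3))
    set j := i * l
    have ht := h.act (p := j) (q := -1) (r := 1) (s := 0) (by norm_num)
    set N₁ := f 0 * j ^ 2 * -1 + f 1 * j * -1 * 1 + f 2 * j * 1 * 0 + f 3 * 1 ^ 2 * 0
    set N₂ := -(f 0 * j * (-1) ^ 2 + f 1 * j * -1 * 0 + f 2 * -1 * 1 * 0 + f 3 * 1 * 0 ^ 2)
    obtain ⟨n', hn'⟩ := hres (-ω)
    refine Or.inr ⟨j, badCoeff_of_mem_sq hp ht hpP (n := i * k - N₁) (n' := -N₂ - n') ?_ ?_⟩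
    · convert hmem using 1
      push_cast
      ring
    · convert hn' using 1
      push_cast
      ring

theorem BadAt.totallyRamified {p : ℕ} (hp : p.Prime) {f : Fin 4 → ℤ} {ω θ : 𝓞 K}
    (h : IsTripleBasis f ω θ) (hb : BadAt p f) :
    ∃ P : Ideal (𝓞 K), P.IsPrime ∧ Ideal.span {(p : 𝓞 K)} = P ^ 3 := by
  obtain hb | ⟨k, hb⟩ := hb
  · exact hb.totallyRamified hp h
  · exact hb.totallyRamified hp (h.act (by norm_num))

end NumberField

theorem nowhereTotallyRamified_iff {K : IntermediateField ℚ ℂ} (h3 : finrank ℚ K = 3)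
    {f : Fin 4 → ℤ} {ω θ : 𝓞 K} (h : IsTripleBasis f ω θ) :
    NowhereTotallyRamified K ↔ Fund (disc f) := by
  have : FiniteDimensional ℚ K := .of_finrank_pos (by omega)
  have : NumberField K := ⟨⟩
  rw [fund_disc_iff]
  refine forall₂_congr fun p hp => not_congr ⟨?_, fun hb => hb.totallyRamified hp h⟩
  rintro ⟨P, hP, hpP⟩
  exact badAt_of_totallyRamified h3 hp h hP hpP

theorem IsTripleBasis.fieldDisc_eq {K : IntermediateField ℚ ℂ} (h3 : finrank ℚ K = 3)
    {f : Fin 4 → ℤ} {ω θ : 𝓞 K} (h : IsTripleBasis f ω θ) : fieldDisc K = disc f := by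
  have hK : FiniteDimensional ℚ K := .of_finrank_pos (by omega)
  have : NumberField K := ⟨⟩
  rw [fieldDisc, dif_pos hK, h.discr_eq h3]

/-- Irreducible integral forms whose discriminant is admissible and lies in `(ξ, η)`. -/
def Good (ξ η : ℝ) (f : Fin 4 → ℤ) : Prop :=
  Irr f ∧ Fund (disc f) ∧ ξ < ((disc f : ℤ) : ℝ) ∧ ((disc f : ℤ) : ℝ) < η

theorem cubicFieldCountNTR_eq (ξ η : ℝ) : cubicFieldCountNTR ξ η =
    Nat.card (Quot fun f g : {f : Fin 4 → ℤ // Good ξ η f} => GEquiv f.1 g.1) := by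
  have hnf : ∀ K : IntermediateField ℚ ℂ, finrank ℚ K = 3 → NumberField K := fun K h3 =>
    have : FiniteDimensional ℚ K := .of_finrank_pos (by omega)
    ⟨⟩
  have hex : ∀ K : {K : IntermediateField ℚ ℂ // finrank ℚ K = 3 ∧ NowhereTotallyRamified K ∧
      ξ < (fieldDisc K : ℝ) ∧ (fieldDisc K : ℝ) < η}, ∃ f : {f : Fin 4 → ℤ // Good ξ η f},
      ∃ ω θ : 𝓞 K.1, IsTripleBasis f.1 ω θ := by
    rintro ⟨K, h3, hN, h1, h2⟩
    have := hnf K h3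
    obtain ⟨f, ω, θ, h⟩ := exists_isTripleBasis (K := K) h3
    rw [h.fieldDisc_eq h3] at h1 h2
    exact ⟨⟨f, h.irr h.indep, (nowhereTotallyRamified_iff h3 h).1 hN, h1, h2⟩, ω, θ, h⟩
  choose F hF using hex
  have hequiv : ∀ K L : {K : IntermediateField ℚ ℂ // finrank ℚ K = 3 ∧
      NowhereTotallyRamified K ∧ ξ < (fieldDisc K : ℝ) ∧ (fieldDisc K : ℝ) < η}, Nonempty (↥K.1 ≃+* ↥L.1) ↔ GEquiv (F K).1 (F L).1 := by
    intro K L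
    have := hnf K.1 K.2.1
    have := hnf L.1 L.2.1
    obtain ⟨ω, θ, h⟩ := hF K
    obtain ⟨ω', θ', h'⟩ := hF L
    constructor
    · rintro ⟨e⟩
      exact h'.gequiv_basis (h.map (RingOfIntegers.mapRingEquiv e))
    · intro hg
      obtain ⟨ω₁, θ₁, h₁⟩ := h.gequiv hg
      exact h₁.fieldEquiv h'
  refine Nat.card_congr (Equiv.ofBijective (Quot.map F fun K L => (hequiv K L).1) ⟨?_, ?_⟩)
  · rintro ⟨K⟩ ⟨L⟩ hKL
    refine Quot.sound ((hequiv K L).2 ?_)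
    have := Quot.eqvGen_exact hKL
    have heq : Equivalence fun f g : {f : Fin 4 → ℤ // Good ξ η f} => GEquiv f.1 g.1 :=
      ⟨fun f => .refl _, fun h => h.symm, fun h => h.trans⟩
    rwa [heq.eqvGen_iff] at this
  · rintro ⟨f⟩
    obtain ⟨K, h3, ω₁, θ₁, ht, hi⟩ := exists_field f.2.1
    have := hnf K h3
    obtain ⟨g, ω₀, θ₀, hg⟩ := exists_isTripleBasis (K := K) h3
    obtain ⟨ω, θ, h⟩ := f.2.2.1.isTripleBasis ht hi hg
    have hd := h.fieldDisc_eq h3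
    refine ⟨Quot.mk _ ⟨K, h3, (nowhereTotallyRamified_iff h3 h).2 f.2.2.1, ?_, ?_⟩, ?_⟩
    · rw [hd]; exact f.2.2.2.1
    · rw [hd]; exact f.2.2.2.2
    · refine Quot.sound ?_
      obtain ⟨ω', θ', h'⟩ := hF ⟨K, _⟩
      exact h.gequiv_basis h'

end BCF

namespace BCF

/-! ### Real forms: parametrisation by the upper half plane -/

/-- The coefficients of `W (X - z Y)² (X - ζ Y)`. -/
def cform (W z ζ : ℂ) : Fin 4 → ℂ :=
  ![W, -W * (2 * z + ζ), W * (z ^ 2 + 2 * z * ζ), -W * z ^ 2 * ζ]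

theorem act_cform {W z ζ p q r s z' ζ' : ℂ} (hz : z' * (p - r * z) = s * z - q)
    (hζ : ζ' * (p - r * ζ) = s * ζ - q) :
    act p q r s (cform W z ζ) = cform (W * (p - r * z) ^ 2 * (p - r * ζ)) z' ζ' := by
  apply ext4 <;> simp [cform]
  · ring
  · linear_combination W * (2 * (p - r * z) * (p - r * ζ) * hz + (p - r * z) ^ 2 * hζ)
  · linear_combination -W * ((p - r * ζ) * (z' * (p - r * z) + s * z - q) * hz +
      2 * (p - r * z) * (ζ' * (p - r * ζ)) * hz + 2 * (p - r * z) * (s * z - q) * hζ)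
  · linear_combination W * ((z' * (p - r * z) + s * z - q) * (ζ' * (p - r * ζ)) * hz
      + (s * z - q) ^ 2 * hζ)

/-- Constants attached to the sign of the discriminant. -/
def cm (s : Bool) : ℝ := if s then 3 else 1
/-- Constants attached to the sign of the discriminant. -/
def ck (s : Bool) : ℝ := if s then -6 else 2
/-- Constants attached to the sign of the discriminant. -/
def cl (s : Bool) : ℝ := if s then -2 else 2
/-- Constants attached to the sign of the discriminant. -/
def cκ (s : Bool) : ℝ := if s then 1728 else 64
/-- The sign of the discriminant. -/
def ce (s : Bool) : ℝ := if s then 1 else -1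

/-- The coefficients of `2 Re (w (X - zY)² (X - zY))` or `2 Re (w (X - zY)² (X - z̄Y))`,
where `z = t 0 + t 1 i` and `w = t 2 + t 3 i`. -/
def Phi (s : Bool) (t : Fin 4 → ℝ) : Fin 4 → ℝ :=
  ![2 * t 2, -6 * t 2 * t 0 + 2 * cm s * t 3 * t 1,
    6 * t 2 * t 0 ^ 2 - 4 * cm s * t 3 * t 0 * t 1 + ck s * t 2 * t 1 ^ 2,
    -2 * t 2 * t 0 ^ 3 - ck s * t 2 * t 0 * t 1 ^ 2 + 2 * cm s * t 3 * t 0 ^ 2 * t 1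
      + cl s * t 3 * t 1 ^ 3]

/-- The point of the upper half plane. -/
def zc (t : Fin 4 → ℝ) : ℂ := ⟨t 0, t 1⟩
/-- The leading coefficient. -/
def wc (t : Fin 4 → ℝ) : ℂ := ⟨t 2, t 3⟩

open ComplexConjugate

/-- The identity or complex conjugation. -/
def cσ (s : Bool) : ℂ →+* ℂ := if s then RingHom.id ℂ else conj

theorem cσ_conj (s : Bool) (z : ℂ) : cσ s (conj z) = conj (cσ s z) := by
  cases s <;> simp [cσ]

theorem cσ_ofReal (s : Bool) (x : ℝ) : cσ s (x : ℂ) = x := by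
  cases s <;> simp [cσ]

theorem Phi_eq (s : Bool) (t : Fin 4 → ℝ) (i : Fin 4) : ((Phi s t i : ℝ) : ℂ) =
    cform (wc t) (zc t) (cσ s (zc t)) i
      + cform (conj (wc t)) (conj (zc t)) (cσ s (conj (zc t))) i := by
  cases s <;> fin_cases i <;> apply Complex.ext <;>
    simp [Phi, cform, wc, zc, cσ, cm, ck, cl, pow_succ] <;> ring

theorem disc_Phi (s : Bool) (t : Fin 4 → ℝ) :
    disc (Phi s t) = ce s * (cκ s * t 1 ^ 6 * (t 2 ^ 2 + t 3 ^ 2) ^ 2) := by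
  cases s <;> simp [Phi, disc, cm, ck, cl, cκ, ce] <;> ring

theorem Phi_neg (s : Bool) (t : Fin 4 → ℝ) : Phi s ![t 0, t 1, -t 2, -t 3] = -Phi s t := by
  apply ext4 <;> simp [Phi] <;> ring

theorem Phi_reflect (s : Bool) (t : Fin 4 → ℝ) :
    Phi s ![-t 0, t 1, t 2, -t 3] = act 1 0 0 (-1) (Phi s t) := by
  apply ext4 <;> simp [Phi] <;> ring

theorem act_Phi (s : Bool) {t t' : Fin 4 → ℝ} {a b c d : ℝ}
    (hz : zc t' * (a - c * zc t) = d * zc t - b)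
    (hw : wc t' = wc t * (a - c * zc t) ^ 2 * (a - c * cσ s (zc t))) :
    Phi s t' = act a b c d (Phi s t) := by
  have hz1 := congrArg (cσ s) hz
  have hz2 := congrArg conj hz
  have hz3 := congrArg conj hz1
  have hw2 := congrArg conj hw
  simp only [map_mul, map_sub, cσ_ofReal, map_pow, Complex.conj_ofReal] at hz1 hz2 hz3 hw2
  have h1 := act_cform (W := wc t) hz hz1
  have h2 := act_cform (W := conj (wc t)) hz2 hz3
  rw [← hw] at h1
  rw [← hw2] at h2
  funext i
  apply Complex.ofReal_injective
  have h3 := congrFun (act_map Complex.ofRealHom a b c d (Phi s t)) i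
  simp only [Complex.ofRealHom_eq_coe] at h3
  rw [Phi_eq, h3, cσ_conj, ← h1, ← h2]
  simp only [Phi_eq, cσ_conj]
  fin_cases i <;> simp <;> ring

theorem Phi_inj (s : Bool) {t t' : Fin 4 → ℝ} (h : 0 < t 1) (h' : 0 < t' 1)
    (hw : t 2 ^ 2 + t 3 ^ 2 ≠ 0) (e : Phi s t = Phi s t') : t = t' := by
  have e0 := congrFun e 0
  have e1 := congrFun e 1
  have e2 := congrFun e 2
  have e3 := congrFun e 3
  suffices hxy : t 0 = t' 0 ∧ t 1 = t' 1 by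
    obtain ⟨hx, hy⟩ := hxy
    have hu : t 2 = t' 2 := by simpa [Phi] using e0
    have hv : t 3 = t' 3 := by
      have hm : cm s ≠ 0 := by cases s <;> simp [cm]
      simp only [Phi, Matrix.cons_val] at e1
      rw [hx, hy, hu] at e1
      have := mul_right_cancel₀ h'.ne' (add_left_cancel e1)
      exact mul_left_cancel₀ (mul_ne_zero two_ne_zero hm) this
    exact ext4 hx hy hu hv
  cases s
  · simp [Phi, cm, ck, cl] at e0 e1 e2 e3
    set x := t 0
    set y := t 1
    set u := t 2
    set v := t 3
    set p := t' 0
    set q := t' 1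
    set m := t' 2
    set n := t' 3
    clear_value x y u v p q m n
    subst e0
    have hA : (p - x) ^ 2 - q ^ 2 + y ^ 2 = 0 ∧ (p - x) * q = 0 := by
      have k1 : (2 * u * p - 2 * u * x + 2 * v * y) * ((p - x) ^ 2 - q ^ 2 + y ^ 2)
        - 2 * u * q * (2 * (p - x) * q) = 0 := by
        linear_combination (p^2 - q^2) * e1 + p * e2 + e3
      have k2 : (2 * u * p - 2 * u * x + 2 * v * y) * (2 * (p - x) * q)
        + 2 * u * q * ((p - x) ^ 2 - q ^ 2 + y ^ 2) = 0 := by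
        linear_combination 2 * p * q * e1 + q * e2
      set α := 2 * u * p - 2 * u * x + 2 * v * y with hα
      set β := 2 * u * q with hβ
      have hn : α ^ 2 + β ^ 2 ≠ 0 := by
        intro h0
        have ha : α = 0 := by nlinarith [sq_nonneg α, sq_nonneg β]
        have hb : β = 0 := by nlinarith [sq_nonneg α, sq_nonneg β]
        have hu : u = 0 := by
          rcases mul_eq_zero.1 hb with h1 | h1
          · linarith
          · exact absurd h1 h'.ne'
        have hv : v = 0 := by
          rw [hα, hu] at ha
          have : v * y = 0 := by linarith
          exact (mul_eq_zero.1 this).resolve_right h.ne'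
        exact hw (by rw [hu, hv]; norm_num)
      have r1 : (α ^ 2 + β ^ 2) * ((p - x) ^ 2 - q ^ 2 + y ^ 2) = 0 := by
        linear_combination α * k1 + β * k2
      have r2 : (α ^ 2 + β ^ 2) * (2 * (p - x) * q) = 0 := by
        linear_combination α * k2 - β * k1
      have r2' := (mul_eq_zero.1 r2).resolve_left hn
      exact ⟨(mul_eq_zero.1 r1).resolve_left hn, by linarith⟩
    have hx : p = x := by
      have := (mul_eq_zero.1 hA.2).resolve_right h'.ne'
      linarith
    refine ⟨hx.symm, ?_⟩
    have : y ^ 2 = q ^ 2 := by rw [hx] at hA; linarith [hA.1]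
    exact (sq_eq_sq₀ h.le h'.le).1 this
  · have hP : (Phi true t 1) ^ 2 - 3 * Phi true t 0 * Phi true t 2
        = 36 * t 1 ^ 2 * (t 2 ^ 2 + t 3 ^ 2) := by
      simp [Phi, cm, ck]; ring
    have hP' : (Phi true t' 1) ^ 2 - 3 * Phi true t' 0 * Phi true t' 2
        = 36 * t' 1 ^ 2 * (t' 2 ^ 2 + t' 3 ^ 2) := by
      simp [Phi, cm, ck]; ring
    have hQ : Phi true t 1 * Phi true t 2 - 9 * Phi true t 0 * Phi true t 3
        = -72 * t 0 * t 1 ^ 2 * (t 2 ^ 2 + t 3 ^ 2) := by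
      simp [Phi, cm, ck, cl]; ring
    have hQ' : Phi true t' 1 * Phi true t' 2 - 9 * Phi true t' 0 * Phi true t' 3
        = -72 * t' 0 * t' 1 ^ 2 * (t' 2 ^ 2 + t' 3 ^ 2) := by
      simp [Phi, cm, ck, cl]; ring
    have hD := disc_Phi true t
    have hD' := disc_Phi true t'
    rw [e] at hP hQ hD
    rw [hP] at hP'
    rw [hQ] at hQ'
    rw [hD] at hD'
    simp only [ce, cκ, if_true] at hD'
    set N := t 2 ^ 2 + t 3 ^ 2
    set N' := t' 2 ^ 2 + t' 3 ^ 2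
    have hN : 0 < N := lt_of_le_of_ne (by positivity) (Ne.symm hw)
    have hk : 0 < t 1 ^ 2 * N := by positivity
    have hkk : t 1 ^ 2 * N = t' 1 ^ 2 * N' := by linarith
    constructor
    · have : (t 1 ^ 2 * N) * t 0 = (t 1 ^ 2 * N) * t' 0 := by
        rw [show t 1 ^ 2 * N * t' 0 = t' 1 ^ 2 * N' * t' 0 by rw [hkk]]; linarith
      exact mul_left_cancel₀ hk.ne' this
    · have h1 : (t 1 ^ 2 * N) ^ 2 * t 1 ^ 2 = (t 1 ^ 2 * N) ^ 2 * t' 1 ^ 2 := by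
        nth_rewrite 2 [hkk]; linarith
      exact (sq_eq_sq₀ h.le h'.le).1 (mul_left_cancel₀ (pow_pos hk 2).ne' h1)

theorem exists_Phi_false (f : Fin 4 → ℝ) (x y : ℝ) (hy : 0 < y)
    (h2 : f 0 * (3 * x ^ 2 - y ^ 2) + 2 * f 1 * x + f 2 = 0)
    (h1 : f 0 * (x ^ 3 - 3 * x * y ^ 2) + f 1 * (x ^ 2 - y ^ 2) + f 2 * x + f 3 = 0) :
    ∃ t : Fin 4 → ℝ, 0 < t 1 ∧ Phi false t = f := by
  have hy' := hy.ne'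
  refine ⟨![x, y, f 0 / 2, (f 1 + 3 * f 0 * x) / (2 * y)], hy, ext4 ?_ ?_ ?_ ?_⟩
  · simp [Phi]
    ring
  · simp [Phi, cm]
    field_simp
    ring
  · simp [Phi, cm, ck]
    field_simp
    linear_combination -2 * h2
  · simp [Phi, cm, ck, cl]
    field_simp
    linear_combination -h1 + x * h2

theorem exists_Phi (s : Bool) (f : Fin 4 → ℝ) (h0 : f 0 ≠ 0) (hD : 0 < ce s * disc f) :
    ∃ t : Fin 4 → ℝ, 0 < t 1 ∧ Phi s t = f := by
  cases s
  · obtain ⟨z, hz⟩ : ∃ z : ℂ, f 0 * z ^ 3 + f 1 * z ^ 2 + f 2 * z + f 3 = 0 := by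
      have hdeg := Cubic.degree_of_a_ne_zero (P := ⟨(f 0 : ℂ), f 1, f 2, f 3⟩) (by simpa using h0)
      obtain ⟨z, hz⟩ := IsAlgClosed.exists_root (Cubic.toPoly ⟨(f 0 : ℂ), f 1, f 2, f 3⟩)
        (by rw [hdeg]; decide)
      exact ⟨z, by simpa [Cubic.toPoly, Polynomial.IsRoot] using hz⟩
    have hre := congrArg Complex.re hz
    have him := congrArg Complex.im hz
    simp [pow_succ] at hre him
    set x := z.re
    set y := z.im
    by_cases hy : y = 0
    · simp [hy] at hre
      simp [ce, disc] at hD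
      set q1 := f 1 + f 0 * x with hq1
      set q0 := f 2 + q1 * x with hq0
      have hlt : q1 ^ 2 < 4 * f 0 * q0 := by
        by_contra! hcon
        have e1 : f 1 = q1 - f 0 * x := by rw [hq1]; ring
        have e2 : f 2 = q0 - q1 * x := by rw [hq0]; ring
        have e3 : f 3 = - q0 * x := by rw [hq0, hq1]; linarith
        have : 0 ≤ (q1 ^ 2 - 4 * f 0 * q0) * (f 0 * x ^ 2 + q1 * x + q0) ^ 2 :=
          mul_nonneg (by linarith) (sq_nonneg _)
        rw [e1, e2, e3] at hD
        nlinarith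
      set Δ := √(4 * f 0 * q0 - q1 ^ 2) with hΔ
      have hΔ0 : 0 < Δ := Real.sqrt_pos.2 (by linarith)
      have hΔ2 : Δ ^ 2 = 4 * f 0 * q0 - q1 ^ 2 := Real.sq_sqrt (by linarith)
      have hY : (Δ / (2 * |f 0|)) ^ 2 = (4 * f 0 * q0 - q1 ^ 2) / (4 * f 0 ^ 2) := by
        rw [div_pow, mul_pow, sq_abs, hΔ2]
        norm_num
      refine exists_Phi_false f (-q1 / (2 * f 0)) (Δ / (2 * |f 0|))
        (div_pos hΔ0 (by positivity)) ?_ ?_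
      · rw [hY]
        field_simp
        rw [hq0, hq1]
        ring
      · rw [hY]
        field_simp
        have e3 : f 3 = - q0 * x := by rw [hq0, hq1]; linarith
        have e1 : f 1 = q1 - f 0 * x := by rw [hq1]; ring
        have e2 : f 2 = q0 - q1 * x := by rw [hq0]; ring
        rw [e3, e2, e1]
        ring
    · have hi : f 0 * (3 * x ^ 2 - y ^ 2) + 2 * f 1 * x + f 2 = 0 := by
        apply mul_left_cancel₀ hy
        linear_combination him
      have hr : f 0 * (x ^ 3 - 3 * x * y ^ 2) + f 1 * (x ^ 2 - y ^ 2) + f 2 * x + f 3 = 0 := by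
        linear_combination hre
      exact exists_Phi_false f x |y| (abs_pos.2 hy) (by rwa [sq_abs]) (by rwa [sq_abs])
  · simp only [ce, if_true, one_mul] at hD
    set P := f 1 ^ 2 - 3 * f 0 * f 2 with hP
    set Q := f 1 * f 2 - 9 * f 0 * f 3 with hQ
    have h4 : 4 * P ^ 3 = (2 * f 1 * P - 3 * f 0 * Q) ^ 2 + 27 * f 0 ^ 2 * disc f := by
      simp only [hP, hQ, disc]; ring
    have hP0 : 0 < P := by
      by_contra! hcon
      have h1 : P ^ 3 ≤ 0 := by nlinarith [sq_nonneg P]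
      have h2 : 0 < f 0 ^ 2 * disc f := by positivity
      nlinarith [sq_nonneg (2 * f 1 * P - 3 * f 0 * Q)]
    set Δ := √(3 * disc f) with hΔ
    have hΔ0 : 0 < Δ := Real.sqrt_pos.2 (by linarith)
    have hΔ2 : Δ ^ 2 = 3 * disc f := Real.sq_sqrt (by linarith)
    have hR : 3 * disc f = 4 * P * (f 2 ^ 2 - 3 * f 1 * f 3) - Q ^ 2 := by
      simp only [hP, hQ, disc]; ring
    refine ⟨![-Q / (2 * P), Δ / (2 * P), f 0 / 2, (f 1 - 3 * f 0 * Q / (2 * P)) / (3 * Δ / P)],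
      by simp; positivity, ext4 ?_ ?_ ?_ ?_⟩
    · simp [Phi]
      ring
    · simp [Phi, cm]
      field_simp
      ring
    · simp [Phi, cm, ck]
      field_simp
      rw [hΔ2, hR]
      simp only [hP, hQ]
      ring
    · simp [Phi, cm, ck, cl]
      field_simp
      rw [hΔ2, hR]
      simp only [hP, hQ]
      ring

end BCF

namespace BCF

/-! ### Reduction theory -/

/-- An integral form viewed as a real form. -/
def toR (f : Fin 4 → ℤ) : Fin 4 → ℝ := fun i => (f i : ℝ)

theorem toR_injective : Function.Injective toR := fun f g h => by
  funext i
  have := congrFun h i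
  simpa [toR] using this

theorem toR_act (p q r s : ℤ) (f : Fin 4 → ℤ) :
    toR (act p q r s f) = act (p : ℝ) q r s (toR f) :=
  act_map (Int.castRingHom ℝ) p q r s f

theorem toR_neg (f : Fin 4 → ℤ) : toR (-f) = -toR f := by
  funext i; simp [toR]

theorem disc_toR (f : Fin 4 → ℤ) : disc (toR f) = ((disc f : ℤ) : ℝ) :=
  (disc_map (Int.castRingHom ℝ) f).symm

/-- Parameters over the closed half fundamental domain. -/
def Reduced (t : Fin 4 → ℝ) : Prop :=
  0 ≤ t 0 ∧ t 0 ≤ 1 / 2 ∧ 1 ≤ t 0 ^ 2 + t 1 ^ 2 ∧ 0 < t 1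

/-- Parameters over the open half fundamental domain. -/
def IntReduced (t : Fin 4 → ℝ) : Prop :=
  0 < t 0 ∧ t 0 < 1 / 2 ∧ 1 < t 0 ^ 2 + t 1 ^ 2 ∧ 0 < t 1

theorem norm_ne_zero_of_disc {s : Bool} {t : Fin 4 → ℝ} (h : disc (Phi s t) ≠ 0) :
    t 2 ^ 2 + t 3 ^ 2 ≠ 0 := by
  intro h0
  rw [disc_Phi, h0] at h
  simp at h

open UpperHalfPlane ModularGroup Matrix.SpecialLinearGroup in
theorem exists_smul_Phi (s : Bool) (t : Fin 4 → ℝ) (h : 0 < t 1)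
    (γ : Matrix.SpecialLinearGroup (Fin 2) ℤ) :
    ∃ t' : Fin 4 → ℝ, zc t' = ((γ • (⟨zc t, h⟩ : ℍ) : ℍ) : ℂ) ∧ 0 < t' 1 ∧
      Phi s t' = act (γ 1 1 : ℝ) (-γ 0 1 : ℝ) (-γ 1 0 : ℝ) (γ 0 0 : ℝ) (Phi s t) := by
  set z : ℍ := ⟨zc t, h⟩
  set w' : ℂ := wc t * ((γ 1 1 : ℝ) - ((-γ 1 0 : ℝ) : ℝ) * zc t) ^ 2 *
    ((γ 1 1 : ℝ) - ((-γ 1 0 : ℝ) : ℝ) * cσ s (zc t)) with hw'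
  refine ⟨![(γ • z).re, (γ • z).im, w'.re, w'.im], ?_, (γ • z).im_pos, ?_⟩
  · apply Complex.ext <;> simp [zc]
  · apply act_Phi s
    · have h1 : zc ![(γ • z).re, (γ • z).im, w'.re, w'.im] = ((γ • z : ℍ) : ℂ) := by
        apply Complex.ext <;> simp [zc]
      rw [h1, coe_specialLinearGroup_apply]
      have hd : ((γ 1 0 : ℤ) : ℂ) * (z : ℂ) + (γ 1 1 : ℤ) ≠ 0 := by
        have := denom_ne_zero (γ : GL (Fin 2) ℝ) z
        simpa [denom] using this
      have hz : (z : ℂ) = zc t := rfl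
      rw [hz] at hd ⊢
      simp only [algebraMap_int_eq, eq_intCast, Complex.ofReal_intCast, Complex.ofReal_neg]
      rw [div_mul_eq_mul_div, div_eq_iff hd]
      ring
    · rw [← hw']
      apply Complex.ext <;> simp [wc]

theorem exists_reduced (s : Bool) (f : Fin 4 → ℤ) (h0 : f 0 ≠ 0) (hD : 0 < ce s * (disc f : ℤ)) :
    ∃ g, GEquiv f g ∧ ∃ t, Phi s t = toR g ∧ Reduced t := by
  obtain ⟨t, ht, hf⟩ := exists_Phi s (toR f) (by simpa [toR] using h0) (by rwa [disc_toR])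
  obtain ⟨γ, hγ⟩ := ModularGroup.exists_smul_mem_fd (⟨zc t, ht⟩ : UpperHalfPlane)
  obtain ⟨t', hz, hpos, ht'⟩ := exists_smul_Phi s t ht γ
  have hdet := Matrix.SpecialLinearGroup.det_coe γ
  rw [Matrix.det_fin_two] at hdet
  obtain ⟨g, hg⟩ : ∃ g, g = act (γ 1 1) (-γ 0 1) (-γ 1 0) (γ 0 0) f := ⟨_, rfl⟩
  have hfg : GEquiv f g := ⟨_, _, _, _, by left; linarith, hg⟩
  have hgt : Phi s t' = toR g := by
    rw [ht', hf, hg, toR_act]; push_cast; rfl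
  have hn : 1 ≤ t' 0 ^ 2 + t' 1 ^ 2 := by
    have := hγ.1
    rw [← hz] at this
    simpa [Complex.normSq_apply, zc, ← pow_two] using this
  have hx : |t' 0| ≤ 1 / 2 := by
    have := hγ.2
    rw [← UpperHalfPlane.coe_re, ← hz] at this
    exact this
  rw [abs_le] at hx
  rcases le_total 0 (t' 0) with h | h
  · exact ⟨g, hfg, t', hgt, h, hx.2, hn, hpos⟩
  · refine ⟨act 1 0 0 (-1) g, hfg.trans ⟨1, 0, 0, -1, by right; norm_num, rfl⟩,
      ![-t' 0, t' 1, t' 2, -t' 3], ?_, ?_⟩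
    · rw [Phi_reflect, hgt, toR_act]; push_cast; rfl
    · refine ⟨by simpa using h, ?_, ?_, hpos⟩
      · simp; linarith
      · simpa using hn

theorem eq_or_neg_of_smul {s : Bool} {f g : Fin 4 → ℤ} {t t' : Fin 4 → ℝ} (hf : Phi s t = toR f)
    (hg : Phi s t' = toR g) (hD : disc f ≠ 0) (hy : 0 < t 1) (hy' : 0 < t' 1)
    (hx : |t 0| < 1 / 2) (hx' : |t' 0| < 1 / 2)
    (hn : 1 < t 0 ^ 2 + t 1 ^ 2) (hn' : 1 < t' 0 ^ 2 + t' 1 ^ 2) {p q r r' : ℤ}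
    (hdet : p * r' - q * r = 1) (hfg : g = act p q r r' f) : t 0 = t' 0 ∧ (g = f ∨ g = -f) := by
  set γ : Matrix.SpecialLinearGroup (Fin 2) ℤ := ⟨!![r', -q; -r, p], by
    rw [Matrix.det_fin_two_of]; linarith⟩ with hγ
  obtain ⟨t2, hz, hpos, ht2⟩ := exists_smul_Phi s t hy γ
  have e : Phi s t2 = Phi s t' := by
    rw [ht2, hf, hg, hfg, toR_act]
    simp [hγ]
  have hg0 : disc g ≠ 0 := by
    rwa [(show GEquiv f g from ⟨p, q, r, r', Or.inl hdet, hfg⟩).disc_eq]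
  have e2 : t2 = t' := by
    refine Phi_inj s hpos hy' (norm_ne_zero_of_disc (s := s) ?_) e
    rw [e, hg, disc_toR]
    exact_mod_cast hg0
  subst e2
  have h1 : (⟨zc t, hy⟩ : UpperHalfPlane) ∈ ModularGroup.fdo := by
    refine ⟨?_, hx⟩
    change 1 < Complex.normSq (zc t)
    simpa [Complex.normSq_apply, zc, ← pow_two] using hn
  have h2 : γ • (⟨zc t, hy⟩ : UpperHalfPlane) ∈ ModularGroup.fd := by
    refine ⟨?_, ?_⟩
    · rw [← hz]
      simpa [Complex.normSq_apply, zc, ← pow_two] using hn'.le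
    · rw [← UpperHalfPlane.coe_re, ← hz]
      exact hx'.le
  rcases ModularGroup.eq_one_or_neg_one_of_mem_fdo_mem_fd h1 h2 with h3 | h3
  · constructor
    · rw [h3, one_smul] at hz
      exact (congrArg Complex.re hz).symm
    · left
      have e00 := congrArg (fun m : Matrix.SpecialLinearGroup (Fin 2) ℤ => m 0 0) h3
      have e01 := congrArg (fun m : Matrix.SpecialLinearGroup (Fin 2) ℤ => m 0 1) h3
      have e10 := congrArg (fun m : Matrix.SpecialLinearGroup (Fin 2) ℤ => m 1 0) h3
      have e11 := congrArg (fun m : Matrix.SpecialLinearGroup (Fin 2) ℤ => m 1 1) h3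
      simp [hγ] at e00 e01 e10 e11
      rw [hfg, e00, e01, e10, e11, act_id]
  · constructor
    · rw [h3, ModularGroup.SL_neg_smul, one_smul] at hz
      exact (congrArg Complex.re hz).symm
    · right
      have e00 := congrArg (fun m : Matrix.SpecialLinearGroup (Fin 2) ℤ => m 0 0) h3
      have e01 := congrArg (fun m : Matrix.SpecialLinearGroup (Fin 2) ℤ => m 0 1) h3
      have e10 := congrArg (fun m : Matrix.SpecialLinearGroup (Fin 2) ℤ => m 1 0) h3
      have e11 := congrArg (fun m : Matrix.SpecialLinearGroup (Fin 2) ℤ => m 1 1) h3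
      simp [hγ] at e00 e01 e10 e11
      rw [hfg, e00, e01, e10, e11, act_neg_id]

theorem eq_or_neg_of_intReduced {s : Bool} {f g : Fin 4 → ℤ} {t t' : Fin 4 → ℝ}
    (hf : Phi s t = toR f) (hg : Phi s t' = toR g) (hD : disc f ≠ 0) (ht : IntReduced t)
    (ht' : IntReduced t') (h : GEquiv f g) : g = f ∨ g = -f := by
  obtain ⟨p, q, r, r', hdet, hfg⟩ := h
  obtain ⟨h0, h1, h2, h3⟩ := ht
  obtain ⟨h0', h1', h2', h3'⟩ := ht'
  have hx : |t 0| < 1 / 2 := by rwa [abs_of_pos h0]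
  have hx' : |t' 0| < 1 / 2 := by rwa [abs_of_pos h0']
  rcases hdet with hdet | hdet
  · exact (eq_or_neg_of_smul hf hg hD h3 h3' hx hx' h2 h2' hdet hfg).2
  · exfalso
    have hr := Phi_reflect s t'
    rw [hg] at hr
    have hr' : Phi s ![-t' 0, t' 1, t' 2, -t' 3] = toR (act 1 0 0 (-1) g) := by
      rw [hr, toR_act]; push_cast; rfl
    have := (eq_or_neg_of_smul (p := p) (q := -q) (r := r) (r' := -r') hf hr' hD h3 h3' hx
      (by simpa using hx') h2 (by simpa using h2') (by linarith) (by
        rw [hfg, act_act]; congr 1 <;> ring)).1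
    simp at this
    linarith

end BCF

namespace BCF

/-! ### Forms high in the cusp -/

/-- The integral forms with `|f i| ≤ B i`. -/
noncomputable def box (B : Fin 4 → ℝ) : Finset (Fin 4 → ℤ) :=
  Fintype.piFinset fun i => Finset.Icc (-⌊B i⌋) ⌊B i⌋

theorem mem_box {B : Fin 4 → ℝ} {f : Fin 4 → ℤ} : f ∈ box B ↔ ∀ i, |(f i : ℝ)| ≤ B i := by
  simp only [box, Fintype.mem_piFinset, Finset.mem_Icc, abs_le]
  refine forall_congr' fun i => and_congr ?_ Int.le_floor
  rw [neg_le, Int.le_floor, neg_le]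
  push_cast
  rfl

theorem card_Icc_floor_le {B : ℝ} (hB : 0 ≤ B) :
    ((Finset.Icc (-⌊B⌋) ⌊B⌋).card : ℝ) ≤ 2 * B + 1 := by
  have h0 := Int.floor_nonneg.2 hB
  have : ((Finset.Icc (-⌊B⌋) ⌊B⌋).card : ℤ) = 2 * ⌊B⌋ + 1 := by
    rw [Int.card_Icc, Int.toNat_of_nonneg (by linarith)]; ring
  have h2 : ((Finset.Icc (-⌊B⌋) ⌊B⌋).card : ℝ) = 2 * (⌊B⌋ : ℝ) + 1 := by exact_mod_cast this
  rw [h2]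
  linarith [Int.floor_le B]

theorem card_box_le {B : Fin 4 → ℝ} (hB : ∀ i, 0 ≤ B i) :
    ((box B).card : ℝ) ≤ ∏ i, (2 * B i + 1) := by
  rw [box, Fintype.card_piFinset]
  push_cast
  exact Finset.prod_le_prod (fun i _ => Nat.cast_nonneg _) fun i _ => card_Icc_floor_le (hB i)

theorem Phi_translate (s : Bool) (t : Fin 4 → ℝ) (n : ℝ) :
    Phi s ![t 0 + n, t 1, t 2, t 3] = act 1 (-n) 0 1 (Phi s t) := by
  cases s <;> apply ext4 <;> simp [Phi, cm, ck, cl] <;> ring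

theorem abs_Phi_le (s : Bool) (t : Fin 4 → ℝ) {W M : ℝ} (hu : |t 2| ≤ W) (hv : |t 3| ≤ W)
    (hx : |t 0| ≤ M) (hy : |t 1| ≤ M) :
    |Phi s t 0| ≤ 2 * W ∧ |Phi s t 1| ≤ 12 * (W * M) ∧ |Phi s t 2| ≤ 24 * (W * M ^ 2) ∧
      |Phi s t 3| ≤ 16 * (W * M ^ 3) := by
  have hW : 0 ≤ W := (abs_nonneg _).trans hu
  have hM : 0 ≤ M := (abs_nonneg _).trans hx
  have mono : ∀ {w : ℝ} (i j : ℕ), |w| ≤ W → |w * t 0 ^ i * t 1 ^ j| ≤ W * M ^ (i + j) := by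
    intro w i j hw
    rw [abs_mul, abs_mul, abs_pow, abs_pow, pow_add, ← mul_assoc]
    gcongr
  have u00 := mono 0 0 hu
  have u10 := mono 1 0 hu
  have v01 := mono 0 1 hv
  have u20 := mono 2 0 hu
  have v11 := mono 1 1 hv
  have u02 := mono 0 2 hu
  have u30 := mono 3 0 hu
  have u12 := mono 1 2 hu
  have v21 := mono 2 1 hv
  have v03 := mono 0 3 hv
  simp only [abs_le, pow_zero, mul_one, pow_one, Nat.reduceAdd, zero_add, add_zero] at *
  have hWM : 0 ≤ W * M := by positivity
  have hWM2 : 0 ≤ W * M ^ 2 := by positivity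
  have hWM3 : 0 ≤ W * M ^ 3 := by positivity
  cases s <;> simp only [Phi, cm, ck, cl, if_true, Bool.false_eq_true, if_false, Matrix.cons_val] <;>
    refine ⟨⟨?_, ?_⟩, ⟨?_, ?_⟩, ⟨?_, ?_⟩, ⟨?_, ?_⟩⟩ <;> linarith

theorem sq_le_of_disc_lt {s : Bool} {t : Fin 4 → ℝ} {X Y : ℝ} (hY : 0 < Y) (hy : Y ≤ t 1)
    (h : |disc (Phi s t)| < X) : 64 * Y ^ 6 * (t 2 ^ 2 + t 3 ^ 2) ^ 2 < X := by
  refine lt_of_le_of_lt ?_ h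
  rw [disc_Phi, abs_mul]
  have h1 : |ce s| = 1 := by cases s <;> simp [ce]
  have h2 : 64 ≤ cκ s := by cases s <;> simp [cκ]; norm_num
  rw [h1, one_mul, abs_of_nonneg (by positivity)]
  gcongr

/-- `f` is the form with parameter `t`, nonzero leading coefficient and `|disc| < X`. -/
structure CuspForm (s : Bool) (X : ℝ) (f : Fin 4 → ℤ) (t : Fin 4 → ℝ) : Prop where
  phi : Phi s t = toR f
  red : Reduced t
  ne : f 0 ≠ 0
  lt : |((disc f : ℤ) : ℝ)| < X

theorem cusp_block (s : Bool) {X Y : ℝ} (hX : 0 < X) (hY : 1 / 2 ≤ Y) (F : Finset (Fin 4 → ℤ))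
    (t : (Fin 4 → ℤ) → Fin 4 → ℝ) (hF : ∀ f ∈ F, CuspForm s X f (t f))
    (hl : ∀ f ∈ F, Y ≤ t f 1) (hu : ∀ f ∈ F, t f 1 < 4 * Y) :
    (F.card : ℝ) ≤ 10 ^ 8 * X / Y := by
  have hY0 : 0 < Y := by linarith
  rcases F.eq_empty_or_nonempty with rfl | ⟨f₀, hf₀⟩
  · simp only [Finset.card_empty, Nat.cast_zero]
    positivity
  set W : ℝ := (X / (64 * Y ^ 6)) ^ (1 / 4 : ℝ) with hW
  have hW0 : 0 < W := by positivity
  have hW4 : W ^ 4 = X / (64 * Y ^ 6) := by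
    rw [hW, ← Real.rpow_natCast, ← Real.rpow_mul (by positivity)]; norm_num
  have key : ∀ f ∈ F, |t f 2| ≤ W ∧ |t f 3| ≤ W := by
    intro f hf
    have h1 := sq_le_of_disc_lt (s := s) (X := X) hY0 (hl f hf)
      (by rw [(hF f hf).phi, disc_toR]; exact (hF f hf).lt)
    have h2 : (t f 2 ^ 2 + t f 3 ^ 2) ^ 2 ≤ W ^ 4 := by
      rw [hW4, le_div_iff₀ (by positivity)]; linarith
    constructor <;> refine le_of_pow_le_pow_left₀ (n := 4) (by norm_num) hW0.le (le_trans ?_ h2) <;>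
      rw [show ∀ z : ℝ, |z| ^ 4 = (z ^ 2) ^ 2 from fun z => by rw [← sq_abs z]; ring] <;> gcongr <;>
      nlinarith [sq_nonneg (t f 2), sq_nonneg (t f 3)]
  have hWh : 1 / 2 ≤ W := by
    have h0 := congrFun (hF f₀ hf₀).phi 0
    simp [Phi, toR] at h0
    have h1 : (1 : ℝ) ≤ |(f₀ 0 : ℝ)| := by
      exact_mod_cast Int.one_le_abs (hF f₀ hf₀).ne
    rw [← h0, abs_mul, abs_two] at h1
    linarith [(key f₀ hf₀).1]
  set B : Fin 4 → ℝ := ![2 * W, 48 * (W * Y), 384 * (W * Y ^ 2), 1024 * (W * Y ^ 3)] with hB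
  set N := ⌈Y⌉₊ with hN
  have hpar : ∀ f ∈ F, ∀ n ∈ Finset.range N, Phi s ![t f 0 + n, t f 1, t f 2, t f 3] =
      toR (act 1 (-(n : ℤ)) 0 1 f) := by
    intro f hf n _
    rw [Phi_translate, (hF f hf).phi, toR_act]
    push_cast
    rfl
  have hcard : (F ×ˢ Finset.range N).card ≤ (box B).card := by
    refine Finset.card_le_card_of_injOn (fun x => act 1 (-(x.2 : ℤ)) 0 1 x.1) ?_ ?_
    · rintro ⟨f, n⟩ hfn
      obtain ⟨hf, hn⟩ := Finset.mem_product.1 hfn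
      rw [Finset.mem_coe, mem_box]
      have hn' : (n : ℝ) < Y := Nat.lt_ceil.1 (Finset.mem_range.1 hn)
      have hr := (hF f hf).red
      have := abs_Phi_le s ![t f 0 + n, t f 1, t f 2, t f 3] (W := W) (M := 4 * Y) (key f hf).1
        (key f hf).2 (by
          simp only [Matrix.cons_val]
          have : (0 : ℝ) ≤ n := Nat.cast_nonneg n
          rw [abs_of_nonneg (by linarith [hr.1])]
          linarith [hr.2.1]) (by
          simp only [Matrix.cons_val]
          rw [abs_of_pos hr.2.2.2]
          exact (hu f hf).le)
      rw [hpar f hf n hn] at this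
      obtain ⟨k0, k1, k2, k3⟩ := this
      simp only [toR] at k0 k1 k2 k3
      intro i
      fin_cases i <;> simp only [hB, Fin.zero_eta, Fin.mk_one, Fin.reduceFinMk, Matrix.cons_val] <;>
        linarith
    · rintro ⟨f, n⟩ hfn ⟨f', n'⟩ hfn' heq
      obtain ⟨hf, hn⟩ := Finset.mem_product.1 (Finset.mem_coe.1 hfn)
      obtain ⟨hf', hn'⟩ := Finset.mem_product.1 (Finset.mem_coe.1 hfn')
      simp only at heq hf hn hf' hn'
      have e := (hpar f hf n hn).trans ((congrArg toR heq).trans (hpar f' hf' n' hn').symm)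
      have hr := (hF f hf).red
      have hr' := (hF f' hf').red
      have hw : t f 2 ^ 2 + t f 3 ^ 2 ≠ 0 := by
        have h0 := congrFun (hF f hf).phi 0
        have h1 := (hF f hf).ne
        intro h2
        have : t f 2 = 0 := by nlinarith [sq_nonneg (t f 2), sq_nonneg (t f 3)]
        simp [Phi, toR, this] at h0
        exact h1 (by exact_mod_cast h0.symm)
      have e2 := Phi_inj s (t := ![t f 0 + n, t f 1, t f 2, t f 3])
        (t' := ![t f' 0 + n', t f' 1, t f' 2, t f' 3]) hr.2.2.2 hr'.2.2.2 hw e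
      have e20 : t f 0 + n = t f' 0 + n' := congrFun e2 0
      have hnn : n = n' := by
        have h1 : ((n : ℤ) : ℝ) - (n' : ℤ) < 1 := by push_cast; linarith [hr.1, hr'.2.1]
        have h2 : ((n' : ℤ) : ℝ) - (n : ℤ) < 1 := by push_cast; linarith [hr'.1, hr.2.1]
        have h1' : (n : ℤ) - n' < 1 := by exact_mod_cast h1
        have h2' : (n' : ℤ) - n < 1 := by exact_mod_cast h2
        omega
      subst hnn
      have : t f = t f' := ext4 (add_right_cancel e20) (congrFun e2 1) (congrFun e2 2)
        (congrFun e2 3)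
      have hff : f = f' := toR_injective (by rw [← (hF f hf).phi, ← (hF f' hf').phi, this])
      rw [hff]
  have hb := card_box_le (B := B) (by
    intro i; fin_cases i <;> simp [hB] <;> positivity)
  have hprod : ∏ i, (2 * B i + 1) ≤ 10 ^ 8 * X := by
    simp only [Fin.prod_univ_four, hB, Matrix.cons_val]
    have h1 : 1 / 4 ≤ W * Y := by nlinarith
    have h2 : 1 / 8 ≤ W * Y ^ 2 := by nlinarith
    have h3 : 1 / 16 ≤ W * Y ^ 3 := by nlinarith [sq_nonneg Y]
    calc _ ≤ (6 * W) * (100 * (W * Y)) * (776 * (W * Y ^ 2)) * (2064 * (W * Y ^ 3)) := by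
          gcongr <;> linarith
      _ = 6 * 100 * 776 * 2064 * (W ^ 4 * Y ^ 6) := by ring
      _ = 6 * 100 * 776 * 2064 / 64 * X := by
          rw [hW4]; field_simp
      _ ≤ 10 ^ 8 * X := by gcongr; norm_num
  rw [Finset.card_product, Finset.card_range] at hcard
  rw [le_div_iff₀ hY0]
  have hc : ((F.card * N : ℕ) : ℝ) ≤ (box B).card := by exact_mod_cast hcard
  push_cast at hc
  have : Y ≤ N := Nat.le_ceil Y
  calc (F.card : ℝ) * Y ≤ F.card * N := by gcongr
    _ ≤ _ := hc.trans (hb.trans hprod)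

theorem cusp_bound (s : Bool) {X T : ℝ} (hX : 0 < X) (hT : 1 / 2 ≤ T) (F : Finset (Fin 4 → ℤ))
    (hF : ∀ f ∈ F, ∃ t, CuspForm s X f t ∧ T ≤ t 1) :
    (F.card : ℝ) ≤ 2 * 10 ^ 8 * X / T := by
  have hT0 : 0 < T := by linarith
  choose! t ht hTt using hF
  have : ∀ f ∈ F, ∃ k : ℕ, T * 4 ^ k ≤ t f 1 ∧ t f 1 < 4 * (T * 4 ^ k) := by
    intro f hf
    obtain ⟨k, h1, h2⟩ := exists_nat_pow_near (x := t f 1 / T) (y := 4)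
      (by rw [le_div_iff₀ hT0]; linarith [hTt f hf]) (by norm_num)
    rw [le_div_iff₀ hT0] at h1
    rw [div_lt_iff₀ hT0] at h2
    exact ⟨k, by linarith, by rw [pow_succ] at h2; linarith⟩
  choose! k hk1 hk2 using this
  have hsum := Finset.card_eq_sum_card_image k F
  rw [hsum]
  push_cast
  have hle : ∀ j ∈ F.image k, (((F.filter fun f => k f = j).card : ℕ) : ℝ) ≤
      10 ^ 8 * X / T * (1 / 4) ^ j := by
    intro j _
    have hone : (1 : ℝ) ≤ 4 ^ j := one_le_pow₀ (by norm_num)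
    refine (cusp_block s hX (Y := T * 4 ^ j) (by nlinarith) _ t ?_ ?_ ?_).trans (le_of_eq ?_)
    · intro f hf
      exact ht f (Finset.mem_filter.1 hf).1
    · intro f hf
      rw [Finset.mem_filter] at hf
      rw [← hf.2]; exact hk1 f hf.1
    · intro f hf
      rw [Finset.mem_filter] at hf
      rw [← hf.2]; exact hk2 f hf.1
    · rw [one_div, inv_pow]; field_simp
  have hs : Summable fun j : ℕ => (1 / 4 : ℝ) ^ j :=
    summable_geometric_of_lt_one (by norm_num) (by norm_num)
  have hgeo : ∑ j ∈ F.image k, (1 / 4 : ℝ) ^ j ≤ 2 := by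
    refine (hs.sum_le_tsum _ fun j _ => by positivity).trans ?_
    rw [tsum_geometric_of_lt_one (by norm_num) (by norm_num)]
    norm_num
  refine (Finset.sum_le_sum hle).trans ?_
  rw [← Finset.mul_sum]
  calc _ ≤ 10 ^ 8 * X / T * 2 := by gcongr
    _ = _ := by ring

end BCF

namespace BCF

open MeasureTheory

/-! ### Counting lattice points in residue classes -/

section Lattice

variable {m : ℕ}

/-- Reduction of an integral form modulo `m`. -/
def modm (m : ℕ) (f : Fin 4 → ℤ) : Fin 4 → ZMod m := fun i => (f i : ZMod m)

/-- Integral forms in the dilate `r A` with residue in `G`. -/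
def latt (G : Finset (Fin 4 → ZMod m)) (A : Set (Fin 4 → ℝ)) (r : ℝ) : Set (Fin 4 → ℤ) :=
  {f | (fun i => (f i : ℝ) / r) ∈ A ∧ modm m f ∈ G}

theorem latt_subset_box (G : Finset (Fin 4 → ZMod m)) {A : Set (Fin 4 → ℝ)} {R r : ℝ}
    (hA : ∀ x ∈ A, ∀ i, |x i| ≤ R) (hr : 0 < r) :
    latt G A r ⊆ box fun _ => R * r := by
  intro f hf
  rw [Finset.mem_coe, mem_box]
  intro i
  have := hA _ hf.1 i
  rwa [abs_div, abs_of_pos hr, div_le_iff₀ hr] at this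

theorem latt_finite (G : Finset (Fin 4 → ZMod m)) {A : Set (Fin 4 → ℝ)}
    (hA : Bornology.IsBounded A) {r : ℝ} (hr : 0 < r) : (latt G A r).Finite := by
  obtain ⟨R, hR⟩ := hA.exists_norm_le
  exact (Finset.finite_toSet _).subset
    (latt_subset_box G (fun x hx i => (norm_le_pi_norm x i).trans (hR x hx)) hr)

/-- The half open cube of side `m / r` attached to the lattice point `f / r`. -/
def cell (m : ℕ) (r : ℝ) (f : Fin 4 → ℤ) : Set (Fin 4 → ℝ) :=
  Set.univ.pi fun i => Set.Ico ((f i : ℝ) / r) ((f i : ℝ) / r + m / r)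

theorem measurableSet_cell (r : ℝ) (f : Fin 4 → ℤ) : MeasurableSet (cell m r f) :=
  MeasurableSet.univ_pi fun _ => measurableSet_Ico

theorem volume_cell {r : ℝ} (hr : 0 < r) (f : Fin 4 → ℤ) :
    volume.real (cell m r f) = (m / r) ^ 4 := by
  rw [Measure.real, cell, Real.volume_pi_Ico_toReal]
  · simp [div_pow]
  · intro i
    simp only [le_add_iff_nonneg_right]
    positivity

theorem volume_cell_ne_top (r : ℝ) (f : Fin 4 → ℤ) : volume (cell m r f) ≠ ⊤ := by
  rw [cell, Real.volume_pi_Ico]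
  exact ENNReal.prod_ne_top fun _ _ => ENNReal.ofReal_ne_top

theorem eq_of_mem_cell {r : ℝ} (hr : 0 < r) {f g : Fin 4 → ℤ} (h : modm m f = modm m g)
    {x : Fin 4 → ℝ} (hf : x ∈ cell m r f) (hg : x ∈ cell m r g) : f = g := by
  funext i
  have h1 := hf i (Set.mem_univ i)
  have h2 := hg i (Set.mem_univ i)
  simp only [Set.mem_Ico, ← add_div] at h1 h2
  have a1 := (div_le_iff₀ hr).1 h1.1
  have a2 := (lt_div_iff₀ hr).1 h1.2
  have b1 := (div_le_iff₀ hr).1 h2.1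
  have b2 := (lt_div_iff₀ hr).1 h2.2
  have hd : (m : ℤ) ∣ f i - g i := by
    rw [← ZMod.intCast_eq_intCast_iff_dvd_sub]
    exact (congrFun h i).symm
  have hlt : |f i - g i| < m := by
    rw [abs_lt]
    constructor
    · have : (-(m : ℤ) : ℝ) < ((f i - g i : ℤ) : ℝ) := by push_cast; linarith
      exact_mod_cast this
    · have : ((f i - g i : ℤ) : ℝ) < ((m : ℤ) : ℝ) := by push_cast; linarith
      exact_mod_cast this
  linarith [Int.eq_zero_of_abs_lt_dvd hd hlt]

theorem dist_of_mem_cell {r : ℝ} (hr : 0 < r) {f : Fin 4 → ℤ} {x : Fin 4 → ℝ}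
    (hf : x ∈ cell m r f) : dist x (fun i => (f i : ℝ) / r) ≤ m / r := by
  rw [dist_pi_le_iff (by positivity)]
  intro i
  have h1 := hf i (Set.mem_univ i)
  simp only [Set.mem_Ico] at h1
  rw [Real.dist_eq, abs_le]
  constructor <;> linarith [show 0 ≤ (m : ℝ) / r by positivity]

theorem exists_mem_cell {r : ℝ} (hr : 0 < r) (hm : 0 < m) (c : Fin 4 → ZMod m) (x : Fin 4 → ℝ) :
    ∃ f, modm m f = c ∧ x ∈ cell m r f := by
  have : NeZero m := ⟨hm.ne'⟩
  have hm' : (0 : ℝ) < m := by exact_mod_cast hm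
  refine ⟨fun i => ((c i).val : ℤ) + m * ⌊(r * x i - (c i).val) / m⌋, ?_, ?_⟩
  · funext i
    simp [modm]
  · intro i _
    simp only [Set.mem_Ico, ← add_div]
    have h1 := Int.floor_le ((r * x i - (c i).val) / m)
    have h2 := Int.lt_floor_add_one ((r * x i - (c i).val) / m)
    rw [le_div_iff₀ hm'] at h1
    rw [div_lt_iff₀ hm'] at h2
    rw [div_le_iff₀ hr, lt_div_iff₀ hr]
    push_cast
    constructor <;> linarith

theorem card_mul_le_of_class {r : ℝ} (hr : 0 < r) {c : Fin 4 → ZMod m}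
    (F : Finset (Fin 4 → ℤ)) (hF : ∀ f ∈ F, modm m f = c) {A : Set (Fin 4 → ℝ)}
    (hA : volume A ≠ ⊤) (hc : ∀ f ∈ F, cell m r f ⊆ A) :
    (F.card : ℝ) * (m / r) ^ 4 ≤ volume.real A := by
  have h : volume.real (⋃ f ∈ F, cell m r f) = ∑ f ∈ F, volume.real (cell m r f) := by
    apply measureReal_biUnion_finset
    · intro f hf g hg hne
      refine Set.disjoint_left.2 fun x hx hx' => hne ?_
      exact eq_of_mem_cell hr ((hF f hf).trans (hF g hg).symm) hx hx'
    · exact fun f _ => measurableSet_cell r f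
    · exact fun f _ => volume_cell_ne_top r f
  simp only [volume_cell hr, Finset.sum_const, nsmul_eq_mul] at h
  rw [← h]
  exact measureReal_mono (Set.iUnion₂_subset hc) hA

theorem le_card_mul_of_class {r : ℝ} (hr : 0 < r)
    (F : Finset (Fin 4 → ℤ)) {A : Set (Fin 4 → ℝ)}
    (hc : A ⊆ ⋃ f ∈ F, cell m r f) :
    volume.real A ≤ (F.card : ℝ) * (m / r) ^ 4 := by
  refine (measureReal_mono hc ?_).trans ((measureReal_biUnion_finset_le _ _).trans ?_)
  · exact ((measure_biUnion_finset_le _ _).trans_lt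
      (ENNReal.sum_lt_top.2 fun f _ => (volume_cell_ne_top r f).lt_top)).ne
  · simp only [volume_cell hr, Finset.sum_const, nsmul_eq_mul, le_refl]

theorem ncard_latt_eq_sum (G : Finset (Fin 4 → ZMod m)) {A : Set (Fin 4 → ℝ)}
    (hA : Bornology.IsBounded A) {r : ℝ} (hr : 0 < r) :
    (latt G A r).ncard = ∑ c ∈ G, (latt {c} A r).ncard := by
  classical
  rw [Set.ncard_eq_toFinset_card _ (latt_finite G hA hr),
    Finset.card_eq_sum_card_fiberwise (f := modm m) (t := G)]
  · refine Finset.sum_congr rfl fun c hc => ?_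
    rw [Set.ncard_eq_toFinset_card _ (latt_finite {c} hA hr)]
    congr 1
    ext f
    simp only [Finset.mem_filter, Set.Finite.mem_toFinset, latt, Set.mem_ofPred_eq,
      Finset.mem_singleton]
    constructor
    · rintro ⟨⟨h1, _⟩, h2⟩
      exact ⟨h1, h2⟩
    · rintro ⟨h1, h2⟩
      exact ⟨⟨h1, h2 ▸ hc⟩, h2⟩
  · intro f hf
    simp only [Set.Finite.coe_toFinset] at hf
    exact hf.2

theorem tendsto_const_div_atTop_nhds (m : ℕ) : Tendsto (fun r : ℝ => (m : ℝ) / r) atTop (nhds 0) :=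
  tendsto_const_nhds.div_atTop tendsto_id

theorem eventually_ncard_latt_le (hm : 0 < m) (G : Finset (Fin 4 → ZMod m))
    {K : Set (Fin 4 → ℝ)} (hK : IsCompact K) {c : ℝ}
    (hc : (G.card : ℝ) / m ^ 4 * volume.real K < c) :
    ∀ᶠ r : ℝ in atTop, ((latt G K r).ncard : ℝ) ≤ c * r ^ 4 := by
  have hm' : (0 : ℝ) < m := by exact_mod_cast hm
  have ht := (tendsto_measure_cthickening_of_isCompact (μ := volume) hK).comp
    (tendsto_const_div_atTop_nhds m)
  have ht2 := ((ENNReal.tendsto_toReal hK.measure_lt_top.ne).comp ht).const_mul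
    ((G.card : ℝ) / m ^ 4)
  filter_upwards [ht2.eventually_lt_const hc, eventually_gt_atTop 0] with r hr hr0
  simp only [Function.comp_apply] at hr
  have hclass : ∀ a ∈ G, ((latt {a} K r).ncard : ℝ) ≤
      volume.real (Metric.cthickening (m / r) K) * (r / m) ^ 4 := by
    intro a _
    have hfin := latt_finite {a} hK.isBounded hr0
    rw [Set.ncard_eq_toFinset_card _ hfin]
    have := card_mul_le_of_class (m := m) hr0 hfin.toFinset (c := a) (fun f hf => by
      simpa [latt] using (hfin.mem_toFinset.1 hf).2) (A := Metric.cthickening (m / r) K)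
      (hK.cthickening.measure_lt_top.ne) (fun f hf x hx =>
        Metric.mem_cthickening_of_dist_le x _ _ _ (hfin.mem_toFinset.1 hf).1
          (dist_of_mem_cell hr0 hx))
    calc _ = (hfin.toFinset.card : ℝ) * (m / r) ^ 4 * (r / m) ^ 4 := by
          field_simp
      _ ≤ _ := by gcongr
  rw [ncard_latt_eq_sum G hK.isBounded hr0]
  push_cast
  refine (Finset.sum_le_sum hclass).trans ?_
  rw [Finset.sum_const, nsmul_eq_mul]
  calc _ = (G.card : ℝ) / m ^ 4 * volume.real (Metric.cthickening (m / r) K) * r ^ 4 := by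
        rw [div_pow]; field_simp
    _ ≤ c * r ^ 4 := by
        gcongr
        exact hr.le

theorem eventually_le_ncard_latt (hm : 0 < m) (G : Finset (Fin 4 → ZMod m))
    {U : Set (Fin 4 → ℝ)} (hU : IsOpen U) (hb : Bornology.IsBounded U) {c : ℝ}
    (hc : c < (G.card : ℝ) / m ^ 4 * volume.real U) :
    ∀ᶠ r : ℝ in atTop, c * r ^ 4 ≤ ((latt G U r).ncard : ℝ) := by
  have hm' : (0 : ℝ) < m := by exact_mod_cast hm
  have hUt : volume U ≠ ⊤ := hb.measure_lt_top.ne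
  have hfin : IsFiniteMeasure (volume.restrict U) := ⟨by
    rw [Measure.restrict_apply_univ]; exact hUt.lt_top⟩
  have ht := (tendsto_measure_cthickening_of_isClosed (μ := volume.restrict U) (s := Uᶜ)
    ⟨1, one_pos, measure_ne_top _ _⟩ hU.isClosed_compl).comp (tendsto_const_div_atTop_nhds m)
  rw [Measure.restrict_apply hU.measurableSet.compl, Set.compl_inter_self, measure_empty] at ht
  have ht2 := ((((ENNReal.tendsto_toReal ENNReal.zero_ne_top).comp ht).const_sub
    (volume.real U)).const_mul ((G.card : ℝ) / m ^ 4))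
  rw [ENNReal.toReal_zero, sub_zero] at ht2
  filter_upwards [ht2.eventually_const_lt hc, eventually_gt_atTop 0] with r hr hr0
  simp only [Function.comp_apply] at hr
  set N := Metric.cthickening (m / r) Uᶜ with hN
  have hNm : MeasurableSet N := Metric.isClosed_cthickening.measurableSet
  rw [Measure.restrict_apply hNm] at hr
  have hdiff : volume.real U - (volume (N ∩ U)).toReal = volume.real (U \ N) := by
    have := measureReal_inter_add_sdiff (μ := volume) (s := U) hNm hUt
    rw [Set.inter_comm] at this
    simp only [Measure.real] at this ⊢
    linarith
  rw [hdiff] at hr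
  have hclass : ∀ a ∈ G, volume.real (U \ N) * (r / m) ^ 4 ≤ ((latt {a} U r).ncard : ℝ) := by
    intro a _
    have hfin := latt_finite {a} hb hr0
    rw [Set.ncard_eq_toFinset_card _ hfin]
    have := le_card_mul_of_class (m := m) hr0 hfin.toFinset (A := U \ N) (fun x hx => by
      obtain ⟨f, hf, hxf⟩ := exists_mem_cell (m := m) hr0 hm a x
      rw [Set.mem_iUnion₂]
      refine ⟨f, ?_, hxf⟩
      rw [hfin.mem_toFinset]
      refine ⟨?_, by simpa using hf⟩
      by_contra hcon
      exact hx.2 (Metric.mem_cthickening_of_dist_le x _ _ _ hcon (dist_of_mem_cell hr0 hxf)))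
    calc _ ≤ (hfin.toFinset.card : ℝ) * (m / r) ^ 4 * (r / m) ^ 4 := by gcongr
      _ = _ := by field_simp
  rw [ncard_latt_eq_sum G hb hr0]
  push_cast
  refine le_trans ?_ (Finset.sum_le_sum hclass)
  rw [Finset.sum_const, nsmul_eq_mul]
  calc c * r ^ 4 ≤ (G.card : ℝ) / m ^ 4 * volume.real (U \ N) * r ^ 4 := by gcongr
    _ = _ := by rw [div_pow]; field_simp

end Lattice

end BCF

namespace BCF

/-! ### Local densities -/

section Local

variable {R F : Type*} [CommRing R] [Field F] (φ : R →+* F)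

/-- `BadCoeff` over a ring with residue field `F`. -/
def LBC (f : Fin 4 → R) : Prop := φ (f 0) = 0 ∧ φ (f 1) = 0 ∧ (f 0 = 0 ∨ φ (f 2) = 0)

/-- `BadAt` over a ring with residue field `F`. -/
def LBA (f : Fin 4 → R) : Prop := LBC φ f ∨ ∃ k : R, LBC φ (act k (-1) 1 0 f)

/-- Forms satisfying `LBC` which do not vanish in the residue field. -/
def LW (f : Fin 4 → R) : Prop := LBC φ f ∧ ¬(φ (f 2) = 0 ∧ φ (f 3) = 0)

variable {φ}

theorem act_shift (k i : R) (f : Fin 4 → R) :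
    act i (-1) 1 0 f = act 1 0 (k - i) 1 (act k (-1) 1 0 f) := by
  rw [act_act]
  apply ext4 <;> simp

theorem act_unshift (k : R) (f : Fin 4 → R) : act 0 1 (-1) k (act k (-1) 1 0 f) = f := by
  rw [act_act]
  apply ext4 <;> simp

theorem act_unshift' (k : R) (f : Fin 4 → R) : act k (-1) 1 0 (act 0 1 (-1) k f) = f := by
  rw [act_act]
  apply ext4 <;> simp

theorem LW.shift (hφ : ∀ x y, φ x = 0 → φ y = 0 → x * y = 0) {f : Fin 4 → R} (h : LW φ f) {e : R}
    (he : φ e = 0) : LW φ (act 1 0 e 1 f) := by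
  obtain ⟨⟨h0, h1, h2⟩, h3⟩ := h
  refine ⟨⟨by simp [h0, h1, he], by simp [h1, he], ?_⟩, by simpa [he] using h3⟩
  rcases h2 with h2 | h2
  · left
    have e1 := hφ _ _ h1 he
    have e2 := hφ _ _ he he
    simp only [act_zero', h2]
    linear_combination e1 + (f 2 + f 3 * e) * e2
  · right
    simp [h2, he]

theorem not_LW_shift {f : Fin 4 → R} (h : LW φ f) {e : R} (he : φ e ≠ 0)
    (h' : LBC φ (act 1 0 e 1 f)) : False := by
  obtain ⟨⟨h0, h1, -⟩, h3⟩ := h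
  obtain ⟨k0, k1, -⟩ := h'
  simp [h0, h1, map_ofNat] at k0 k1
  have j0 : φ (f 2) + φ (f 3) * φ e = 0 := by
    apply mul_left_cancel₀ (pow_ne_zero 2 he); linear_combination k0
  have j1 : 2 * φ (f 2) + 3 * φ (f 3) * φ e = 0 := by
    apply mul_left_cancel₀ he; linear_combination k1
  have j3 : φ (f 3) = 0 := by
    apply mul_left_cancel₀ he; linear_combination j1 - 2 * j0
  exact h3 ⟨by rw [j3] at j0; simpa using j0, j3⟩

theorem not_LW_unshift {f : Fin 4 → R} (h : LW φ f) {k : R} (h' : LBC φ (act 0 1 (-1) k f)) :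
    False := by
  obtain ⟨-, h3⟩ := h
  obtain ⟨k0, k1, -⟩ := h'
  simp at k0 k1
  simp [k0] at k1
  exact h3 ⟨k1, k0⟩

theorem LBA_iff (hφ : ∀ x y, φ x = 0 → φ y = 0 → x * y = 0) {p : ℕ}
    (hp : ∀ k : R, ∃ i < p, φ (k - (i : ℕ)) = 0) (f : Fin 4 → R) :
    LBA φ f ↔ (∀ i, φ (f i) = 0) ∨ LW φ f ∨ ∃ i < p, ∃ w, LW φ w ∧ act 0 1 (-1) (i : R) w = f := by
  constructor
  · rintro (h | ⟨k, hk⟩)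
    · by_cases h' : φ (f 2) = 0 ∧ φ (f 3) = 0
      · left
        intro i
        fin_cases i
        exacts [h.1, h.2.1, h'.1, h'.2]
      · exact Or.inr (Or.inl ⟨h, h'⟩)
    · by_cases h' : φ (act k (-1) 1 0 f 2) = 0 ∧ φ (act k (-1) 1 0 f 3) = 0
      · left
        obtain ⟨h0, h1, -⟩ := hk
        have hf := act_unshift k f
        generalize act k (-1) 1 0 f = g at *
        rw [← hf]
        intro i
        fin_cases i <;> simp [h0, h1, h'.1, h'.2]
      · right; right
        obtain ⟨i, hi, he⟩ := hp k
        exact ⟨i, hi, _, LW.shift hφ (f := act k (-1) 1 0 f) ⟨hk, h'⟩ he, by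
          rw [← act_shift, act_unshift]⟩
  · rintro (h | h | ⟨i, -, w, hw, rfl⟩)
    · exact Or.inl ⟨h 0, h 1, Or.inr (h 2)⟩
    · exact Or.inl h.1
    · exact Or.inr ⟨i, by rw [act_unshift']; exact hw.1⟩

open Classical in
theorem card_LBA [Fintype R] (hφ : ∀ x y, φ x = 0 → φ y = 0 → x * y = 0) {p : ℕ}
    (hp : ∀ k : R, ∃ i < p, φ (k - (i : ℕ)) = 0)
    (hinj : ∀ i < p, ∀ j < p, φ ((i : ℕ) - (j : ℕ) : R) = 0 → i = j)
    (hk : (Finset.univ.filter fun x : R => φ x = 0).card = p) (hR : Fintype.card R = p ^ 2) :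
    ((Finset.univ.filter fun f : Fin 4 → R => LBA φ f).card : ℤ) = 2 * p ^ 6 - p ^ 4 := by
  set Z := Finset.univ.filter fun f : Fin 4 → R => ∀ i, φ (f i) = 0 with hZ
  set W := Finset.univ.filter fun f : Fin 4 → R => LW φ f with hW
  set V := (Finset.range p ×ˢ W).image (fun x => act 0 1 (-1) (x.1 : R) x.2) with hV
  set N := Finset.univ.filter fun x : R => φ x = 0 with hN
  have hNc : ((Finset.univ \ N).card : ℤ) = p ^ 2 - p := by
    rw [Finset.card_sdiff_of_subset (Finset.subset_univ _), Finset.card_univ, hR, hk]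
    rw [Nat.cast_sub (by nlinarith)]
    push_cast; ring
  have hZc : (Z.card : ℤ) = p ^ 4 := by
    have : Z = Fintype.piFinset fun _ => N := by ext f; simp [hZ, hN]
    rw [this, Fintype.card_piFinset]
    simp [hk]
  have hWc : (W.card : ℤ) = 2 * p ^ 4 * (p - 1) := by
    have : W = Fintype.piFinset ![{0}, N, Finset.univ \ N, Finset.univ] ∪
        Fintype.piFinset ![N, N, N, Finset.univ \ N] := by
      ext f
      simp only [hW, hN, Finset.mem_filter, Finset.mem_univ, true_and, Finset.mem_union,
        Fintype.mem_piFinset, Fin.forall_fin_succ, Matrix.cons_val_zero, Matrix.cons_val_succ,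
        Fin.succ_zero_eq_one, Fin.succ_one_eq_two, IsEmpty.forall_iff, Finset.mem_singleton,
        Finset.mem_sdiff]
      have h3 : (Fin.succ 2 : Fin 4) = 3 := rfl
      simp only [LW, LBC]
      have h0 : f 0 = 0 → φ (f 0) = 0 := fun h => by rw [h, map_zero]
      rw [h3]
      tauto
    rw [this, Finset.card_union_of_disjoint]
    · rw [Fintype.card_piFinset, Fintype.card_piFinset]
      push_cast
      simp only [Fin.prod_univ_four, Matrix.cons_val, hNc, hk, Finset.card_univ, hR]
      simp
      ring
    · rw [Finset.disjoint_left]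
      intro f h1 h2
      rw [Fintype.mem_piFinset] at h1 h2
      have a1 := h1 2
      have a2 := h2 2
      simp at a1 a2
      exact a1 a2
  have hVc : (V.card : ℤ) = p * W.card := by
    rw [hV, Finset.card_image_of_injOn, Finset.card_product, Finset.card_range]
    · push_cast; ring
    · rintro ⟨i, w⟩ hiw ⟨j, w'⟩ hjw heq
      simp only [Finset.coe_product, Set.mem_prod, Finset.mem_coe, Finset.mem_range, hW,
        Finset.mem_filter, Finset.mem_univ, true_and] at hiw hjw heq
      have h1 : act (j : R) (-1) 1 0 (act 0 1 (-1) (i : R) w) = w' := by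
        rw [heq, act_unshift']
      rw [act_shift (i : R), act_unshift'] at h1
      have hij : i = j := by
        by_contra hne
        refine not_LW_shift hiw.2 (e := (i : R) - j) (fun h => hne ?_) (h1 ▸ hjw.2.1)
        exact hinj i hiw.1 j hjw.1 h
      subst hij
      rw [sub_self, act_id] at h1
      rw [h1]
  have hZW : Disjoint Z W := by
    rw [Finset.disjoint_left]
    intro f h1 h2
    simp only [hZ, hW, Finset.mem_filter, Finset.mem_univ, true_and] at h1 h2
    exact h2.2 ⟨h1 2, h1 3⟩
  have hZWV : Disjoint (Z ∪ W) V := by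
    rw [Finset.disjoint_left]
    intro f h1 h2
    simp only [hZ, hW, hV, Finset.mem_filter, Finset.mem_univ, true_and, Finset.mem_union,
      Finset.mem_image, Finset.mem_product, Prod.exists] at h1 h2
    obtain ⟨i, w, ⟨-, hw⟩, rfl⟩ := h2
    refine not_LW_unshift hw (k := (i : R)) ?_
    rcases h1 with h | h
    · exact ⟨h 0, h 1, Or.inr (h 2)⟩
    · exact h.1
  have hall : (Finset.univ.filter fun f : Fin 4 → R => LBA φ f) = (Z ∪ W) ∪ V := by
    ext f
    simp only [LBA_iff hφ hp, hZ, hW, hV, Finset.mem_filter, Finset.mem_univ, true_and,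
      Finset.mem_union, Finset.mem_image, Finset.mem_product, Prod.exists, Finset.mem_range]
    rw [or_assoc]
    refine or_congr_right (or_congr_right ⟨?_, ?_⟩)
    · rintro ⟨i, hi, w, hw, rfl⟩
      exact ⟨i, w, ⟨hi, hw⟩, rfl⟩
    · rintro ⟨i, w, ⟨hi, hw⟩, rfl⟩
      exact ⟨i, hi, w, hw, rfl⟩
  rw [hall, Finset.card_union_of_disjoint hZWV, Finset.card_union_of_disjoint hZW]
  push_cast
  rw [hVc, hZc, hWc]
  ring

end Local

/-- Reduction from `ℤ/p²` to `ℤ/p`. -/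
def redp (p : ℕ) : ZMod (p ^ 2) →+* ZMod p := ZMod.castHom (dvd_pow_self p two_ne_zero) _

theorem badCoeff_iff_LBC {p : ℕ} [Fact p.Prime] (f : Fin 4 → ℤ) :
    BadCoeff p f ↔ LBC (redp p) (modm (p ^ 2) f) := by
  simp only [BadCoeff, LBC, modm, map_intCast, ZMod.intCast_zmod_eq_zero_iff_dvd]
  push_cast
  rfl

theorem modm_act (m : ℕ) (p q r s : ℤ) (f : Fin 4 → ℤ) :
    modm m (act p q r s f) = act (p : ZMod m) q r s (modm m f) :=
  act_map (Int.castRingHom (ZMod m)) p q r s f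

theorem badAt_iff_LBA {p : ℕ} [Fact p.Prime] (f : Fin 4 → ℤ) :
    BadAt p f ↔ LBA (redp p) (modm (p ^ 2) f) := by
  simp only [BadAt, LBA, badCoeff_iff_LBC, modm_act]
  refine or_congr_right ⟨?_, ?_⟩
  · rintro ⟨k, hk⟩
    exact ⟨k, by simpa using hk⟩
  · rintro ⟨k, hk⟩
    obtain ⟨k, rfl⟩ := ZMod.intCast_surjective k
    exact ⟨k, by simpa using hk⟩

open Classical in
theorem card_bad (p : ℕ) [hp : Fact p.Prime] :
    ((Finset.univ.filter fun f : Fin 4 → ZMod (p ^ 2) => LBA (redp p) f).card : ℤ) =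
      2 * p ^ 6 - p ^ 4 := by
  have hp0 := hp.out.pos
  have key : ∀ x : ZMod (p ^ 2), redp p x = 0 → ∃ y, x = p * y := by
    intro x hx
    obtain ⟨n, rfl⟩ := ZMod.intCast_surjective x
    rw [map_intCast, ZMod.intCast_zmod_eq_zero_iff_dvd] at hx
    obtain ⟨k, rfl⟩ := hx
    exact ⟨k, by push_cast; rfl⟩
  have hpp : (p : ZMod (p ^ 2)) * p = 0 := by
    rw [← Nat.cast_mul, ← pow_two, ZMod.natCast_self]
  apply card_LBA
  · intro x y hx hy
    obtain ⟨a, rfl⟩ := key x hx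
    obtain ⟨b, rfl⟩ := key y hy
    linear_combination a * b * hpp
  · intro k
    refine ⟨(redp p k).val, ZMod.val_lt _, ?_⟩
    rw [map_sub, map_natCast, ZMod.natCast_zmod_val, sub_self]
  · intro i hi j hj h
    rw [map_sub, map_natCast, map_natCast, sub_eq_zero, ZMod.natCast_eq_natCast_iff',
      Nat.mod_eq_of_lt hi, Nat.mod_eq_of_lt hj] at h
    exact h
  · have : (Finset.univ.filter fun x : ZMod (p ^ 2) => redp p x = 0) =
        (Finset.range p).image fun i : ℕ => (p * i : ZMod (p ^ 2)) := by
      ext x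
      simp only [Finset.mem_filter, Finset.mem_univ, true_and, Finset.mem_image, Finset.mem_range]
      constructor
      · intro hx
        obtain ⟨y, rfl⟩ := key x hx
        refine ⟨(redp p y).val, ZMod.val_lt _, ?_⟩
        obtain ⟨z, hz⟩ := key (y - ((redp p y).val : ℕ)) (by simp)
        linear_combination (-(p : ZMod (p ^ 2))) * hz - z * hpp
      · rintro ⟨i, -, rfl⟩
        simp
    refine Eq.trans (by convert congrArg Finset.card this) ?_
    rw [Finset.card_image_of_injOn, Finset.card_range]
    intro i hi j hj h
    simp only [Finset.coe_range, Set.mem_Iio] at hi hj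
    have h' : ((p * i : ℕ) : ZMod (p ^ 2)) = ((p * j : ℕ) : ZMod (p ^ 2)) := by
      push_cast; exact h
    rw [ZMod.natCast_eq_natCast_iff', Nat.mod_eq_of_lt (by nlinarith),
      Nat.mod_eq_of_lt (by nlinarith)] at h'
    exact Nat.eq_of_mul_eq_mul_left hp0 h'
  · rw [ZMod.card]

/-- Forms modulo `m n` as pairs of forms modulo `m` and `n`. -/
def crtForms {m n : ℕ} (h : m.Coprime n) :
    (Fin 4 → ZMod (m * n)) ≃ (Fin 4 → ZMod m) × (Fin 4 → ZMod n) :=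
  ((Equiv.refl _).arrowCongr (ZMod.chineseRemainder h).toEquiv).trans
    (Equiv.arrowProdEquivProdArrow _ _ _)

theorem crtForms_modm {m n : ℕ} (h : m.Coprime n) (f : Fin 4 → ℤ) :
    crtForms h (modm (m * n) f) = (modm m f, modm n f) := by
  ext i <;> simp [crtForms, modm, Equiv.arrowProdEquivProdArrow]

theorem exists_residues (S : Finset ℕ) (hS : ∀ p ∈ S, p.Prime) :
    ∃ m : ℕ, 0 < m ∧ m = ∏ p ∈ S, p ^ 2 ∧ ∃ G : Finset (Fin 4 → ZMod m),
      (∀ f : Fin 4 → ℤ, modm m f ∈ G ↔ ∀ p ∈ S, ¬BadAt p f) ∧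
      (G.card : ℝ) / m ^ 4 = ∏ p ∈ S, (1 - ((p : ℝ) ^ 2)⁻¹) ^ 2 := by
  classical
  induction S using Finset.induction_on with
  | empty => exact ⟨1, one_pos, by simp, Finset.univ, fun f => ⟨fun _ => by simp, fun _ => Finset.mem_univ _⟩, by simp⟩
  | insert q S hq ih =>
    obtain ⟨m, hm, hmS, G, hG, hc⟩ := ih fun p hp => hS p (Finset.mem_insert_of_mem hp)
    have hqp : q.Prime := hS q (Finset.mem_insert_self _ _)
    have : Fact q.Prime := ⟨hqp⟩
    have hco : m.Coprime (q ^ 2) := by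
      rw [hmS]
      refine Nat.Coprime.prod_left fun p hp => Nat.Coprime.pow _ _ ?_
      rw [Nat.coprime_primes (hS p (Finset.mem_insert_of_mem hp)) hqp]
      rintro rfl
      exact hq hp
    set H := Finset.univ.filter fun f : Fin 4 → ZMod (q ^ 2) => ¬LBA (redp q) f with hH
    refine ⟨m * q ^ 2, Nat.mul_pos hm (pow_pos hqp.pos 2), ?_,
      (G ×ˢ H).map (crtForms hco).symm.toEmbedding, ?_, ?_⟩
    · rw [Finset.prod_insert hq, hmS, mul_comm]
    · intro f
      rw [Finset.mem_map_equiv, Equiv.symm_symm, crtForms_modm, Finset.mem_product,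
        Finset.forall_mem_insert, hG, and_comm]
      simp [hH, badAt_iff_LBA]
    · have h1 : (H.card : ℝ) = q ^ 8 - (2 * q ^ 6 - q ^ 4) := by
        have h2 := Finset.card_filter_add_card_filter_not (s := Finset.univ)
          (fun f : Fin 4 → ZMod (q ^ 2) => LBA (redp q) f)
        have h3 := card_bad q
        rw [Finset.card_univ, Fintype.card_fun, ZMod.card, Fintype.card_fin, ← pow_mul] at h2
        have h4 : ((Finset.univ.filter fun f : Fin 4 → ZMod (q ^ 2) => LBA (redp q) f).card : ℤ) +
          (H.card : ℤ) = q ^ 8 := by exact_mod_cast h2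
        have : (H.card : ℤ) = q ^ 8 - (2 * q ^ 6 - q ^ 4) := by linarith
        exact_mod_cast this
      rw [Finset.card_map, Finset.card_product, Finset.prod_insert hq, ← hc]
      push_cast
      rw [h1]
      have hq0 : (q : ℝ) ≠ 0 := by exact_mod_cast hqp.ne_zero
      have hm0 : (m : ℝ) ≠ 0 := by exact_mod_cast hm.ne'
      field_simp
      ring

theorem tendsto_prod_density :
    Tendsto (fun n : ℕ => ∏ p ∈ n.primesBelow, (1 - ((p : ℝ) ^ 2)⁻¹) ^ 2) atTop
      (nhds ((6 / Real.pi ^ 2) ^ 2)) := by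
  have h := riemannZeta_eulerProduct (s := 2) (by norm_num)
  rw [riemannZeta_two] at h
  have h2 := (Complex.continuous_re.tendsto _).comp h
  have e1 : ((Real.pi : ℂ) ^ 2 / 6).re = Real.pi ^ 2 / 6 := by
    rw [show ((Real.pi : ℂ) ^ 2 / 6) = ((Real.pi ^ 2 / 6 : ℝ) : ℂ) by push_cast; rfl,
      Complex.ofReal_re]
  rw [e1] at h2
  have h3 := (h2.inv₀ (by positivity)).pow 2
  rw [inv_div] at h3
  refine h3.congr fun n => ?_
  simp only [Function.comp_apply]
  have : (∏ p ∈ n.primesBelow, (1 - (p : ℂ) ^ (-2 : ℂ))⁻¹) =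
      ((∏ p ∈ n.primesBelow, (1 - ((p : ℝ) ^ 2)⁻¹)⁻¹ : ℝ) : ℂ) := by
    push_cast
    refine Finset.prod_congr rfl fun p _ => ?_
    rw [Complex.cpow_neg, Complex.cpow_ofNat]
  rw [this, Complex.ofReal_re, Finset.prod_inv_distrib, inv_inv, Finset.prod_pow]

end BCF

namespace BCF

/-! ### Forms which are weakly divisible to the second order -/

/-- The ring of `f` lies with index `p` in the ring of `g`, along the vector `(u, v)`. -/
def Over (p : ℕ) (g : Fin 4 → ℤ) (u v : ℤ) (f : Fin 4 → ℤ) : Prop :=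
  ∃ (m n : ℤ) (h : Fin 4 → ℤ), (m * v - u * n = 1 ∨ m * v - u * n = -1) ∧ GEquiv f h ∧
    h 0 = p ^ 2 * act m u n v g 0 ∧ h 1 = p * act m u n v g 1 ∧ h 2 = act m u n v g 2 ∧
    act m u n v g 3 = p * h 3

theorem gequiv_of_overform {p : ℤ} (hp : p ≠ 0) {g h g' h' : Fin 4 → ℤ}
    (h0 : h 0 = p ^ 2 * g 0) (h1 : h 1 = p * g 1) (h2 : h 2 = g 2) (h3 : g 3 = p * h 3)
    (h0' : h' 0 = p ^ 2 * g' 0) (h1' : h' 1 = p * g' 1) (h2' : h' 2 = g' 2)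
    (h3' : g' 3 = p * h' 3) {a b c d : ℤ} (hd : a * d - p * b * c = 1 ∨ a * d - p * b * c = -1)
    (hg : g' = act a (p * b) c d g) : GEquiv h h' := by
  refine ⟨a, b, p * c, d, by simpa [mul_comm, mul_left_comm, mul_assoc] using hd, ?_⟩
  have e0 := congrFun hg 0
  have e1 := congrFun hg 1
  have e2 := congrFun hg 2
  have e3 := congrFun hg 3
  simp only [act_zero', act_one', act_two', act_three'] at e0 e1 e2 e3
  apply ext4 <;> simp only [act_zero', act_one', act_two', act_three']
  · rw [h0', e0, h0, h1, h2, h3]; ring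
  · rw [h1', e1, h0, h1, h2, h3]; ring
  · rw [h2', e2, h0, h1, h2, h3]; ring
  · apply mul_left_cancel₀ hp
    rw [← h3', e3, h0, h1, h2, h3]; ring

theorem Over.gequiv {p : ℕ} (hp : p ≠ 0) {g f f' : Fin 4 → ℤ} {u v u' v' : ℤ} (h : Over p g u v f)
    (h' : Over p g u' v' f') (hd : (p : ℤ) ∣ u' * v - u * v') : GEquiv f f' := by
  obtain ⟨m, n, φ, hdet, hf, h0, h1, h2, h3⟩ := h
  obtain ⟨m', n', φ', hdet', hf', h0', h1', h2', h3'⟩ := h'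
  refine hf.trans (GEquiv.trans ?_ hf'.symm)
  obtain ⟨b, hb⟩ := hd
  have hp' : (p : ℤ) ≠ 0 := by exact_mod_cast hp
  rcases hdet with hdet | hdet
  · refine gequiv_of_overform hp' h0 h1 h2 h3 h0' h1' h2' h3' (a := v * m' - u * n') (b := b)
      (c := -n * m' + m * n') (d := -n * u' + m * v') ?_ ?_
    · have : (v * m' - u * n') * (-n * u' + m * v') - p * b * (-n * m' + m * n') =
        (m * v - u * n) * (m' * v' - u' * n') := by rw [← hb]; ring
      rw [this, hdet, one_mul]; exact hdet'
    · rw [← hb, act_act]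
      congr 1
      · linear_combination -m' * hdet
      · linear_combination -u' * hdet
      · linear_combination -n' * hdet
      · linear_combination -v' * hdet
  · refine gequiv_of_overform hp' h0 h1 h2 h3 h0' h1' h2' h3' (a := -(v * m' - u * n')) (b := -b)
      (c := -(-n * m' + m * n')) (d := -(-n * u' + m * v')) ?_ ?_
    · have : -(v * m' - u * n') * -(-n * u' + m * v') - p * -b * -(-n * m' + m * n') =
        (m * v - u * n) * (m' * v' - u' * n') := by linear_combination (-n * m' + m * n') * hb
      rw [this, hdet]; omega
    · rw [mul_neg, ← hb, act_act]
      congr 1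
      · linear_combination m' * hdet
      · linear_combination u' * hdet
      · linear_combination n' * hdet
      · linear_combination v' * hdet

/-- `f` is divisible to the second order at `p`, but is not a cube modulo `p`. -/
def WeakAt (p : ℕ) (f : Fin 4 → ℤ) : Prop :=
  ∃ h, GEquiv f h ∧ (p : ℤ) ^ 2 ∣ h 0 ∧ (p : ℤ) ∣ h 1 ∧ ¬(p : ℤ) ∣ h 2

theorem WeakAt.exists_over {s : Bool} {p : ℕ} (hp : p.Prime) {f : Fin 4 → ℤ} (hf : Irr f)
    (hD : 0 < ce s * (disc f : ℤ)) (hw : WeakAt p f) :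
    ∃ g t u v, Phi s t = toR g ∧ Reduced t ∧ g 0 ≠ 0 ∧ disc f = p ^ 2 * disc g ∧
      (∃ i, ¬(p : ℤ) ∣ g i) ∧ (p : ℤ) ∣ eval g u v ∧ IsCoprime u v ∧ Over p g u v f := by
  obtain ⟨h, hfh, ⟨a, ha⟩, ⟨b, hb⟩, hc⟩ := hw
  have hp0 : (p : ℤ) ≠ 0 := by exact_mod_cast hp.ne_zero
  set g₀ : Fin 4 → ℤ := ![a, b, h 2, p * h 3] with hg₀
  have hdisc : disc h = p ^ 2 * disc g₀ := by
    simp [disc, hg₀, ha, hb]; ring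
  have hirr : Irr g₀ := by
    intro u v huv
    have := hf.gequiv hfh u (p * v) (by
      have : eval h u (p * v) = p ^ 2 * eval g₀ u v := by simp [eval, hg₀, ha, hb]; ring
      rw [this, huv, mul_zero])
    exact ⟨this.1, (mul_eq_zero.1 this.2).resolve_left hp0⟩
  have hD0 : 0 < ce s * (disc g₀ : ℤ) := by
    rw [← hfh.disc_eq, hdisc] at hD
    push_cast at hD
    have hpp : (0 : ℝ) < (p : ℝ) ^ 2 := by have := hp.pos; positivity
    rw [mul_left_comm] at hD
    exact pos_of_mul_pos_right hD hpp.le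
  obtain ⟨g, hg, t, ht, hred⟩ := exists_reduced s g₀ hirr.coeff_zero_ne hD0
  have hgi := hirr.gequiv hg
  obtain ⟨m, u, n, v, hdet, hact⟩ := hg.symm
  refine ⟨g, t, u, v, ht, hred, hgi.coeff_zero_ne, ?_, ?_, ?_, ?_, ?_⟩
  · rw [← hfh.disc_eq, hdisc, hg.disc_eq]
  · by_contra! hall
    apply hc
    have : h 2 = act m u n v g 2 := by rw [← hact]; simp [hg₀]
    rw [this, act_two']
    refine dvd_add (dvd_add (dvd_add ?_ ?_) ?_) ?_
    · exact (((hall 0).mul_left 3).mul_right _).mul_right _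
    · exact (hall 1).mul_right _
    · exact (hall 2).mul_right _
    · exact (((hall 3).mul_left 3).mul_right _).mul_right _
  · have : eval g u v = p * h 3 := by
      have h3 := congrFun hact 3
      simp [hg₀] at h3
      rw [h3, eval]
    rw [this]; exact dvd_mul_right _ _
  · rcases hdet with hdet | hdet
    · exact ⟨-n, m, by linarith⟩
    · exact ⟨n, -m, by linarith⟩
  · refine ⟨m, n, h, hdet, hfh, ?_⟩
    rw [← hact]
    exact ⟨by simp [hg₀, ha], by simp [hg₀, hb], by simp [hg₀], by simp [hg₀]⟩

/-- The point of `ℙ¹(𝔽_p)` given by an integral vector. -/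
noncomputable def label (p : ℕ) (u v : ℤ) : Option (ZMod p) :=
  open Classical in if (u : ZMod p) = 0 then none else some ((v : ZMod p) * (u : ZMod p)⁻¹)

theorem dvd_of_label_eq {p : ℕ} [Fact p.Prime] {u v u' v' : ℤ} (h : label p u v = label p u' v') :
    (p : ℤ) ∣ u' * v - u * v' := by
  rw [← ZMod.intCast_zmod_eq_zero_iff_dvd]
  push_cast
  unfold label at h
  split_ifs at h with h1 h2 h2
  · rw [h1, h2]; ring
  · rw [Option.some.injEq] at h
    field_simp at h
    linear_combination h

open Polynomial in
theorem exists_labels {p : ℕ} [Fact p.Prime] {g : Fin 4 → ℤ} (hg : ∃ i, ¬(p : ℤ) ∣ g i) :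
    ∃ S : Finset (Option (ZMod p)), S.card ≤ 4 ∧ ∀ u v : ℤ, (p : ℤ) ∣ eval g u v →
      label p u v ∈ S := by
  classical
  set P : (ZMod p)[X] := C (g 3 : ZMod p) * X ^ 3 + C (g 2 : ZMod p) * X ^ 2 +
    C (g 1 : ZMod p) * X + C (g 0 : ZMod p) with hP
  have hP0 : P ≠ 0 := by
    intro h0
    obtain ⟨i, hi⟩ := hg
    apply hi
    rw [← ZMod.intCast_zmod_eq_zero_iff_dvd]
    have hc := (Cubic.toPoly_eq_zero_iff
      (P := ⟨(g 3 : ZMod p), (g 2 : ZMod p), (g 1 : ZMod p), (g 0 : ZMod p)⟩)).1 h0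
    obtain ⟨c3, c2, c1, c0⟩ := (Cubic.mk.injEq ..).mp hc
    fin_cases i <;> assumption
  refine ⟨insert none (P.roots.toFinset.image some), ?_, ?_⟩
  · refine (Finset.card_insert_le _ _).trans (Nat.succ_le_succ ?_)
    refine Finset.card_image_le.trans ((Multiset.toFinset_card_le _).trans
      ((card_roots' P).trans ?_))
    exact natDegree_cubic_le
  · intro u v huv
    unfold label
    split_ifs with h
    · exact Finset.mem_insert_self _ _
    · refine Finset.mem_insert_of_mem (Finset.mem_image_of_mem _ ?_)
      rw [Multiset.mem_toFinset, mem_roots hP0, IsRoot.def]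
      rw [← ZMod.intCast_zmod_eq_zero_iff_dvd] at huv
      simp only [eval] at huv
      push_cast at huv
      simp only [hP, eval_add, eval_mul, eval_C, eval_pow, eval_X]
      field_simp
      linear_combination huv

theorem weak_bound (s : Bool) {X : ℝ} (hX : 0 < X) {p : ℕ} (hp : p.Prime)
    (F : Finset (Fin 4 → ℤ)) (hF : ∀ f ∈ F, Irr f ∧ 0 < ce s * (disc f : ℤ) ∧
      |((disc f : ℤ) : ℝ)| < X ∧ (∃ t, Phi s t = toR f ∧ IntReduced t) ∧ WeakAt p f) :
    (F.card : ℝ) ≤ 32 * 10 ^ 8 * X * ((p : ℝ) ^ 2)⁻¹ := by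
  classical
  have := Fact.mk hp
  have hp0 : (0 : ℝ) < p := by exact_mod_cast hp.pos
  choose! g t u v h1 h2 h3 h4 h5 h6 h7 h8 using fun f (hf : f ∈ F) =>
    (hF f hf).2.2.2.2.exists_over hp (hF f hf).1 (hF f hf).2.1
  have hfib : F.card ≤ 8 * (F.image g).card := by
    refine Finset.card_le_mul_card_image _ _ fun g₀ hg₀ => ?_
    obtain ⟨f₀, hf₀, rfl⟩ := Finset.mem_image.1 hg₀
    obtain ⟨S, hS, hlab⟩ := exists_labels (h5 f₀ hf₀)
    set F' := F.filter fun f => g f = g f₀ with hF'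
    have hle : F'.card ≤ 2 * (F'.image fun f => label p (u f) (v f)).card := by
      refine Finset.card_le_mul_card_image _ _ fun l hl => ?_
      obtain ⟨f₁, hf₁, rfl⟩ := Finset.mem_image.1 hl
      rw [hF', Finset.mem_filter] at hf₁
      refine (Finset.card_le_card (t := {f₁, -f₁}) fun f hf => ?_).trans Finset.card_le_two
      simp only [hF', Finset.mem_filter] at hf
      obtain ⟨⟨hf, hgf⟩, hl⟩ := hf
      obtain ⟨t₁, ht₁, hr₁⟩ := (hF f₁ hf₁.1).2.2.2.1
      obtain ⟨t₂, ht₂, hr₂⟩ := (hF f hf).2.2.2.1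
      have ho := h8 f₁ hf₁.1
      rw [hf₁.2, ← hgf] at ho
      have hge := ho.gequiv hp.ne_zero (h8 f hf) (dvd_of_label_eq hl.symm)
      have hne : disc f₁ ≠ 0 := fun h0 => by
        have := (hF f₁ hf₁.1).2.1
        simp [h0] at this
      simpa using eq_or_neg_of_intReduced ht₁ ht₂ hne hr₁ hr₂ hge
    have hsub : (F'.image fun f => label p (u f) (v f)) ⊆ S := by
      intro l hl
      obtain ⟨f, hf, rfl⟩ := Finset.mem_image.1 hl
      rw [hF', Finset.mem_filter] at hf
      exact hlab _ _ (hf.2 ▸ h6 f hf.1)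
    have := Finset.card_le_card hsub
    omega
  have hcusp := cusp_bound s (X := X * ((p : ℝ) ^ 2)⁻¹) (T := 1 / 2) (by positivity) le_rfl
    (F.image g) (by
      intro g₀ hg₀
      obtain ⟨f, hf, rfl⟩ := Finset.mem_image.1 hg₀
      refine ⟨t f, ⟨h1 f hf, h2 f hf, h3 f hf, ?_⟩, ?_⟩
      · have := (hF f hf).2.2.1
        rw [h4 f hf] at this
        push_cast at this
        rw [abs_mul, abs_of_pos (by positivity : (0 : ℝ) < (p : ℝ) ^ 2)] at this
        rw [lt_mul_inv_iff₀ (by positivity)]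
        linarith
      · obtain ⟨a1, a2, a3, a4⟩ := h2 f hf
        nlinarith)
  have : (F.card : ℝ) ≤ 8 * ((F.image g).card : ℝ) := by exact_mod_cast hfib
  calc (F.card : ℝ) ≤ 8 * (2 * 10 ^ 8 * (X * ((p : ℝ) ^ 2)⁻¹) / (1 / 2)) := by linarith
    _ = _ := by ring

end BCF

namespace BCF

/-! ### Forms which are cubes of linear forms modulo a large prime -/

theorem card_le_prod_of_fibers : ∀ {n : ℕ} (F : Finset (Fin n → ℤ)) (N : Fin n → ℝ),
    (∀ i, 0 ≤ N i) → (∀ i, ∀ f ∈ F, ∀ S : Finset ℤ,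
      (∀ x ∈ S, ∃ g ∈ F, (∀ j < i, g j = f j) ∧ g i = x) → (S.card : ℝ) ≤ N i) →
    (F.card : ℝ) ≤ ∏ i, N i
  | 0, F, N, _, _ => by
    have : F.card ≤ 1 := Finset.card_le_one_of_subsingleton F
    simpa using this
  | n + 1, F, N, hN, hF => by
    classical
    have hfib : (F.card : ℝ) ≤ N (Fin.last n) * ((F.image Fin.init).card : ℝ) := by
      rw [Finset.card_eq_sum_card_image Fin.init F, Nat.cast_sum, mul_comm, ← nsmul_eq_mul]
      refine Finset.sum_le_card_nsmul _ _ _ fun g hg => ?_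
      obtain ⟨f, hf, rfl⟩ := Finset.mem_image.1 hg
      set S := F.filter fun x => Fin.init x = Fin.init f with hS
      have hinj : Set.InjOn (fun x : Fin (n + 1) → ℤ => x (Fin.last n)) S := by
        intro x hx y hy hxy
        simp only [hS, Finset.coe_filter, Set.mem_ofPred_eq] at hx hy
        rw [← Fin.snoc_init_self x, ← Fin.snoc_init_self y, hx.2, hy.2]
        congr 1
      rw [← Finset.card_image_of_injOn hinj]
      refine hF _ f hf _ fun x hx => ?_
      obtain ⟨y, hy, rfl⟩ := Finset.mem_image.1 hx
      simp only [hS, Finset.mem_filter] at hy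
      refine ⟨y, hy.1, fun j hj => ?_, rfl⟩
      obtain ⟨k, rfl⟩ := Fin.exists_castSucc_eq.2 hj.ne
      exact congrFun hy.2 k
    have ih : ((F.image Fin.init).card : ℝ) ≤ ∏ i : Fin n, N i.castSucc := by
      refine card_le_prod_of_fibers _ (fun i => N i.castSucc) (fun i => hN _) ?_
      intro i f hf S hS
      obtain ⟨f', hf', rfl⟩ := Finset.mem_image.1 hf
      refine hF i.castSucc f' hf' S fun x hx => ?_
      obtain ⟨g, hg, hgj, rfl⟩ := hS x hx
      obtain ⟨g', hg', rfl⟩ := Finset.mem_image.1 hg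
      refine ⟨g', hg', fun j hj => ?_, rfl⟩
      obtain ⟨k, rfl⟩ := Fin.exists_castSucc_eq.2 (hj.trans (Fin.castSucc_lt_last i)).ne
      exact hgj k (Fin.castSucc_lt_castSucc_iff.1 hj)
    rw [Fin.prod_univ_castSucc, mul_comm]
    exact hfib.trans (mul_le_mul_of_nonneg_left ih (hN _))

theorem card_le_of_modEq {L : ℝ} (hL0 : 0 ≤ L) {m : ℕ} (hm : 0 < m) (S : Finset ℤ)
    (hL : ∀ x ∈ S, |(x : ℝ)| ≤ L) (hS : ∀ x ∈ S, ∀ y ∈ S, (m : ℤ) ∣ x - y) :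
    (S.card : ℝ) ≤ 2 * L / m + 1 := by
  have hm' : (0 : ℝ) < m := by exact_mod_cast hm
  rcases S.eq_empty_or_nonempty with rfl | hne
  · simp only [Finset.card_empty, Nat.cast_zero]
    positivity
  set x₀ := S.min' hne
  have hx₀ : x₀ ∈ S := S.min'_mem hne
  have hcard : S.card ≤ (Finset.range (⌊2 * L / m⌋₊ + 1)).card := by
    refine Finset.card_le_card_of_injOn (fun x => ((x - x₀) / m).toNat) ?_ ?_
    · intro x hx
      have hx : x ∈ S := hx
      simp only [Finset.coe_range, Set.mem_Iio, Order.lt_add_one_iff]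
      apply Nat.le_floor
      obtain ⟨k, hk⟩ := hS x hx x₀ hx₀
      have h0 : x₀ ≤ x := S.min'_le x hx
      have hk0 : 0 ≤ k := by
        by_contra! hneg
        have : (m : ℤ) * k < 0 := mul_neg_of_pos_of_neg (by exact_mod_cast hm) hneg
        omega
      rw [hk, Int.mul_ediv_cancel_left _ (by exact_mod_cast hm.ne')]
      have h1 : ((k.toNat : ℤ) : ℝ) = k := by rw [Int.toNat_of_nonneg hk0]
      rw [Int.cast_natCast] at h1
      rw [h1, le_div_iff₀ hm']
      have h2 : (x : ℝ) - x₀ = m * k := by exact_mod_cast hk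
      have h3 := abs_le.1 (hL x hx)
      have h4 := abs_le.1 (hL x₀ hx₀)
      linarith
    · intro x hx y hy hxy
      have hx : x ∈ S := hx
      have hy : y ∈ S := hy
      simp only at hxy
      obtain ⟨k, hk⟩ := hS x hx x₀ hx₀
      obtain ⟨l, hl⟩ := hS y hy x₀ hx₀
      have hxm : x₀ ≤ x := S.min'_le x hx
      have hym : x₀ ≤ y := S.min'_le y hy
      have hmz : (0 : ℤ) ≤ m := by positivity
      have h1 := Int.ediv_nonneg (sub_nonneg.2 hxm) hmz
      have h2 := Int.ediv_nonneg (sub_nonneg.2 hym) hmz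
      have h3 : (x - x₀) / m = (y - x₀) / m := by omega
      rw [hk, hl, Int.mul_ediv_cancel_left _ (by exact_mod_cast hm.ne'),
        Int.mul_ediv_cancel_left _ (by exact_mod_cast hm.ne')] at h3
      rw [← h3, ← hk] at hl
      linarith
  rw [Finset.card_range] at hcard
  calc (S.card : ℝ) ≤ (⌊2 * L / m⌋₊ : ℝ) + 1 := by exact_mod_cast hcard
    _ ≤ _ := by gcongr; exact Nat.floor_le (by positivity)

/-- The coefficients of the Hessian of `f` are divisible by `p`. -/
def StrongAt (p : ℕ) (f : Fin 4 → ℤ) : Prop :=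
  (p : ℤ) ∣ f 1 ^ 2 - 3 * f 0 * f 2 ∧ (p : ℤ) ∣ f 1 * f 2 - 9 * f 0 * f 3 ∧
    (p : ℤ) ∣ f 2 ^ 2 - 3 * f 1 * f 3

theorem StrongAt.act {p : ℕ} {f : Fin 4 → ℤ} (h : StrongAt p f) (a b c d : ℤ) :
    StrongAt p (act a b c d f) := by
  obtain ⟨⟨P, hP⟩, ⟨Q, hQ⟩, ⟨R, hR⟩⟩ := h
  refine ⟨⟨(a * d - b * c) ^ 2 * (P * a ^ 2 + Q * a * c + R * c ^ 2), ?_⟩,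
    ⟨(a * d - b * c) ^ 2 * (2 * P * a * b + Q * (a * d + b * c) + 2 * R * c * d), ?_⟩,
    ⟨(a * d - b * c) ^ 2 * (P * b ^ 2 + Q * b * d + R * d ^ 2), ?_⟩⟩ <;>
    simp only [act_zero', act_one', act_two', act_three']
  · linear_combination (a * d - b * c) ^ 2 * (a ^ 2 * hP + a * c * hQ + c ^ 2 * hR)
  · linear_combination (a * d - b * c) ^ 2 * (2 * a * b * hP + (a * d + b * c) * hQ + 2 * c * d * hR)
  · linear_combination (a * d - b * c) ^ 2 * (b ^ 2 * hP + b * d * hQ + d ^ 2 * hR)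

theorem BadAt.weakAt_or_strongAt {p : ℕ} {f : Fin 4 → ℤ} (h : BadAt p f) :
    WeakAt p f ∨ StrongAt p f := by
  have key : ∀ g, BadCoeff p g → GEquiv f g → WeakAt p f ∨ StrongAt p g := by
    rintro g ⟨h0, h1, h2⟩ hfg
    by_cases h3 : (p : ℤ) ∣ g 2
    · right
      refine ⟨dvd_sub (dvd_pow h1 two_ne_zero) ?_, dvd_sub (h1.mul_right _) ?_,
        dvd_sub (dvd_pow h3 two_ne_zero) ?_⟩
      · exact (h0.mul_left _).mul_right _
      · exact (h0.mul_left _).mul_right _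
      · exact (h1.mul_left _).mul_right _
    · exact Or.inl ⟨g, hfg, h2.resolve_right h3, h1, h3⟩
  rcases h with h | ⟨k, h⟩
  · exact key f h (GEquiv.refl f)
  · refine (key _ h ⟨k, -1, 1, 0, by simp, rfl⟩).imp_right fun hs => ?_
    have := hs.act 0 1 (-1) k
    rw [act_act] at this
    convert this using 1
    rw [← act_id f, act_act]
    congr 1 <;> ring

theorem coord_card_le {L : ℝ} (hL0 : 0 ≤ L) {F : Finset (Fin 4 → ℤ)} (hF : F ⊆ box fun _ => L) {i : Fin 4}
    {m : ℕ} (hm : 0 < m) {f : Fin 4 → ℤ} {S : Finset ℤ}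
    (hS : ∀ x ∈ S, ∃ g ∈ F, (∀ j < i, g j = f j) ∧ g i = x)
    (h : ∀ g ∈ F, ∀ g' ∈ F, (∀ j < i, g j = f j) → (∀ j < i, g' j = f j) → (m : ℤ) ∣ g i - g' i) :
    (S.card : ℝ) ≤ 2 * L / m + 1 := by
  refine card_le_of_modEq hL0 hm S (fun x hx => ?_) fun x hx y hy => ?_
  · obtain ⟨g, hg, -, rfl⟩ := hS x hx
    exact mem_box.1 (hF hg) i
  · obtain ⟨g, hg, hgj, rfl⟩ := hS x hx
    obtain ⟨g', hg', hgj', rfl⟩ := hS y hy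
    exact h g hg g' hg' hgj hgj'

theorem strong_bound_small {L : ℝ} {p : ℕ} (hp : p.Prime) (h3 : 3 < p) (hL : (p : ℝ) ≤ L)
    (F : Finset (Fin 4 → ℤ)) (hF : F ⊆ box fun _ => L) (hs : ∀ f ∈ F, StrongAt p f) :
    (F.card : ℝ) ≤ 162 * L ^ 4 * ((p : ℝ) ^ 2)⁻¹ := by
  classical
  have hp0 : (0 : ℝ) < p := by exact_mod_cast hp.pos
  have hp1 : (1 : ℝ) ≤ p := by exact_mod_cast hp.one_le
  have hL1 : 1 ≤ L := hp1.trans hL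
  have hL0 : 0 ≤ L := zero_le_one.trans hL1
  have hP : Prime (p : ℤ) := Nat.prime_iff_prime_int.1 hp
  have hp3 : ¬(p : ℤ) ∣ 3 := by
    intro h
    have := Nat.le_of_dvd (by norm_num) (Int.natCast_dvd_natCast.1 (by exact_mod_cast h : (p : ℤ) ∣ (3 : ℕ)))
    omega
  have hN1 : 2 * L / (1 : ℕ) + 1 ≤ 3 * L := by push_cast; linarith
  have hNp : 2 * L / p + 1 ≤ 3 * L / p := by
    rw [← sub_nonneg]
    have : 3 * L / p - (2 * L / p + 1) = (L - p) / p := by field_simp; ring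
    rw [this]
    exact div_nonneg (by linarith) hp0.le
  have h1 : ((F.filter fun f => ¬(p : ℤ) ∣ f 0).card : ℝ) ≤ 81 * L ^ 4 * ((p : ℝ) ^ 2)⁻¹ := by
    have hsub := (Finset.filter_subset (fun f : Fin 4 → ℤ => ¬(p : ℤ) ∣ f 0) F).trans hF
    refine (card_le_prod_of_fibers _ ![3 * L, 3 * L, 3 * L / p, 3 * L / p] ?_ ?_).trans ?_
    · intro i; fin_cases i <;> simp <;> positivity
    · intro i f hf S hS
      fin_cases i
      · exact (coord_card_le hL0 hsub one_pos hS (by simp)).trans hN1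
      · exact (coord_card_le hL0 hsub one_pos hS (by simp)).trans hN1
      · refine (coord_card_le hL0 hsub hp.pos hS fun g hg g' hg' hj hj' => ?_).trans hNp
        have e0 : g 0 = f 0 := hj 0 (by decide)
        have e1 : g 1 = f 1 := hj 1 (by decide)
        have e0' : g' 0 = f 0 := hj' 0 (by decide)
        have e1' : g' 1 = f 1 := hj' 1 (by decide)
        rw [Finset.mem_filter] at hg hg' hf
        have d1 := (hs g hg.1).1
        have d2 := (hs g' hg'.1).1
        rw [e0, e1] at d1
        rw [e0', e1'] at d2
        have d3 : (p : ℤ) ∣ 3 * (f 0 * (g 2 - g' 2)) := by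
          exact (dvd_sub d2 d1).trans (dvd_of_eq (by ring))
        exact (hP.dvd_or_dvd ((hP.dvd_or_dvd d3).resolve_left hp3)).resolve_left hf.2
      · refine (coord_card_le hL0 hsub hp.pos hS fun g hg g' hg' hj hj' => ?_).trans hNp
        have e0 : g 0 = f 0 := hj 0 (by decide)
        have e1 : g 1 = f 1 := hj 1 (by decide)
        have e2 : g 2 = f 2 := hj 2 (by decide)
        have e0' : g' 0 = f 0 := hj' 0 (by decide)
        have e1' : g' 1 = f 1 := hj' 1 (by decide)
        have e2' : g' 2 = f 2 := hj' 2 (by decide)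
        rw [Finset.mem_filter] at hg hg' hf
        have d1 := (hs g hg.1).2.1
        have d2 := (hs g' hg'.1).2.1
        rw [e0, e1, e2] at d1
        rw [e0', e1', e2'] at d2
        have d3 : (p : ℤ) ∣ 3 * (3 * (f 0 * (g 3 - g' 3))) := by
          exact (dvd_sub d2 d1).trans (dvd_of_eq (by ring))
        exact (hP.dvd_or_dvd ((hP.dvd_or_dvd ((hP.dvd_or_dvd d3).resolve_left hp3)).resolve_left
          hp3)).resolve_left hf.2
    · simp [Fin.prod_univ_four]
      apply le_of_eq
      field_simp
      ring
  have h2 : ((F.filter fun f => (p : ℤ) ∣ f 0).card : ℝ) ≤ 81 * L ^ 4 * ((p : ℝ) ^ 2)⁻¹ := by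
    have hsub := (Finset.filter_subset (fun f : Fin 4 → ℤ => (p : ℤ) ∣ f 0) F).trans hF
    have hd : ∀ f ∈ F.filter (fun f => (p : ℤ) ∣ f 0),
        (p : ℤ) ∣ f 0 ∧ (p : ℤ) ∣ f 1 ∧ (p : ℤ) ∣ f 2 := by
      intro f hf
      rw [Finset.mem_filter] at hf
      have d1 : (p : ℤ) ∣ f 1 := hP.dvd_of_dvd_pow
        ((dvd_sub_left ((hf.2.mul_left 3).mul_right _)).1 (hs f hf.1).1)
      exact ⟨hf.2, d1, hP.dvd_of_dvd_pow
        ((dvd_sub_left ((d1.mul_left 3).mul_right _)).1 (hs f hf.1).2.2)⟩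
    refine (card_le_prod_of_fibers _ ![3 * L / p, 3 * L / p, 3 * L / p, 3 * L] ?_ ?_).trans ?_
    · intro i; fin_cases i <;> simp <;> positivity
    · intro i f hf S hS
      fin_cases i
      · exact (coord_card_le hL0 hsub hp.pos hS fun g hg g' hg' _ _ =>
          dvd_sub (hd g hg).1 (hd g' hg').1).trans hNp
      · exact (coord_card_le hL0 hsub hp.pos hS fun g hg g' hg' _ _ =>
          dvd_sub (hd g hg).2.1 (hd g' hg').2.1).trans hNp
      · exact (coord_card_le hL0 hsub hp.pos hS fun g hg g' hg' _ _ =>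
          dvd_sub (hd g hg).2.2 (hd g' hg').2.2).trans hNp
      · exact (coord_card_le hL0 hsub one_pos hS (by simp)).trans hN1
    · simp [Fin.prod_univ_four]
      calc 3 * L / p * (3 * L / p) * (3 * L / p) * (3 * L)
          = 81 * L ^ 4 * ((p : ℝ) ^ 2)⁻¹ * (p : ℝ)⁻¹ := by field_simp; ring
        _ ≤ 81 * L ^ 4 * ((p : ℝ) ^ 2)⁻¹ * 1 := by
          gcongr; exact inv_le_one_of_one_le₀ hp1
        _ = _ := mul_one _
  have h3 : (F.card : ℝ) = ((F.filter fun f => (p : ℤ) ∣ f 0).card : ℝ) +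
      ((F.filter fun f => ¬(p : ℤ) ∣ f 0).card : ℝ) := by
    exact_mod_cast (Finset.card_filter_add_card_filter_not _).symm
  rw [h3]
  linarith

theorem card_large_primeFactors_le {L : ℝ} (hL : 5 ≤ L) {n : ℕ} (hn : n ≠ 0)
    (h : (n : ℝ) ≤ 4 * L ^ 2) : (n.primeFactors.filter fun p : ℕ => L < p).card ≤ 2 := by
  by_contra! hcard
  set S := n.primeFactors.filter fun p : ℕ => L < p
  have h1 : L ^ S.card ≤ ∏ p ∈ S, (p : ℝ) :=
    (Finset.prod_const L).symm.trans_le (Finset.prod_le_prod (fun _ _ => by linarith)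
      fun p hp => (Finset.mem_filter.1 hp).2.le)
  have h2 : (∏ p ∈ S, p) ≤ n := Nat.le_of_dvd (Nat.pos_of_ne_zero hn)
    ((Finset.prod_dvd_prod_of_subset _ _ _ (Finset.filter_subset _ _)).trans
      (Nat.prod_primeFactors_dvd n))
  have h3 : (∏ p ∈ S, (p : ℝ)) ≤ n := by
    rw [← Nat.cast_prod]
    exact Nat.cast_le.2 h2
  have h4 : L ^ 3 ≤ L ^ S.card := pow_le_pow_right₀ (by linarith) hcard
  have : L ^ 3 ≤ 4 * L ^ 2 := by linarith
  nlinarith [sq_nonneg L]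

theorem strong_bound_large {L : ℝ} (hL : 5 ≤ L) (F : Finset (Fin 4 → ℤ))
    (hF : F ⊆ box fun _ => L) (h0 : ∀ f ∈ F, f 0 ≠ 0)
    (hs : ∀ f ∈ F, ∃ p : ℕ, p.Prime ∧ L < p ∧ StrongAt p f) :
    (F.card : ℝ) ≤ 189 * L ^ 3 := by
  classical
  have hL0 : 0 ≤ L := by linarith
  have hN1 : 2 * L / (1 : ℕ) + 1 ≤ 3 * L := by push_cast; linarith
  have h1 : ((F.filter fun f => f 1 ^ 2 - 3 * f 0 * f 2 = 0).card : ℝ) ≤ 27 * L ^ 3 := by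
    have hsub := (Finset.filter_subset (fun f : Fin 4 → ℤ => f 1 ^ 2 - 3 * f 0 * f 2 = 0) F).trans hF
    refine (card_le_prod_of_fibers _ ![3 * L, 3 * L, 1, 3 * L] ?_ ?_).trans ?_
    · intro i; fin_cases i <;> simp <;> positivity
    · intro i f hf S hS
      fin_cases i
      · exact (coord_card_le hL0 hsub one_pos hS (by simp)).trans hN1
      · exact (coord_card_le hL0 hsub one_pos hS (by simp)).trans hN1
      · have : S.card ≤ 1 := by
          refine Finset.card_le_one.2 fun x hx y hy => ?_
          obtain ⟨g, hg, hj, rfl⟩ := hS x hx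
          obtain ⟨g', hg', hj', rfl⟩ := hS y hy
          have e0 : g 0 = f 0 := hj 0 (by decide)
          have e1 : g 1 = f 1 := hj 1 (by decide)
          have e0' : g' 0 = f 0 := hj' 0 (by decide)
          have e1' : g' 1 = f 1 := hj' 1 (by decide)
          rw [Finset.mem_filter] at hg hg' hf
          have d1 := hg.2
          have d2 := hg'.2
          rw [e0, e1] at d1
          rw [e0', e1'] at d2
          have : 3 * f 0 * (g 2 - g' 2) = 0 := by linarith
          have := (mul_eq_zero.1 this).resolve_left (by simpa using h0 f hf.1)
          exact sub_eq_zero.1 this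
        simpa using this
      · exact (coord_card_le hL0 hsub one_pos hS (by simp)).trans hN1
    · simp [Fin.prod_univ_four]
      apply le_of_eq
      ring
  have h2 : ((F.filter fun f => ¬f 1 ^ 2 - 3 * f 0 * f 2 = 0).card : ℝ) ≤ 162 * L ^ 3 := by
    have hsub := (Finset.filter_subset (fun f : Fin 4 → ℤ => ¬f 1 ^ 2 - 3 * f 0 * f 2 = 0) F).trans hF
    refine (card_le_prod_of_fibers _ ![3 * L, 3 * L, 3 * L, 6] ?_ ?_).trans ?_
    · intro i; fin_cases i <;> simp <;> positivity
    · intro i f hf S hS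
      fin_cases i
      · exact (coord_card_le hL0 hsub one_pos hS (by simp)).trans hN1
      · exact (coord_card_le hL0 hsub one_pos hS (by simp)).trans hN1
      · exact (coord_card_le hL0 hsub one_pos hS (by simp)).trans hN1
      · change (S.card : ℝ) ≤ 6
        rw [Finset.mem_filter] at hf
        set n := (f 1 ^ 2 - 3 * f 0 * f 2).natAbs with hn
        have hn0 : n ≠ 0 := by simpa [hn] using hf.2
        have hb := mem_box.1 (hF hf.1)
        have hnL : (n : ℝ) ≤ 4 * L ^ 2 := by
          rw [hn, Nat.cast_natAbs]
          push_cast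
          calc |(f 1 : ℝ) ^ 2 - 3 * f 0 * f 2| ≤ |(f 1 : ℝ) ^ 2| + |3 * (f 0 : ℝ) * f 2| := abs_sub _ _
            _ = |(f 1 : ℝ)| * |(f 1 : ℝ)| + 3 * (|(f 0 : ℝ)| * |(f 2 : ℝ)|) := by
              rw [abs_mul, abs_mul, sq, abs_mul]; norm_num; ring
            _ ≤ L * L + 3 * (L * L) := by gcongr <;> exact hb _
            _ = _ := by ring
        set PS := n.primeFactors.filter fun p : ℕ => L < p with hPS
        have hPc : PS.card ≤ 2 := card_large_primeFactors_le hL hn0 hnL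
        have hSle : S ⊆ PS.biUnion fun p => S.filter fun x =>
            (p : ℤ) ∣ f 1 * f 2 - 9 * f 0 * x := by
          intro x hx
          obtain ⟨g, hg, hj, rfl⟩ := hS x hx
          have e0 : g 0 = f 0 := hj 0 (by decide)
          have e1 : g 1 = f 1 := hj 1 (by decide)
          have e2 : g 2 = f 2 := hj 2 (by decide)
          rw [Finset.mem_filter] at hg
          obtain ⟨p, hp, hLp, hp1, hp2, -⟩ := hs g hg.1
          rw [e0, e1, e2] at hp1 hp2
          refine Finset.mem_biUnion.2 ⟨p, ?_, Finset.mem_filter.2 ⟨hx, hp2⟩⟩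
          rw [hPS, Finset.mem_filter, Nat.mem_primeFactors]
          exact ⟨⟨hp, Int.natCast_dvd.1 hp1, hn0⟩, hLp⟩
        have hfib : ∀ p ∈ PS, (S.filter fun x => (p : ℤ) ∣ f 1 * f 2 - 9 * f 0 * x).card ≤ 3 := by
          intro p hp
          rw [hPS, Finset.mem_filter, Nat.mem_primeFactors] at hp
          obtain ⟨⟨hp, -, -⟩, hLp⟩ := hp
          have hP : Prime (p : ℤ) := Nat.prime_iff_prime_int.1 hp
          have hp5 : 5 < p := by exact_mod_cast hL.trans_lt hLp
          have hp3 : ¬(p : ℤ) ∣ 3 := by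
            intro h
            have := Int.le_of_dvd (by norm_num) h
            omega
          have hpf : ¬(p : ℤ) ∣ f 0 := by
            intro h
            have h5 := Int.le_of_dvd (abs_pos.2 (h0 f hf.1)) ((dvd_abs _ _).2 h)
            have h6 : (p : ℝ) ≤ |(f 0 : ℝ)| := by exact_mod_cast h5
            linarith [hb 0]
          have hp0 : (0 : ℝ) < p := by exact_mod_cast hp.pos
          have := card_le_of_modEq (L := L) hL0 hp.pos
            (S.filter fun x => (p : ℤ) ∣ f 1 * f 2 - 9 * f 0 * x) (fun x hx => by
              obtain ⟨g, hg, -, rfl⟩ := hS x (Finset.mem_filter.1 hx).1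
              exact mem_box.1 (hsub hg) _) fun x hx y hy => by
              have d3 : (p : ℤ) ∣ 3 * (3 * (f 0 * (x - y))) := by
                exact (dvd_sub (Finset.mem_filter.1 hy).2 (Finset.mem_filter.1 hx).2).trans
                  (dvd_of_eq (by ring))
              exact (hP.dvd_or_dvd ((hP.dvd_or_dvd ((hP.dvd_or_dvd d3).resolve_left
                hp3)).resolve_left hp3)).resolve_left hpf
          have h7 : 2 * L / p + 1 ≤ 3 := by
            have : 2 * L / p ≤ 2 := by rw [div_le_iff₀ hp0]; linarith
            linarith
          exact_mod_cast this.trans h7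
        have := (Finset.card_le_card hSle).trans (Finset.card_biUnion_le_card_mul _ _ 3 hfib)
        have : S.card ≤ 6 := by omega
        exact_mod_cast this
    · simp [Fin.prod_univ_four]
      apply le_of_eq
      ring
  have h3 : (F.card : ℝ) = ((F.filter fun f => f 1 ^ 2 - 3 * f 0 * f 2 = 0).card : ℝ) +
      ((F.filter fun f => ¬f 1 ^ 2 - 3 * f 0 * f 2 = 0).card : ℝ) := by
    exact_mod_cast (Finset.card_filter_add_card_filter_not _).symm
  rw [h3]
  linarith

end BCF

namespace BCF

/-! ### Reducible forms -/

theorem exists_root_of_not_irr {f : Fin 4 → ℤ} (hf : ¬Irr f) (h0 : f 0 ≠ 0) (h3 : f 3 ≠ 0) :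
    ∃ (x y : ℕ) (w z : ℤ) (b : Bool), x ≠ 0 ∧ y ≠ 0 ∧ f 3 = x * w ∧ f 0 = y * z ∧
      eval f x (if b then y else -y) = 0 := by
  simp only [Irr, not_forall] at hf
  obtain ⟨u, v, huv, hne⟩ := hf
  have hu : u ≠ 0 := by
    rintro rfl
    apply hne
    simp [eval, h3] at huv
    simp [huv]
  have hv : v ≠ 0 := by
    rintro rfl
    apply hne
    simp [eval, h0] at huv
    simp [huv]
  obtain ⟨g, u', v', hg, hco, rfl, rfl⟩ := Int.exists_gcd_one' (Int.gcd_pos_of_ne_zero_left v hu)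
  have hg0 : (g : ℤ) ≠ 0 := by exact_mod_cast hg.ne'
  have huv' : eval f u' v' = 0 := by
    have : eval f (u' * g) (v' * g) = g ^ 3 * eval f u' v' := by simp only [eval]; ring
    rw [this] at huv
    exact (mul_eq_zero.1 huv).resolve_left (pow_ne_zero _ hg0)
  have hcop : IsCoprime u' v' := Int.isCoprime_iff_gcd_eq_one.2 hco
  have d3 : u' ∣ f 3 := by
    refine (hcop.pow_right (n := 3)).dvd_of_dvd_mul_right
      ⟨-(f 0 * u' ^ 2 + f 1 * u' * v' + f 2 * v' ^ 2), ?_⟩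
    simp only [eval] at huv'
    linear_combination huv'
  have d0 : v' ∣ f 0 := by
    refine (hcop.symm.pow_right (n := 3)).dvd_of_dvd_mul_right
      ⟨-(f 1 * u' ^ 2 + f 2 * u' * v' + f 3 * v' ^ 2), ?_⟩
    simp only [eval] at huv'
    linear_combination huv'
  obtain ⟨w, hw⟩ := Int.natAbs_dvd.2 d3
  obtain ⟨z, hz⟩ := Int.natAbs_dvd.2 d0
  have hneg : eval f (-u') (-v') = 0 := by
    simp only [eval] at huv' ⊢
    linear_combination -huv'
  have hu' : u' ≠ 0 := left_ne_zero_of_mul hu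
  have hv' : v' ≠ 0 := left_ne_zero_of_mul hv
  have hx : ∃ b : Bool, eval f u'.natAbs (if b then (v'.natAbs : ℤ) else -v'.natAbs) = 0 := by
    rcases le_total 0 u' with h | h <;> rcases le_total 0 v' with h' | h' <;>
      simp only [Int.natCast_natAbs, abs_of_nonneg, abs_of_nonpos, h, h']
    · exact ⟨true, by simpa using huv'⟩
    · exact ⟨false, by simpa using huv'⟩
    · exact ⟨false, by simpa using hneg⟩
    · exact ⟨true, by simpa using hneg⟩
  obtain ⟨b, hb⟩ := hx
  exact ⟨_, _, w, z, b, Int.natAbs_ne_zero.2 hu', Int.natAbs_ne_zero.2 hv', hw, hz, hb⟩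

/-- The pairs of a positive integer and an integer whose product is at most `L`. -/
noncomputable def hyperbola (L : ℝ) : Finset (Σ _ : ℕ, ℤ) :=
  (Finset.Icc 1 ⌊L⌋₊).sigma fun x => Finset.Icc (-⌊L / x⌋) ⌊L / x⌋

theorem mem_hyperbola {L : ℝ} {x : ℕ} {w : ℤ} (hx : x ≠ 0) (hw : w ≠ 0)
    (h : |((x * w : ℤ) : ℝ)| ≤ L) : (⟨x, w⟩ : Σ _ : ℕ, ℤ) ∈ hyperbola L := by
  have hx0 : (0 : ℝ) < x := by exact_mod_cast Nat.pos_of_ne_zero hx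
  have hw1 : (1 : ℝ) ≤ |(w : ℝ)| := by exact_mod_cast Int.one_le_abs hw
  push_cast at h
  rw [abs_mul, abs_of_pos hx0] at h
  rw [hyperbola, Finset.mem_sigma, Finset.mem_Icc, Finset.mem_Icc, ← abs_le, Int.le_floor]
  refine ⟨⟨Nat.one_le_iff_ne_zero.2 hx, Nat.le_floor (by nlinarith)⟩, ?_⟩
  rw [le_div_iff₀ hx0]
  push_cast
  linarith

theorem card_hyperbola_le {L : ℝ} (hL : 1 ≤ L) :
    ((hyperbola L).card : ℝ) ≤ 3 * L * (1 + Real.log L) := by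
  rw [hyperbola, Finset.card_sigma]
  push_cast
  calc ∑ x ∈ Finset.Icc 1 ⌊L⌋₊, ((Finset.Icc (-⌊L / x⌋) ⌊L / x⌋).card : ℝ)
      ≤ ∑ x ∈ Finset.Icc 1 ⌊L⌋₊, 3 * L * (x : ℝ)⁻¹ := by
        refine Finset.sum_le_sum fun x hx => (card_Icc_floor_le (by positivity)).trans ?_
        rw [Finset.mem_Icc] at hx
        have hx0 : (0 : ℝ) < x := by exact_mod_cast hx.1
        have hxL : (x : ℝ) ≤ L := (Nat.le_floor_iff (by linarith)).1 hx.2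
        have : 1 ≤ L / x := (one_le_div hx0).2 hxL
        rw [mul_assoc, ← div_eq_mul_inv]
        linarith
    _ = 3 * L * (harmonic ⌊L⌋₊ : ℝ) := by
        rw [harmonic_eq_sum_Icc, ← Finset.mul_sum]; push_cast; rfl
    _ ≤ _ := by gcongr; exact harmonic_floor_le_one_add_log L hL

theorem reducible_bound {L : ℝ} (hL : 1 ≤ L) (F : Finset (Fin 4 → ℤ))
    (hF : F ⊆ box fun _ => L) (hs : ∀ f ∈ F, ¬Irr f) :
    (F.card : ℝ) ≤ 54 * L ^ 3 + 54 * L ^ 3 * (1 + Real.log L) ^ 2 := by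
  classical
  have hL0 : 0 ≤ L := by linarith
  have hN1 : 2 * L / (1 : ℕ) + 1 ≤ 3 * L := by push_cast; linarith
  have hz : ∀ k : Fin 4, ((F.filter fun f => f k = 0).card : ℝ) ≤ 27 * L ^ 3 := by
    intro k
    have hsub := (Finset.filter_subset (fun f : Fin 4 → ℤ => f k = 0) F).trans hF
    refine (card_le_prod_of_fibers _ (Function.update (fun _ => 3 * L) k 1) ?_ ?_).trans ?_
    · intro i
      by_cases h : i = k
      · subst h; simp
      · simp [h]; positivity
    · intro i f hf S hS
      by_cases h : i = k
      · subst h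
        have : S.card ≤ 1 := by
          refine Finset.card_le_one.2 fun x hx y hy => ?_
          obtain ⟨g, hg, -, rfl⟩ := hS x hx
          obtain ⟨g', hg', -, rfl⟩ := hS y hy
          rw [(Finset.mem_filter.1 hg).2, (Finset.mem_filter.1 hg').2]
        simpa using this
      · rw [Function.update_of_ne h]
        exact (coord_card_le hL0 hsub one_pos hS (by simp)).trans hN1
    · rw [Finset.prod_update_of_mem (Finset.mem_univ k), Finset.prod_const,
        Finset.card_sdiff_of_subset (Finset.subset_univ _)]
      simp
      apply le_of_eq
      ring
  set F' := F.filter fun f => f 0 ≠ 0 ∧ f 3 ≠ 0 with hF'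
  have hmain : (F'.card : ℝ) ≤ 54 * L ^ 3 * (1 + Real.log L) ^ 2 := by
    choose! x y w z b hx hy h3 h0 hev using fun f (hf : f ∈ F') =>
      exists_root_of_not_irr (hs f (Finset.mem_filter.1 hf).1) (Finset.mem_filter.1 hf).2.1
        (Finset.mem_filter.1 hf).2.2
    have hcard : F'.card ≤ ((hyperbola L ×ˢ hyperbola L) ×ˢ
        (Finset.Icc (-⌊L⌋) ⌊L⌋ ×ˢ (Finset.univ : Finset Bool))).card := by
      refine Finset.card_le_card_of_injOn
        (fun f => (((⟨x f, w f⟩, ⟨y f, z f⟩) : (Σ _ : ℕ, ℤ) × (Σ _ : ℕ, ℤ)), (f 1, b f))) ?_ ?_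
      · intro f hf
        have hf : f ∈ F' := hf
        have hbox := mem_box.1 (hF (Finset.mem_filter.1 hf).1)
        obtain ⟨hn0, hn3⟩ := (Finset.mem_filter.1 hf).2
        rw [h0 f hf] at hn0
        rw [h3 f hf] at hn3
        rw [Finset.mem_coe, Finset.mem_product, Finset.mem_product, Finset.mem_product]
        refine ⟨⟨mem_hyperbola (hx f hf) (right_ne_zero_of_mul hn3) ?_,
          mem_hyperbola (hy f hf) (right_ne_zero_of_mul hn0) ?_⟩, ?_, Finset.mem_univ _⟩
        · rw [← h3 f hf]; exact hbox 3
        · rw [← h0 f hf]; exact hbox 0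
        · rw [Finset.mem_Icc, ← abs_le, Int.le_floor]
          push_cast
          exact hbox 1
      · intro f hf g hg hfg
        have hf : f ∈ F' := hf
        have hg : g ∈ F' := hg
        simp only [Prod.mk.injEq, Sigma.mk.injEq, heq_eq_eq] at hfg
        obtain ⟨⟨⟨e1, e2⟩, e3, e4⟩, e5, e6⟩ := hfg
        have c0 : f 0 = g 0 := by rw [h0 f hf, h0 g hg, e3, e4]
        have c3 : f 3 = g 3 := by rw [h3 f hf, h3 g hg, e1, e2]
        refine ext4 c0 e5 ?_ c3
        have hevf := hev f hf
        have hevg := hev g hg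
        rw [← e1, ← e3, ← e6] at hevg
        set v : ℤ := if b f then (y f : ℤ) else -(y f : ℤ) with hv
        have hv0 : v ≠ 0 := by
          have : (y f : ℤ) ≠ 0 := by exact_mod_cast hy f hf
          rw [hv]; split_ifs
          · exact this
          · exact neg_ne_zero.2 this
        have hx0 : (x f : ℤ) ≠ 0 := by exact_mod_cast hx f hf
        have : (f 2 - g 2) * (x f * v ^ 2) = 0 := by
          simp only [eval] at hevf hevg
          rw [← c0, ← c3, ← e5] at hevg
          linear_combination hevf - hevg
        have := (mul_eq_zero.1 this).resolve_right (mul_ne_zero hx0 (pow_ne_zero _ hv0))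
        exact sub_eq_zero.1 this
    rw [Finset.card_product, Finset.card_product, Finset.card_product, Finset.card_univ,
      Fintype.card_bool] at hcard
    have hlog : 0 ≤ 1 + Real.log L := by have := Real.log_nonneg hL; linarith
    calc (F'.card : ℝ) ≤ ((hyperbola L).card : ℝ) * (hyperbola L).card *
          (((Finset.Icc (-⌊L⌋) ⌊L⌋).card : ℝ) * 2) := by exact_mod_cast hcard
      _ ≤ (3 * L * (1 + Real.log L)) * (3 * L * (1 + Real.log L)) * ((3 * L) * 2) := by
        have h1 := card_hyperbola_le hL
        have h2 : ((Finset.Icc (-⌊L⌋) ⌊L⌋).card : ℝ) ≤ 3 * L :=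
          (card_Icc_floor_le hL0).trans (by linarith)
        gcongr
      _ = _ := by ring
  have hcov : F ⊆ F' ∪ (F.filter (fun f => f 0 = 0) ∪ F.filter fun f => f 3 = 0) := by
    intro f hf
    simp only [hF', Finset.mem_union, Finset.mem_filter, hf, true_and]
    tauto
  have h1 : (F.card : ℝ) ≤ F'.card + (((F.filter fun f => f 0 = 0).card : ℝ) +
      ((F.filter fun f => f 3 = 0).card : ℝ)) := by
    exact_mod_cast (Finset.card_le_card hcov).trans ((Finset.card_union_le _ _).trans
      (Nat.add_le_add_left (Finset.card_union_le _ _) _))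
  linarith [hz 0, hz 3]

end BCF

namespace BCF

/-! ### The Jacobian of the parametrisation -/

/-- The Jacobian matrix of `Phi s`. -/
def jac (s : Bool) (t : Fin 4 → ℝ) : Matrix (Fin 4) (Fin 4) ℝ :=
  !![0, 0, 2, 0;
    -6 * t 2, 2 * cm s * t 3, -6 * t 0, 2 * cm s * t 1;
    12 * t 2 * t 0 - 4 * cm s * t 3 * t 1, -4 * cm s * t 3 * t 0 + 2 * ck s * t 2 * t 1,
      6 * t 0 ^ 2 + ck s * t 1 ^ 2, -4 * cm s * t 0 * t 1;
    -6 * t 2 * t 0 ^ 2 - ck s * t 2 * t 1 ^ 2 + 4 * cm s * t 3 * t 0 * t 1,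
      -2 * ck s * t 2 * t 0 * t 1 + 2 * cm s * t 3 * t 0 ^ 2 + 3 * cl s * t 3 * t 1 ^ 2,
      -2 * t 0 ^ 3 - ck s * t 0 * t 1 ^ 2, 2 * cm s * t 0 ^ 2 * t 1 + cl s * t 1 ^ 3]

/-- The Jacobian constant. -/
def cJ (s : Bool) : ℝ := if s then 576 else 64

theorem cJ_pos (s : Bool) : 0 < cJ s := by cases s <;> simp [cJ]

theorem cκ_pos (s : Bool) : 0 < cκ s := by cases s <;> simp [cκ]

theorem det_jac (s : Bool) (t : Fin 4 → ℝ) :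
    (jac s t).det = ce s * (cJ s * (t 2 ^ 2 + t 3 ^ 2) * t 1 ^ 4) := by
  cases s <;> simp [jac, Matrix.det_succ_row_zero, Fin.sum_univ_succ, Fin.succAbove, cm, ck, cl, ce, cJ] <;> ring

theorem abs_det_jac (s : Bool) (t : Fin 4 → ℝ) :
    |(jac s t).det| = cJ s * (t 2 ^ 2 + t 3 ^ 2) * t 1 ^ 4 := by
  have h : |ce s| = 1 := by cases s <;> simp [ce]
  have := cJ_pos s
  rw [det_jac, abs_mul, h, one_mul, abs_of_nonneg (by positivity)]

/-- The derivative of `Phi s`. -/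
noncomputable def jacL (s : Bool) (t : Fin 4 → ℝ) : (Fin 4 → ℝ) →L[ℝ] (Fin 4 → ℝ) :=
  (Matrix.toLin' (jac s t)).toContinuousLinearMap

theorem det_jacL (s : Bool) (t : Fin 4 → ℝ) : (jacL s t).det = (jac s t).det := by
  rw [jacL, ContinuousLinearMap.det, LinearMap.coe_toContinuousLinearMap, LinearMap.det_toLin']

theorem hasStrictFDerivAt_Phi (s : Bool) (t : Fin 4 → ℝ) :
    HasStrictFDerivAt (Phi s) (jacL s t) t := by
  rw [hasStrictFDerivAt_pi']
  have h0 := hasStrictFDerivAt_apply (𝕜 := ℝ) (F' := fun _ : Fin 4 => ℝ) 0 t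
  have h1 := hasStrictFDerivAt_apply (𝕜 := ℝ) (F' := fun _ : Fin 4 => ℝ) 1 t
  have h2 := hasStrictFDerivAt_apply (𝕜 := ℝ) (F' := fun _ : Fin 4 => ℝ) 2 t
  have h3 := hasStrictFDerivAt_apply (𝕜 := ℝ) (F' := fun _ : Fin 4 => ℝ) 3 t
  refine Fin.forall_fin_succ.2 ⟨?_, Fin.forall_fin_succ.2 ⟨?_, Fin.forall_fin_succ.2 ⟨?_,
    Fin.forall_fin_succ.2 ⟨?_, fun i => i.elim0⟩⟩⟩⟩
  · refine (h2.const_mul 2).congr_fderiv ?_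
    ext v
    simp [jacL, jac, dotProduct, Fin.sum_univ_four]
  · refine (((h2.const_mul (-6)).mul h0).add
      (((h3.const_mul (2 * cm s))).mul h1)).congr_fderiv ?_
    ext v
    simp [jacL, jac, dotProduct, Fin.sum_univ_four]
    ring
  · refine ((((h2.const_mul 6).mul (h0.pow 2)).sub
      (((h3.const_mul (4 * cm s)).mul h0).mul h1)).add
      ((h2.const_mul (ck s)).mul (h1.pow 2))).congr_fderiv ?_
    ext v
    simp [jacL, jac, dotProduct, Fin.sum_univ_four]
    ring
  · refine (((((h2.const_mul (-2)).mul (h0.pow 3)).sub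
      (((h2.const_mul (ck s)).mul h0).mul (h1.pow 2))).add
      (((h3.const_mul (2 * cm s)).mul (h0.pow 2)).mul h1)).add
      ((h3.const_mul (cl s)).mul (h1.pow 3))).congr_fderiv ?_
    ext v
    simp [jacL, jac, dotProduct, Fin.sum_univ_four]
    ring

theorem continuous_Phi (s : Bool) : Continuous (Phi s) :=
  continuous_iff_continuousAt.2 fun t => (hasStrictFDerivAt_Phi s t).continuousAt

theorem isOpen_image_Phi (s : Bool) {U : Set (Fin 4 → ℝ)} (hU : IsOpen U)
    (h : ∀ t ∈ U, 0 < t 1 ∧ t 2 ^ 2 + t 3 ^ 2 ≠ 0) : IsOpen (Phi s '' U) := by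
  rw [isOpen_iff_mem_nhds]
  rintro _ ⟨t, ht, rfl⟩
  have hdet : (jac s t).det ≠ 0 := by
    obtain ⟨h1, h2⟩ := h t ht
    rw [← abs_ne_zero, abs_det_jac]
    have := (cJ_pos s).ne'
    positivity
  have hsurj : ((jacL s t : (Fin 4 → ℝ) →ₗ[ℝ] (Fin 4 → ℝ))).range = ⊤ := by
    rw [LinearMap.range_eq_top]
    have : IsUnit (jac s t) := (Matrix.isUnit_iff_isUnit_det _).2 (isUnit_iff_ne_zero.2 hdet)
    exact Matrix.mulVec_surjective_iff_isUnit.2 this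
  rw [← (hasStrictFDerivAt_Phi s t).map_nhds_eq_of_surj hsurj]
  exact image_mem_map (hU.mem_nhds ht)

end BCF

namespace BCF

open MeasureTheory

/-! ### The volume of the fundamental domain -/

theorem lintegral_fin_four {f : (Fin 4 → ℝ) → ENNReal} (hf : Measurable f) :
    ∫⁻ t, f t = ∫⁻ x, ∫⁻ y, ∫⁻ p : ℝ × ℝ, f ![x, y, p.1, p.2] := by
  have e3 := (volume_preserving_piFinSuccAbove (fun _ : Fin 4 => ℝ) 0).symm
  have e2 := (volume_preserving_piFinSuccAbove (fun _ : Fin 3 => ℝ) 0).symm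
  have e1 := (volume_preserving_finTwoArrow ℝ).symm
  rw [← e3.lintegral_comp hf, Measure.volume_eq_prod, lintegral_prod _ (by fun_prop)]
  refine lintegral_congr fun x => ?_
  rw [← e2.lintegral_comp (by fun_prop), Measure.volume_eq_prod, lintegral_prod _ (by fun_prop)]
  refine lintegral_congr fun y => ?_
  rw [← e1.lintegral_comp (by fun_prop)]
  refine lintegral_congr fun p => ?_
  congr 1
  apply ext4 <;> rfl

theorem lintegral_Ioo_of_hasDerivAt {a b : ℝ} (h : a ≤ b) {F f : ℝ → ℝ}
    (hF : ∀ x ∈ Set.Icc a b, HasDerivAt F (f x) x) (hf : ContinuousOn f (Set.Icc a b))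
    (h0 : ∀ x ∈ Set.Icc a b, 0 ≤ f x) :
    ∫⁻ x in Set.Ioo a b, ENNReal.ofReal (f x) = ENNReal.ofReal (F b - F a) := by
  have hi : IntervalIntegrable f volume a b :=
    ContinuousOn.intervalIntegrable (by rwa [Set.uIcc_of_le h])
  rw [setLIntegral_congr Ioo_ae_eq_Ioc, ← intervalIntegral.integral_eq_sub_of_hasDerivAt
    (by rwa [Set.uIcc_of_le h]) hi, intervalIntegral.integral_of_le h,
    ofReal_integral_eq_lintegral_ofReal]
  · exact (intervalIntegrable_iff_integrableOn_Ioc_of_le h).1 hi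
  · exact (ae_restrict_iff' measurableSet_Ioc).2 (.of_forall fun x hx =>
      h0 x (Set.Ioc_subset_Icc_self hx))

theorem lintegral_radial {I : Set ℝ} (hI : MeasurableSet I) (hI0 : I ⊆ Set.Ioi 0) :
    ∫⁻ p in {p : ℝ × ℝ | Real.sqrt (p.1 ^ 2 + p.2 ^ 2) ∈ I}, ENNReal.ofReal (p.1 ^ 2 + p.2 ^ 2)
      = ENNReal.ofReal (2 * Real.pi) * ∫⁻ r in I, ENNReal.ofReal (r ^ 3) := by
  have hm : MeasurableSet {p : ℝ × ℝ | Real.sqrt (p.1 ^ 2 + p.2 ^ 2) ∈ I} :=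
    measurableSet_preimage (by fun_prop) hI
  rw [← lintegral_indicator hm, ← lintegral_comp_polarCoord_symm, polarCoord_target,
    Measure.volume_eq_prod]
  have key : ∀ p ∈ Set.Ioi (0 : ℝ) ×ˢ Set.Ioo (-Real.pi) Real.pi,
      ENNReal.ofReal p.1 • {p : ℝ × ℝ | Real.sqrt (p.1 ^ 2 + p.2 ^ 2) ∈ I}.indicator
        (fun p => ENNReal.ofReal (p.1 ^ 2 + p.2 ^ 2)) (polarCoord.symm p)
      = I.indicator (fun r => ENNReal.ofReal (r ^ 3)) p.1 := by
    rintro ⟨r, θ⟩ ⟨hr, -⟩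
    have hr : 0 < r := hr
    have e : (r * Real.cos θ) ^ 2 + (r * Real.sin θ) ^ 2 = r ^ 2 := by
      linear_combination r ^ 2 * Real.cos_sq_add_sin_sq θ
    by_cases h : r ∈ I
    · rw [Set.indicator_of_mem (by simpa [e, Real.sqrt_sq hr.le] using h), Set.indicator_of_mem h]
      simp only [polarCoord_symm_apply, e, smul_eq_mul]
      rw [← ENNReal.ofReal_mul hr.le]
      congr 1
      ring
    · rw [Set.indicator_of_notMem (by simpa [e, Real.sqrt_sq hr.le] using h),
        Set.indicator_of_notMem h, smul_zero]
  have hmeas : Measurable fun p : ℝ × ℝ => I.indicator (fun r => ENNReal.ofReal (r ^ 3)) p.1 :=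
    (Measurable.indicator (by fun_prop) hI).comp measurable_fst
  rw [setLIntegral_congr_fun (measurableSet_Ioi.prod measurableSet_Ioo) key,
    setLIntegral_prod _ hmeas.aemeasurable]
  simp only [lintegral_const, Measure.restrict_apply MeasurableSet.univ, Set.univ_inter,
    Real.volume_Ioo]
  rw [lintegral_mul_const _ (Measurable.indicator (by fun_prop) hI), mul_comm,
    setLIntegral_indicator hI, Set.inter_eq_left.2 hI0]
  congr 2
  ring

theorem lintegral_radial_Ioo {I : Set ℝ} (hI : MeasurableSet I) (hI0 : I ⊆ Set.Ioi 0) {R : ℝ}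
    (hR : 0 ≤ R) (h : I =ᵐ[volume] Set.Ioo 0 R) :
    ∫⁻ p in {p : ℝ × ℝ | Real.sqrt (p.1 ^ 2 + p.2 ^ 2) ∈ I}, ENNReal.ofReal (p.1 ^ 2 + p.2 ^ 2)
      = ENNReal.ofReal (Real.pi / 2 * R ^ 4) := by
  rw [lintegral_radial hI hI0, setLIntegral_congr h, lintegral_Ioo_of_hasDerivAt hR
    (F := fun r => r ^ 4 / 4) (fun x _ => ?_) (by fun_prop) (fun x hx => pow_nonneg hx.1 3),
    ← ENNReal.ofReal_mul (by positivity)]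
  · congr 1
    ring
  · exact ((hasDerivAt_pow 4 x).div_const 4).congr_deriv (by push_cast; ring)

/-- The radius of the fibre of the fundamental domain over a point with imaginary part `y`. -/
noncomputable def rad (s : Bool) (y : ℝ) : ℝ := ((cκ s * y ^ 6)⁻¹) ^ ((1 : ℝ) / 4)

theorem rad_pow (s : Bool) {y : ℝ} (hy : 0 < y) : rad s y ^ 4 = (cκ s * y ^ 6)⁻¹ := by
  have := cκ_pos s
  rw [rad, ← Real.rpow_natCast, ← Real.rpow_mul (by positivity)]
  norm_num

theorem rad_nonneg (s : Bool) (y : ℝ) : 0 ≤ rad s y := by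
  have := cκ_pos s
  exact Real.rpow_nonneg (by positivity) _

/-- The normalised volume of a truncated fundamental domain. -/
noncomputable def vol (s : Bool) (T : ℝ) : ℝ :=
  cJ s * Real.pi / (2 * cκ s) * (Real.pi / 6 - (2 * T)⁻¹)

theorem lintegral_fund (s : Bool) {T : ℝ} (hT : 1 ≤ T) {A : Set ℝ} {C I : ℝ → Set ℝ}
    (hA : A =ᵐ[volume] Set.Ioo 0 (1 / 2)) (hA' : A ⊆ Set.Icc 0 (1 / 2)) (hAm : MeasurableSet A)
    (hC : ∀ x ∈ A, C x =ᵐ[volume] Set.Ioo (Real.sqrt (1 - x ^ 2)) T)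
    (hC' : ∀ x ∈ A, C x ⊆ Set.Ioi 0) (hCm : ∀ x, MeasurableSet (C x))
    (hI : ∀ y, 0 < y → I y =ᵐ[volume] Set.Ioo 0 (rad s y)) (hI' : ∀ y, I y ⊆ Set.Ioi 0)
    (hIm : ∀ y, MeasurableSet (I y))
    (hS : MeasurableSet {t : Fin 4 → ℝ | t 0 ∈ A ∧ t 1 ∈ C (t 0) ∧
      Real.sqrt (t 2 ^ 2 + t 3 ^ 2) ∈ I (t 1)}) :
    ∫⁻ t in {t : Fin 4 → ℝ | t 0 ∈ A ∧ t 1 ∈ C (t 0) ∧ Real.sqrt (t 2 ^ 2 + t 3 ^ 2) ∈ I (t 1)},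
      ENNReal.ofReal (cJ s * (t 2 ^ 2 + t 3 ^ 2) * t 1 ^ 4) = ENNReal.ofReal (vol s T) := by
  have hJ := cJ_pos s
  have hκ := cκ_pos s
  rw [← lintegral_indicator hS, lintegral_fin_four (Measurable.indicator (by fun_prop) hS)]
  have h3 : ∀ x y, x ∈ A → y ∈ C x → ∫⁻ p : ℝ × ℝ, {t : Fin 4 → ℝ | t 0 ∈ A ∧ t 1 ∈ C (t 0) ∧
      Real.sqrt (t 2 ^ 2 + t 3 ^ 2) ∈ I (t 1)}.indicator
      (fun t => ENNReal.ofReal (cJ s * (t 2 ^ 2 + t 3 ^ 2) * t 1 ^ 4)) ![x, y, p.1, p.2]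
      = ENNReal.ofReal (cJ s * Real.pi / (2 * cκ s) * (y ^ 2)⁻¹) := by
    intro x y hx hy
    have hy0 : 0 < y := hC' x hx hy
    have hm : MeasurableSet {p : ℝ × ℝ | Real.sqrt (p.1 ^ 2 + p.2 ^ 2) ∈ I y} :=
      measurableSet_preimage (by fun_prop) (hIm y)
    calc _ = ∫⁻ p : ℝ × ℝ, {p : ℝ × ℝ | Real.sqrt (p.1 ^ 2 + p.2 ^ 2) ∈ I y}.indicator
          (fun p => ENNReal.ofReal (cJ s * y ^ 4) * ENNReal.ofReal (p.1 ^ 2 + p.2 ^ 2)) p := by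
          refine lintegral_congr fun p => ?_
          by_cases h : Real.sqrt (p.1 ^ 2 + p.2 ^ 2) ∈ I y
          · rw [Set.indicator_of_mem (by simpa using ⟨hx, hy, h⟩),
              Set.indicator_of_mem (s := {p : ℝ × ℝ | Real.sqrt (p.1 ^ 2 + p.2 ^ 2) ∈ I y}) h,
              ← ENNReal.ofReal_mul (by positivity)]
            congr 1
            simp
            ring
          · rw [Set.indicator_of_notMem (by simp [h]), Set.indicator_of_notMem
              (s := {p : ℝ × ℝ | Real.sqrt (p.1 ^ 2 + p.2 ^ 2) ∈ I y}) h]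
      _ = _ := by
          rw [lintegral_indicator hm, lintegral_const_mul _ (by fun_prop),
            lintegral_radial_Ioo (hIm y) (hI' y) (rad_nonneg s y) (hI y hy0), rad_pow s hy0,
            ← ENNReal.ofReal_mul (by positivity)]
          congr 1
          field_simp
  have h3' : ∀ x y, ¬ (x ∈ A ∧ y ∈ C x) → ∫⁻ p : ℝ × ℝ, {t : Fin 4 → ℝ | t 0 ∈ A ∧ t 1 ∈ C (t 0) ∧
      Real.sqrt (t 2 ^ 2 + t 3 ^ 2) ∈ I (t 1)}.indicator
      (fun t => ENNReal.ofReal (cJ s * (t 2 ^ 2 + t 3 ^ 2) * t 1 ^ 4)) ![x, y, p.1, p.2] = 0 := by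
    intro x y h
    have : ∀ p : ℝ × ℝ, {t : Fin 4 → ℝ | t 0 ∈ A ∧ t 1 ∈ C (t 0) ∧
      Real.sqrt (t 2 ^ 2 + t 3 ^ 2) ∈ I (t 1)}.indicator
      (fun t => ENNReal.ofReal (cJ s * (t 2 ^ 2 + t 3 ^ 2) * t 1 ^ 4)) ![x, y, p.1, p.2] = 0 :=
      fun p => Set.indicator_of_notMem (fun hp => h ⟨hp.1, hp.2.1⟩) _
    simp only [this, lintegral_zero]
  have hsq : ∀ x ∈ Set.Icc (0 : ℝ) (1 / 2), 0 < 1 - x ^ 2 := fun x hx => by nlinarith [hx.1, hx.2]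
  have hs1 : ∀ x ∈ Set.Icc (0 : ℝ) (1 / 2), Real.sqrt (1 - x ^ 2) ≤ T := fun x hx =>
    (Real.sqrt_le_one.2 (by nlinarith [hx.1])).trans hT
  have h2 : ∀ x, ∫⁻ y, ∫⁻ p : ℝ × ℝ, {t : Fin 4 → ℝ | t 0 ∈ A ∧ t 1 ∈ C (t 0) ∧
      Real.sqrt (t 2 ^ 2 + t 3 ^ 2) ∈ I (t 1)}.indicator
      (fun t => ENNReal.ofReal (cJ s * (t 2 ^ 2 + t 3 ^ 2) * t 1 ^ 4)) ![x, y, p.1, p.2]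
      = A.indicator (fun x => ENNReal.ofReal (cJ s * Real.pi / (2 * cκ s) *
        (1 / Real.sqrt (1 - x ^ 2) - T⁻¹))) x := by
    intro x
    by_cases hx : x ∈ A
    · have h0 := Real.sqrt_pos.2 (hsq x (hA' hx))
      rw [Set.indicator_of_mem hx]
      calc _ = ∫⁻ y, (C x).indicator (fun y =>
            ENNReal.ofReal (cJ s * Real.pi / (2 * cκ s) * (y ^ 2)⁻¹)) y := by
            refine lintegral_congr fun y => ?_
            by_cases hy : y ∈ C x
            · rw [h3 x y hx hy, Set.indicator_of_mem hy]
            · rw [h3' x y (fun h => hy h.2), Set.indicator_of_notMem hy]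
        _ = _ := by
            rw [lintegral_indicator (hCm x), setLIntegral_congr (hC x hx),
              lintegral_Ioo_of_hasDerivAt (hs1 x (hA' hx))
              (F := fun y => -(cJ s * Real.pi / (2 * cκ s) * y⁻¹))
              (f := fun y => cJ s * Real.pi / (2 * cκ s) * (y ^ 2)⁻¹) (fun y hy => ?_) ?_
              (fun y hy => by positivity)]
            · congr 1
              ring
            · refine continuousOn_const.mul (ContinuousOn.inv₀ (by fun_prop) fun y hy => ?_)
              exact pow_ne_zero _ (h0.trans_le hy.1).ne'
            · have hy : y ≠ 0 := (h0.trans_le hy.1).ne'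
              exact ((hasDerivAt_inv hy).const_mul (cJ s * Real.pi / (2 * cκ s))).neg.congr_deriv
                (by ring)
    · rw [Set.indicator_of_notMem hx]
      have : ∀ y, ∫⁻ p : ℝ × ℝ, {t : Fin 4 → ℝ | t 0 ∈ A ∧ t 1 ∈ C (t 0) ∧
        Real.sqrt (t 2 ^ 2 + t 3 ^ 2) ∈ I (t 1)}.indicator (fun t =>
          ENNReal.ofReal (cJ s * (t 2 ^ 2 + t 3 ^ 2) * t 1 ^ 4)) ![x, y, p.1, p.2] = 0 :=
        fun y => h3' x y fun h => hx h.1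
      simp only [this, lintegral_zero]
  simp only [h2]
  rw [lintegral_indicator hAm, setLIntegral_congr hA, lintegral_Ioo_of_hasDerivAt (by norm_num)
    (F := fun x => cJ s * Real.pi / (2 * cκ s) * (Real.arcsin x - x * T⁻¹))
    (f := fun x => cJ s * Real.pi / (2 * cκ s) * (1 / Real.sqrt (1 - x ^ 2) - T⁻¹))
    (fun x hx => ?_) ?_
    (fun x hx => ?_)]
  · have e : Real.arcsin (1 / 2) = Real.pi / 6 := by
      rw [← Real.sin_pi_div_six, Real.arcsin_sin] <;> linarith [Real.pi_pos]
    rw [e, Real.arcsin_zero, vol]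
    congr 1
    field_simp
    ring
  · refine continuousOn_const.mul (ContinuousOn.sub ?_ continuousOn_const)
    exact continuousOn_const.div (by fun_prop) fun x hx => (Real.sqrt_pos.2 (hsq x hx)).ne'
  · refine HasDerivAt.const_mul _ ((Real.hasDerivAt_arcsin ?_ ?_).sub ?_)
    · linarith [hx.1]
    · linarith [hx.2]
    · simpa using (hasDerivAt_id x).mul_const T⁻¹
  · have h1 : Real.sqrt (1 - x ^ 2) ≤ T := hs1 x hx
    have h0 := Real.sqrt_pos.2 (hsq x hx)
    have : T⁻¹ ≤ 1 / Real.sqrt (1 - x ^ 2) := by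
      rw [one_div]
      gcongr
    have h4 : 0 ≤ 1 / Real.sqrt (1 - x ^ 2) - T⁻¹ := by linarith
    positivity

end BCF

namespace BCF

open MeasureTheory

/-- The open truncated fundamental domain. -/
def openDom (s : Bool) (T : ℝ) : Set (Fin 4 → ℝ) :=
  {t | 0 < t 0 ∧ t 0 < 1 / 2 ∧ 1 < t 0 ^ 2 + t 1 ^ 2 ∧ 0 < t 1 ∧ t 1 < T ∧
    0 < t 2 ^ 2 + t 3 ^ 2 ∧ cκ s * t 1 ^ 6 * (t 2 ^ 2 + t 3 ^ 2) ^ 2 < 1}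

/-- The closed truncated fundamental domain. -/
def closedDom (s : Bool) (T : ℝ) : Set (Fin 4 → ℝ) :=
  {t | 0 ≤ t 0 ∧ t 0 ≤ 1 / 2 ∧ 1 ≤ t 0 ^ 2 + t 1 ^ 2 ∧ 0 ≤ t 1 ∧ t 1 ≤ T ∧
    cκ s * t 1 ^ 6 * (t 2 ^ 2 + t 3 ^ 2) ^ 2 ≤ 1}

theorem openDom_subset_closedDom (s : Bool) (T : ℝ) : openDom s T ⊆ closedDom s T :=
  fun _ ⟨h1, h2, h3, h4, h5, _, h7⟩ => ⟨h1.le, h2.le, h3.le, h4.le, h5.le, h7.le⟩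

theorem isOpen_openDom (s : Bool) (T : ℝ) : IsOpen (openDom s T) := by
  unfold openDom
  simp only [Set.ofPred_and]
  repeat' first
    | exact isOpen_lt (by fun_prop) (by fun_prop)
    | refine IsOpen.inter ?_ ?_

theorem isClosed_closedDom (s : Bool) (T : ℝ) : IsClosed (closedDom s T) := by
  unfold closedDom
  simp only [Set.ofPred_and]
  repeat' first
    | exact isClosed_le (by fun_prop) (by fun_prop)
    | refine IsClosed.inter ?_ ?_

theorem le_cκ (s : Bool) : 64 ≤ cκ s := by cases s <;> norm_num [cκ]

theorem isCompact_closedDom (s : Bool) {T : ℝ} (hT : 1 ≤ T) : IsCompact (closedDom s T) := by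
  refine Metric.isCompact_of_isClosed_isBounded (isClosed_closedDom s T)
    ((Metric.isBounded_closedBall (x := 0) (r := T)).subset ?_)
  rintro t ⟨h1, h2, h3, h4, h5, h6⟩
  have hy : 3 / 4 ≤ t 1 ^ 2 := by nlinarith
  have hy6 : (3 / 4) ^ 3 ≤ t 1 ^ 6 := by
    calc _ ≤ (t 1 ^ 2) ^ 3 := by gcongr
      _ = _ := by ring
  have hq : (t 2 ^ 2 + t 3 ^ 2) ^ 2 ≤ 1 := by
    have : 1 ≤ cκ s * t 1 ^ 6 := by nlinarith [le_cκ s]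
    nlinarith [sq_nonneg (t 2 ^ 2 + t 3 ^ 2)]
  have hq' : t 2 ^ 2 + t 3 ^ 2 ≤ 1 := by nlinarith [sq_nonneg (t 2), sq_nonneg (t 3)]
  rw [mem_closedBall_zero_iff, pi_norm_le_iff_of_nonneg (by linarith)]
  refine Fin.forall_fin_succ.2 ⟨?_, Fin.forall_fin_succ.2 ⟨?_, Fin.forall_fin_succ.2 ⟨?_,
    Fin.forall_fin_succ.2 ⟨?_, fun i => i.elim0⟩⟩⟩⟩
  · exact abs_le.2 ⟨by linarith, by linarith⟩
  · exact abs_le.2 ⟨show -T ≤ t 1 by linarith, h5⟩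
  · exact (abs_le_one_iff_mul_self_le_one.2 (show t 2 * t 2 ≤ 1 by
      nlinarith [sq_nonneg (t 3)])).trans hT
  · exact (abs_le_one_iff_mul_self_le_one.2 (show t 3 * t 3 ≤ 1 by
      nlinarith [sq_nonneg (t 2)])).trans hT

theorem isOpen_image_openDom (s : Bool) (T : ℝ) : IsOpen (Phi s '' openDom s T) :=
  isOpen_image_Phi s (isOpen_openDom s T) fun _ ht => ⟨ht.2.2.2.1, ht.2.2.2.2.2.1.ne'⟩

theorem isCompact_image_closedDom (s : Bool) {T : ℝ} (hT : 1 ≤ T) :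
    IsCompact (Phi s '' closedDom s T) :=
  (isCompact_closedDom s hT).image (continuous_Phi s)

theorem isBounded_image_openDom (s : Bool) {T : ℝ} (hT : 1 ≤ T) :
    Bornology.IsBounded (Phi s '' openDom s T) :=
  (isCompact_image_closedDom s hT).isBounded.subset
    (Set.image_mono (openDom_subset_closedDom s T))

theorem sqrt_pow_four {q : ℝ} (hq : 0 ≤ q) : Real.sqrt q ^ 4 = q ^ 2 := by
  rw [show (4 : ℕ) = 2 * 2 from rfl, pow_mul, Real.sq_sqrt hq]

theorem sqrt_lt_rad_iff (s : Bool) {y q : ℝ} (hy : 0 < y) (hq : 0 ≤ q) :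
    Real.sqrt q < rad s y ↔ cκ s * y ^ 6 * q ^ 2 < 1 := by
  have := cκ_pos s
  rw [← pow_lt_pow_iff_left₀ (Real.sqrt_nonneg q) (rad_nonneg s y) (four_ne_zero), rad_pow s hy,
    sqrt_pow_four hq, ← one_div, lt_div_iff₀ (by positivity), mul_comm]

theorem sqrt_le_rad_iff (s : Bool) {y q : ℝ} (hy : 0 < y) (hq : 0 ≤ q) :
    Real.sqrt q ≤ rad s y ↔ cκ s * y ^ 6 * q ^ 2 ≤ 1 := by
  have := cκ_pos s
  rw [← pow_le_pow_iff_left₀ (Real.sqrt_nonneg q) (rad_nonneg s y) (four_ne_zero), rad_pow s hy,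
    sqrt_pow_four hq, ← one_div, le_div_iff₀ (by positivity), mul_comm]

theorem volume_image_openDom (s : Bool) {T : ℝ} (hT : 1 ≤ T) :
    volume (Phi s '' openDom s T) = ENNReal.ofReal (vol s T) := by
  have e : openDom s T = {t : Fin 4 → ℝ | t 0 ∈ Set.Ioo (0 : ℝ) (1 / 2) ∧
      t 1 ∈ {y : ℝ | 1 < t 0 ^ 2 + y ^ 2 ∧ 0 < y ∧ y < T} ∧
      Real.sqrt (t 2 ^ 2 + t 3 ^ 2) ∈ Set.Ioo 0 (rad s (t 1))} := by
    ext t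
    constructor
    · rintro ⟨h1, h2, h3, h4, h5, h6, h7⟩
      exact ⟨⟨h1, h2⟩, ⟨h3, h4, h5⟩, Real.sqrt_pos.2 h6, (sqrt_lt_rad_iff s h4 h6.le).2 h7⟩
    · rintro ⟨⟨h1, h2⟩, ⟨h3, h4, h5⟩, h6, h7⟩
      have h6 := Real.sqrt_pos.1 h6
      exact ⟨h1, h2, h3, h4, h5, h6, (sqrt_lt_rad_iff s h4 h6.le).1 h7⟩
  have hm := (isOpen_openDom s T).measurableSet
  rw [← lintegral_abs_det_fderiv_eq_addHaar_image volume hm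
    (fun t _ => (hasStrictFDerivAt_Phi s t).hasFDerivAt.hasFDerivWithinAt) ?_]
  · simp only [det_jacL, abs_det_jac]
    rw [e] at hm ⊢
    refine lintegral_fund s hT (A := Set.Ioo 0 (1 / 2))
      (C := fun x => {y : ℝ | 1 < x ^ 2 + y ^ 2 ∧ 0 < y ∧ y < T})
      (I := fun y => Set.Ioo 0 (rad s y)) (ae_eq_refl _) Set.Ioo_subset_Icc_self measurableSet_Ioo
      (fun x hx => ?_) (fun x hx y hy => hy.2.1) (fun x => ?_) (fun y _ => ae_eq_refl _)
      (fun y => Set.Ioo_subset_Ioi_self) (fun y => measurableSet_Ioo) hm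
    · refine (Eq.eventuallyEq ?_)
      ext y
      have h1 : 0 < 1 - x ^ 2 := by nlinarith [hx.1, hx.2]
      constructor
      · rintro ⟨h2, h3, h4⟩
        exact ⟨(Real.sqrt_lt' h3).2 (by linarith), h4⟩
      · rintro ⟨h2, h4⟩
        have h3 := (Real.sqrt_pos.2 h1).trans h2
        exact ⟨by linarith [(Real.sqrt_lt' h3).1 h2], h3, h4⟩
    · simp only [Set.ofPred_and]
      exact (measurableSet_lt (by fun_prop) (by fun_prop)).inter
        (measurableSet_Ioi.inter measurableSet_Iio)
  · intro t ht t' ht' h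
    exact Phi_inj s ht.2.2.2.1 ht'.2.2.2.1 ht.2.2.2.2.2.1.ne' h

theorem volume_image_closedDom_le (s : Bool) {T : ℝ} (hT : 1 ≤ T) :
    volume (Phi s '' closedDom s T) ≤ ENNReal.ofReal (vol s T) := by
  have e : closedDom s T ∩ {t | 0 < t 2 ^ 2 + t 3 ^ 2} =
      {t : Fin 4 → ℝ | t 0 ∈ Set.Icc (0 : ℝ) (1 / 2) ∧
      t 1 ∈ {y : ℝ | 1 ≤ t 0 ^ 2 + y ^ 2 ∧ 0 ≤ y ∧ y ≤ T} ∧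
      Real.sqrt (t 2 ^ 2 + t 3 ^ 2) ∈ Set.Ioc 0 (rad s (t 1))} := by
    ext t
    constructor
    · rintro ⟨⟨h1, h2, h3, h4, h5, h7⟩, h6⟩
      have h4' : 0 < t 1 := h4.lt_of_ne fun h => by nlinarith
      exact ⟨⟨h1, h2⟩, ⟨h3, h4, h5⟩, Real.sqrt_pos.2 h6,
        (sqrt_le_rad_iff s h4' (le_of_lt h6)).2 h7⟩
    · rintro ⟨⟨h1, h2⟩, ⟨h3, h4, h5⟩, h6, h7⟩
      have h6 := Real.sqrt_pos.1 h6
      have h4' : 0 < t 1 := h4.lt_of_ne fun h => by nlinarith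
      exact ⟨⟨h1, h2, h3, h4, h5, (sqrt_le_rad_iff s h4' h6.le).1 h7⟩, h6⟩
  have hm : MeasurableSet (closedDom s T ∩ {t | 0 < t 2 ^ 2 + t 3 ^ 2}) :=
    (isClosed_closedDom s T).measurableSet.inter (measurableSet_lt (by fun_prop) (by fun_prop))
  have hsub : Phi s '' closedDom s T ⊆
      {0} ∪ Phi s '' (closedDom s T ∩ {t | 0 < t 2 ^ 2 + t 3 ^ 2}) := by
    rintro _ ⟨t, ht, rfl⟩
    by_cases h : 0 < t 2 ^ 2 + t 3 ^ 2
    · exact Or.inr ⟨t, ⟨ht, h⟩, rfl⟩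
    · have h2 : t 2 = 0 := by nlinarith [sq_nonneg (t 2), sq_nonneg (t 3)]
      have h3 : t 3 = 0 := by nlinarith [sq_nonneg (t 2), sq_nonneg (t 3)]
      left
      apply ext4 <;> simp [Phi, h2, h3]
  refine (measure_mono hsub).trans ((measure_union_le _ _).trans ?_)
  rw [measure_singleton, zero_add]
  refine (addHaar_image_le_lintegral_abs_det_fderiv volume hm
    (fun t _ => (hasStrictFDerivAt_Phi s t).hasFDerivAt.hasFDerivWithinAt)).trans (le_of_eq ?_)
  simp only [det_jacL, abs_det_jac]
  rw [e] at hm ⊢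
  refine lintegral_fund s hT (A := Set.Icc 0 (1 / 2))
    (C := fun x => {y : ℝ | 1 ≤ x ^ 2 + y ^ 2 ∧ 0 ≤ y ∧ y ≤ T})
    (I := fun y => Set.Ioc 0 (rad s y)) Ioo_ae_eq_Icc.symm subset_rfl measurableSet_Icc
    (fun x hx => ?_) (fun x hx y hy => ?_) (fun x => ?_) (fun y _ => Ioo_ae_eq_Ioc.symm)
    (fun y => Set.Ioc_subset_Ioi_self) (fun y => measurableSet_Ioc) hm
  · refine (Eq.eventuallyEq ?_).trans Ioo_ae_eq_Icc.symm
    ext y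
    constructor
    · rintro ⟨h2, h3, h4⟩
      exact ⟨(Real.sqrt_le_left h3).2 (by linarith), h4⟩
    · rintro ⟨h2, h4⟩
      have h3 := (Real.sqrt_nonneg _).trans h2
      exact ⟨by linarith [(Real.sqrt_le_left h3).1 h2], h3, h4⟩
  · exact hy.2.1.lt_of_ne fun h => by nlinarith [hy.1, hx.1, hx.2]
  · simp only [Set.ofPred_and]
    exact (measurableSet_le (by fun_prop) (by fun_prop)).inter
      (measurableSet_Ici.inter measurableSet_Iic)

end BCF

namespace BCF

open MeasureTheory

/-! ### Classes and reduced forms -/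

/-- Irreducible forms of fundamental discriminant with sign `s` and absolute value below `X`. -/
def GoodS (s : Bool) (X : ℝ) (f : Fin 4 → ℤ) : Prop :=
  Irr f ∧ Fund (disc f) ∧ 0 < ce s * (disc f : ℤ) ∧ |((disc f : ℤ) : ℝ)| < X

/-- The relation of equivalence on such forms. -/
def classRel (s : Bool) (X : ℝ) (f g : {f : Fin 4 → ℤ // GoodS s X f}) : Prop := GEquiv f.1 g.1

theorem good_iff (X : ℝ) (s : Bool) (f : Fin 4 → ℤ) :
    Good (if s then 0 else -X) (if s then X else 0) f ↔ GoodS s X f := by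
  have : (0 < ce s * (disc f : ℤ) ∧ |((disc f : ℤ) : ℝ)| < X) ↔
      (if s then 0 else -X) < ((disc f : ℤ) : ℝ) ∧ ((disc f : ℤ) : ℝ) < (if s then X else 0) := by
    cases s
    · simp only [ce, Bool.false_eq_true, if_false, abs_lt]
      constructor <;> rintro ⟨h1, h2⟩
      · exact ⟨h2.1, by linarith⟩
      · exact ⟨by linarith, h1, by linarith⟩
    · simp only [ce, if_true, abs_lt]
      constructor <;> rintro ⟨h1, h2⟩
      · exact ⟨by linarith, h2.2⟩
      · exact ⟨by linarith, by linarith, h2⟩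
  rw [Good, GoodS, this]

theorem cubicFieldCountNTR_eq_classRel (s : Bool) (X : ℝ) :
    cubicFieldCountNTR (if s then 0 else -X) (if s then X else 0)
      = Nat.card (Quot (classRel s X)) := by
  rw [cubicFieldCountNTR_eq]
  have : Good (if s then 0 else -X) (if s then X else 0) = GoodS s X :=
    funext fun f => propext (good_iff X s f)
  rw [this]
  rfl

theorem GoodS.gequiv {s : Bool} {X : ℝ} {f g : Fin 4 → ℤ} (hf : GoodS s X f) (h : GEquiv f g) :
    GoodS s X g := by
  obtain ⟨h1, h2, h3, h4⟩ := hf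
  exact ⟨h1.gequiv h, by rwa [h.disc_eq], by rwa [h.disc_eq], by rwa [h.disc_eq]⟩

theorem GEquiv.neg (f : Fin 4 → ℤ) : GEquiv f (-f) :=
  ⟨-1, 0, 0, -1, by simp, (act_neg_id f).symm⟩

theorem classRel_exact {s : Bool} {X : ℝ} {f g : {f : Fin 4 → ℤ // GoodS s X f}}
    (h : Quot.mk (classRel s X) f = Quot.mk (classRel s X) g) : GEquiv f.1 g.1 := by
  have he : Equivalence (classRel s X) :=
    ⟨fun f => GEquiv.refl f.1, fun h => GEquiv.symm h, fun h h' => GEquiv.trans h h'⟩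
  exact (he.quot_mk_eq_iff f g).1 h

/-- The reduced forms. -/
def redSet (s : Bool) (X : ℝ) : Set (Fin 4 → ℤ) :=
  {g | GoodS s X g ∧ ∃ t, Phi s t = toR g ∧ Reduced t}

/-- The strictly reduced forms. -/
def intRedSet (s : Bool) (X : ℝ) : Set (Fin 4 → ℤ) :=
  {g | GoodS s X g ∧ ∃ t, Phi s t = toR g ∧ IntReduced t}

theorem Reduced.half_le {t : Fin 4 → ℝ} (h : Reduced t) : 1 / 2 ≤ t 1 := by
  obtain ⟨h1, h2, h3, h4⟩ := h
  nlinarith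

theorem finite_redSet (s : Bool) {X : ℝ} (hX : 0 < X) : (redSet s X).Finite := by
  by_contra hinf
  obtain ⟨N, hN⟩ := exists_nat_gt (2 * 10 ^ 8 * X / (1 / 2))
  obtain ⟨F, hF, hc⟩ := Set.Infinite.exists_subset_card_eq hinf N
  have := cusp_bound s hX le_rfl F fun f hf => by
    obtain ⟨hg, t, ht, hr⟩ := hF hf
    exact ⟨t, ⟨ht, hr, hg.1.coeff_zero_ne, hg.2.2.2⟩, hr.half_le⟩
  rw [hc] at this
  linarith

theorem exists_rep (s : Bool) (X : ℝ) (q : Quot (classRel s X)) :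
    ∃ g : {f : Fin 4 → ℤ // GoodS s X f}, g.1 ∈ redSet s X ∧ Quot.mk _ g = q := by
  obtain ⟨f, rfl⟩ := Quot.exists_rep q
  obtain ⟨g, hfg, hg⟩ := exists_reduced s f.1 f.2.1.coeff_zero_ne f.2.2.2.1
  exact ⟨⟨g, f.2.gequiv hfg⟩, ⟨f.2.gequiv hfg, hg⟩, Quot.sound hfg.symm⟩

theorem neg_mem_redSet {s : Bool} {X : ℝ} {g : Fin 4 → ℤ} (hg : g ∈ redSet s X) :
    -g ∈ redSet s X := by
  obtain ⟨h, t, ht, hr⟩ := hg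
  exact ⟨h.gequiv (GEquiv.neg g), ![t 0, t 1, -t 2, -t 3], by rw [Phi_neg, ht, toR_neg], hr⟩

theorem finite_classes (s : Bool) {X : ℝ} (hX : 0 < X) : Finite (Quot (classRel s X)) := by
  have := (finite_redSet s hX).to_subtype
  choose r hr hq using exists_rep s X
  refine Finite.of_injective (β := redSet s X) (fun q => ⟨(r q).1, hr q⟩) fun q q' h => ?_
  have e : r q = r q' := Subtype.ext (congrArg (fun x : redSet s X => x.1) h)
  rw [← hq q, ← hq q', e]

theorem two_mul_classes_le (s : Bool) {X : ℝ} (hX : 0 < X) :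
    2 * Nat.card (Quot (classRel s X)) ≤ (redSet s X).ncard := by
  have := (finite_redSet s hX).to_subtype
  choose r hr hq using exists_rep s X
  have key := Nat.card_le_card_of_injective (α := Bool × Quot (classRel s X)) (β := redSet s X)
    (fun x => if x.1 then ⟨(r x.2).1, hr x.2⟩ else ⟨-(r x.2).1, neg_mem_redSet (hr x.2)⟩) ?_
  · rw [Nat.card_prod, Nat.card_eq_fintype_card, Fintype.card_bool] at key
    exact key
  · have hclass : ∀ q q', GEquiv (r q).1 (r q').1 → q = q' := fun q q' h => by
      rw [← hq q, ← hq q']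
      exact Quot.sound h
    have hneg : ∀ q, (r q).1 ≠ -(r q).1 := fun q h => by
      have h0 := (r q).2.1.coeff_zero_ne
      have := congrFun h 0
      simp only [Pi.neg_apply] at this
      omega
    rintro ⟨b, q⟩ ⟨b', q'⟩ h
    cases b <;> cases b' <;> simp only [if_true, if_false, Bool.false_eq_true, Subtype.mk.injEq] at h
    · rw [hclass q q' (neg_injective h ▸ GEquiv.refl _)]
    · have := hclass q q' (h ▸ GEquiv.neg _)
      subst this
      exact absurd h.symm (hneg q)
    · have := hclass q q' (h ▸ (GEquiv.neg _).symm)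
      subst this
      exact absurd h (hneg q)
    · rw [hclass q q' (h ▸ GEquiv.refl _)]

theorem intRedSet_ncard_le (s : Bool) {X : ℝ} (hX : 0 < X) :
    (intRedSet s X).ncard ≤ 2 * Nat.card (Quot (classRel s X)) := by
  have := finite_classes s hX
  have key := Nat.card_le_card_of_injective (α := intRedSet s X) (β := Bool × Quot (classRel s X))
    (fun g => (decide (0 < g.1 0), Quot.mk _ ⟨g.1, g.2.1⟩)) ?_
  · rw [Nat.card_prod, Nat.card_eq_fintype_card (α := Bool), Fintype.card_bool] at key
    exact key
  · rintro ⟨g, hg, t, ht, hr⟩ ⟨g', hg', t', ht', hr'⟩ h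
    obtain ⟨h1, h2⟩ := Prod.mk.inj h
    simp only [decide_eq_decide] at h1
    have hD : disc g ≠ 0 := fun h0 => by simpa [h0] using hg.2.2.1
    rcases eq_or_neg_of_intReduced ht ht' hD hr hr' (classRel_exact h2) with e | e
    · exact Subtype.ext e.symm
    · have h0 := hg.1.coeff_zero_ne
      rw [e, Pi.neg_apply] at h1
      omega

/-! ### Upper bound -/

theorem Phi_smul (s : Bool) (t : Fin 4 → ℝ) (r : ℝ) :
    Phi s ![t 0, t 1, r * t 2, r * t 3] = r • Phi s t := by
  apply ext4 <;> simp [Phi] <;> ring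

theorem abs_disc_Phi (s : Bool) (t : Fin 4 → ℝ) :
    |disc (Phi s t)| = cκ s * t 1 ^ 6 * (t 2 ^ 2 + t 3 ^ 2) ^ 2 := by
  have h : |ce s| = 1 := by cases s <;> simp [ce]
  have := cκ_pos s
  rw [disc_Phi, abs_mul, h, one_mul, abs_of_nonneg (by positivity)]

theorem classes_le (s : Bool) {r T : ℝ} (hr : 0 < r) (hT : 1 ≤ T) {m : ℕ}
    {G : Finset (Fin 4 → ZMod m)} (hG : ∀ f, Fund (disc f) → modm m f ∈ G) :
    2 * (Nat.card (Quot (classRel s (r ^ 4))) : ℝ) ≤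
      (latt G (Phi s '' closedDom s T) r).ncard + 2 * 10 ^ 8 * r ^ 4 / T := by
  have hX : 0 < r ^ 4 := by positivity
  have hfin := finite_redSet s hX
  have hlf := latt_finite G (isCompact_image_closedDom s hT).isBounded hr
  have hsub : redSet s (r ^ 4) ⊆ latt G (Phi s '' closedDom s T) r ∪
      {g ∈ redSet s (r ^ 4) | ∃ t, CuspForm s (r ^ 4) g t ∧ T ≤ t 1} := by
    rintro g ⟨hg, t, ht, hred⟩
    rcases le_total T (t 1) with h | h
    · exact Or.inr ⟨⟨hg, t, ht, hred⟩, t, ⟨ht, hred, hg.1.coeff_zero_ne, hg.2.2.2⟩, h⟩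
    · refine Or.inl ⟨⟨![t 0, t 1, r⁻¹ * t 2, r⁻¹ * t 3], ?_, ?_⟩, hG g hg.2.1⟩
      · refine ⟨hred.1, hred.2.1, hred.2.2.1, hred.2.2.2.le, h, ?_⟩
        have h4 := hg.2.2.2
        rw [← disc_toR, ← ht, abs_disc_Phi] at h4
        calc _ = cκ s * t 1 ^ 6 * (t 2 ^ 2 + t 3 ^ 2) ^ 2 / r ^ 4 := by
              simp
              field_simp
          _ ≤ 1 := ((div_lt_one hX).2 h4).le
      · rw [Phi_smul, ht]
        funext i
        simp [toR]
        field_simp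
  have hf2 : {g ∈ redSet s (r ^ 4) | ∃ t, CuspForm s (r ^ 4) g t ∧ T ≤ t 1}.Finite :=
    hfin.subset (Set.sep_subset _ _)
  have h1 := (Set.ncard_le_ncard hsub (hlf.union hf2)).trans (Set.ncard_union_le _ _)
  have h2 := cusp_bound s hX (by linarith : 1 / 2 ≤ T) hf2.toFinset fun f hf =>
    ((hf2.mem_toFinset).1 hf).2
  rw [← Set.ncard_eq_toFinset_card _ hf2] at h2
  have h3 : (2 * Nat.card (Quot (classRel s (r ^ 4))) : ℝ) ≤ (redSet s (r ^ 4)).ncard := by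
    exact_mod_cast two_mul_classes_le s hX
  have h1' : ((redSet s (r ^ 4)).ncard : ℝ) ≤ (latt G (Phi s '' closedDom s T) r).ncard +
      {g ∈ redSet s (r ^ 4) | ∃ t, CuspForm s (r ^ 4) g t ∧ T ≤ t 1}.ncard := by exact_mod_cast h1
  linarith

end BCF

namespace BCF

open MeasureTheory

/-! ### Lower bound -/

theorem sum_inv_sq_le {n : ℕ} (hn : 2 ≤ n) (P : Finset ℕ) (hP : ∀ p ∈ P, n ≤ p) :
    ∑ p ∈ P, ((p : ℝ) ^ 2)⁻¹ ≤ 2 / n := by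
  have hsub : P ⊆ Finset.Ioc (n - 1) (max n (P.sup id)) := fun p hp => by
    have h1 := hP p hp
    have h2 : p ≤ P.sup id := Finset.le_sup (f := id) hp
    exact Finset.mem_Ioc.2 ⟨by omega, h2.trans (le_max_right _ _)⟩
  have h1 := (Finset.sum_le_sum_of_subset_of_nonneg hsub
    (f := fun p : ℕ => ((p : ℝ) ^ 2)⁻¹) fun _ _ _ => by positivity).trans
    (sum_Ioc_inv_sq_le_sub (α := ℝ) (by omega : n - 1 ≠ 0) (by omega))
  have h2 : (2 : ℝ) ≤ n := by exact_mod_cast hn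
  have h3 : ((n - 1 : ℕ) : ℝ)⁻¹ ≤ 2 / n := by
    rw [Nat.cast_sub (by omega), Nat.cast_one, inv_eq_one_div, div_le_div_iff₀] <;> linarith
  have h4 : (0 : ℝ) ≤ ((max n (P.sup id) : ℕ) : ℝ)⁻¹ := by positivity
  linarith

theorem card_le_tail {α : Type*} {F : Finset α} {n : ℕ} (hn : 2 ≤ n) {c : ℝ} (hc : 0 ≤ c)
    {Q : ℕ → α → Prop} (h : ∀ f ∈ F, ∃ p, n ≤ p ∧ p.Prime ∧ Q p f)
    (hb : ∀ p, n ≤ p → p.Prime → ∀ F' ⊆ F, (∀ f ∈ F', Q p f) →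
      (F'.card : ℝ) ≤ c * ((p : ℝ) ^ 2)⁻¹) : (F.card : ℝ) ≤ c * (2 / n) := by
  classical
  choose! p hp using h
  calc (F.card : ℝ) = ∑ q ∈ F.image p, ((F.filter fun f => p f = q).card : ℝ) := by
        exact_mod_cast Finset.card_eq_sum_card_image p F
    _ ≤ ∑ q ∈ F.image p, c * ((q : ℝ) ^ 2)⁻¹ := by
        refine Finset.sum_le_sum fun q hq => ?_
        obtain ⟨f, hf, rfl⟩ := Finset.mem_image.1 hq
        refine hb _ (hp f hf).1 (hp f hf).2.1 _ (Finset.filter_subset _ _) fun g hg => ?_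
        obtain ⟨hg, e⟩ := Finset.mem_filter.1 hg
        exact e ▸ (hp g hg).2.2
    _ ≤ c * (2 / n) := by
        rw [← Finset.mul_sum]
        refine mul_le_mul_of_nonneg_left (sum_inv_sq_le hn _ fun q hq => ?_) hc
        obtain ⟨f, hf, rfl⟩ := Finset.mem_image.1 hq
        exact (hp f hf).1

/-- The number of forms discarded in a box of side `L` for reasons independent of a sieve. -/
noncomputable def boxErr (L : ℝ) : ℝ :=
  54 * L ^ 3 + 54 * L ^ 3 * (1 + Real.log L) ^ 2 + 189 * L ^ 3

theorem le_classes (s : Bool) {r T R : ℝ} (hr : 0 < r) (hR : ∀ x ∈ Phi s '' openDom s T, ‖x‖ ≤ R)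
    (hRr : 5 ≤ R * r) {n : ℕ} (hn : 4 ≤ n) {m : ℕ} {G : Finset (Fin 4 → ZMod m)}
    (hG : ∀ f, modm m f ∈ G → ∀ p ∈ n.primesBelow, ¬BadAt p f) :
    ((latt G (Phi s '' openDom s T) r).ncard : ℝ) ≤
      2 * (Nat.card (Quot (classRel s (r ^ 4))) : ℝ) + boxErr (R * r) +
        (32 * 10 ^ 8 * r ^ 4 + 162 * (R * r) ^ 4) * (2 / n) := by
  classical
  have hX : 0 < r ^ 4 := by positivity
  have hbox := latt_subset_box G (A := Phi s '' openDom s T)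
    (fun x hx i => (norm_le_pi_norm x i).trans (hR x hx)) hr
  have hlf : (latt G (Phi s '' openDom s T) r).Finite := (Finset.finite_toSet _).subset hbox
  obtain ⟨E, hE⟩ := hlf.exists_finset_coe
  have hEbox : E ⊆ box fun _ => R * r := by
    rw [← Finset.coe_subset, hE]
    exact hbox
  have hpar : ∀ f ∈ E, 0 < ce s * (disc f : ℤ) ∧ |((disc f : ℤ) : ℝ)| < r ^ 4 ∧
      ∃ t, Phi s t = toR f ∧ IntReduced t := by
    intro f hf
    have hf : f ∈ latt G (Phi s '' openDom s T) r := hE ▸ Finset.mem_coe.2 hf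
    obtain ⟨⟨t, ⟨h1, h2, h3, h4, h5, h6, h7⟩, ht⟩, -⟩ := hf
    have hP : Phi s ![t 0, t 1, r * t 2, r * t 3] = toR f := by
      rw [Phi_smul, ht]
      funext i
      simp [toR]
      field_simp
    have hD : |((disc f : ℤ) : ℝ)| < r ^ 4 := by
      rw [← disc_toR, ← hP, abs_disc_Phi]
      calc _ = cκ s * t 1 ^ 6 * (t 2 ^ 2 + t 3 ^ 2) ^ 2 * r ^ 4 := by
            simp
            ring
        _ < r ^ 4 := mul_lt_of_lt_one_left hX h7
    have hpos : 0 < ce s * ((disc f : ℤ) : ℝ) := by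
      have e : ce s * ce s = 1 := by cases s <;> simp [ce]
      rw [← disc_toR, ← hP, disc_Phi, ← mul_assoc, e, one_mul]
      have h8 := cκ_pos s
      have : 0 < (r * t 2) ^ 2 + (r * t 3) ^ 2 := by
        rw [mul_pow, mul_pow, ← mul_add]
        positivity
      simp
      positivity
    exact ⟨hpos, hD, _, hP, h1, h2, h3, h4⟩
  have hA : ((E.filter fun f => ¬Irr f).card : ℝ) ≤ _ :=
    reducible_bound (by linarith) (E.filter fun f => ¬Irr f)
      ((Finset.filter_subset _ _).trans hEbox) fun f hf => (Finset.mem_filter.1 hf).2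
  have hB : ((E.filter fun f => Irr f ∧ ∃ p, n ≤ p ∧ p.Prime ∧ WeakAt p f).card : ℝ) ≤
      32 * 10 ^ 8 * r ^ 4 * (2 / n) := by
    refine card_le_tail (by omega) (by positivity) (Q := WeakAt)
      (fun f hf => (Finset.mem_filter.1 hf).2.2) fun p _ hp F' hF' hw =>
        weak_bound s hX hp F' fun f hf => ?_
    obtain ⟨h1, h2, -⟩ := Finset.mem_filter.1 (hF' hf)
    obtain ⟨h3, h4, h5⟩ := hpar f h1
    exact ⟨h2, h3, h4, h5, hw f hf⟩
  have hC : ((E.filter fun f => ∃ p, n ≤ p ∧ p.Prime ∧ (p : ℝ) ≤ R * r ∧ StrongAt p f).card : ℝ) ≤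
      162 * (R * r) ^ 4 * (2 / n) := by
    refine card_le_tail (by omega) (by positivity) (Q := fun p f => (p : ℝ) ≤ R * r ∧ StrongAt p f)
      (fun f hf => (Finset.mem_filter.1 hf).2) fun p hnp hp F' hF' hw => ?_
    rcases F'.eq_empty_or_nonempty with rfl | ⟨f, hf⟩
    · simp only [Finset.card_empty, Nat.cast_zero]
      positivity
    · exact strong_bound_small hp (by omega) (hw f hf).1 F'
        (hF'.trans ((Finset.filter_subset _ _).trans hEbox)) fun f hf => (hw f hf).2
  have hD : ((E.filter fun f => Irr f ∧ ∃ p : ℕ, p.Prime ∧ R * r < p ∧ StrongAt p f).card : ℝ) ≤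
      189 * (R * r) ^ 3 :=
    strong_bound_large hRr _ ((Finset.filter_subset _ _).trans hEbox)
      (fun f hf => (Finset.mem_filter.1 hf).2.1.coeff_zero_ne)
      fun f hf => (Finset.mem_filter.1 hf).2.2
  have hI : ((E.filter fun f => Irr f ∧ Fund (disc f)).card : ℝ) ≤
      2 * (Nat.card (Quot (classRel s (r ^ 4))) : ℝ) := by
    have hfin : (intRedSet s (r ^ 4)).Finite := (finite_redSet s hX).subset
      fun f ⟨h, t, ht, h1, h2, h3, h4⟩ => ⟨h, t, ht, h1.le, h2.le, h3.le, h4⟩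
    have h1 := Set.ncard_le_ncard (s := (E.filter fun f => Irr f ∧ Fund (disc f) : Finset _))
      (t := intRedSet s (r ^ 4)) (fun f hf => by
        obtain ⟨h1, h2, h3⟩ := Finset.mem_filter.1 (Finset.mem_coe.1 hf)
        obtain ⟨h4, h5, h6⟩ := hpar f h1
        exact ⟨⟨h2, h3, h4, h5⟩, h6⟩) hfin
    rw [Set.ncard_coe_finset] at h1
    exact_mod_cast h1.trans (intRedSet_ncard_le s hX)
  have hcov : E ⊆ (E.filter fun f => Irr f ∧ Fund (disc f)) ∪ ((E.filter fun f => ¬Irr f) ∪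
      ((E.filter fun f => Irr f ∧ ∃ p, n ≤ p ∧ p.Prime ∧ WeakAt p f) ∪
      ((E.filter fun f => ∃ p, n ≤ p ∧ p.Prime ∧ (p : ℝ) ≤ R * r ∧ StrongAt p f) ∪
      (E.filter fun f => Irr f ∧ ∃ p : ℕ, p.Prime ∧ R * r < p ∧ StrongAt p f)))) := by
    intro f hf
    simp only [Finset.mem_union, Finset.mem_filter, hf, true_and]
    by_cases hI : Irr f
    · by_cases hF : Fund (disc f)
      · exact Or.inl ⟨hI, hF⟩
      · rw [fund_disc_iff] at hF
        push Not at hF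
        obtain ⟨p, hp, hb⟩ := hF
        have hmod : modm m f ∈ G := by
          have : f ∈ latt G (Phi s '' openDom s T) r := hE ▸ Finset.mem_coe.2 hf
          exact this.2
        have hnp : n ≤ p := by
          by_contra hlt
          exact hG f hmod p (Nat.mem_primesBelow.2 ⟨by omega, hp⟩) hb
        rcases hb.weakAt_or_strongAt with h | h
        · exact Or.inr (Or.inr (Or.inl ⟨hI, p, hnp, hp, h⟩))
        · rcases le_or_gt (p : ℝ) (R * r) with h' | h'
          · exact Or.inr (Or.inr (Or.inr (Or.inl ⟨p, hnp, hp, h', h⟩)))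
          · exact Or.inr (Or.inr (Or.inr (Or.inr ⟨hI, p, hp, h', h⟩)))
    · exact Or.inr (Or.inl hI)
  have hcard : (E.card : ℝ) ≤ (E.filter fun f => Irr f ∧ Fund (disc f)).card +
      ((E.filter fun f => ¬Irr f).card +
      ((E.filter fun f => Irr f ∧ ∃ p, n ≤ p ∧ p.Prime ∧ WeakAt p f).card +
      ((E.filter fun f => ∃ p, n ≤ p ∧ p.Prime ∧ (p : ℝ) ≤ R * r ∧ StrongAt p f).card +
      (E.filter fun f => Irr f ∧ ∃ p : ℕ, p.Prime ∧ R * r < p ∧ StrongAt p f).card))) := by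
    have h1 := (Finset.card_le_card hcov).trans (Finset.card_union_le _ _)
    have h2 := Finset.card_union_le (E.filter fun f => ¬Irr f)
      ((E.filter fun f => Irr f ∧ ∃ p, n ≤ p ∧ p.Prime ∧ WeakAt p f) ∪
      ((E.filter fun f => ∃ p, n ≤ p ∧ p.Prime ∧ (p : ℝ) ≤ R * r ∧ StrongAt p f) ∪
      (E.filter fun f => Irr f ∧ ∃ p : ℕ, p.Prime ∧ R * r < p ∧ StrongAt p f)))
    have h3 := Finset.card_union_le (E.filter fun f => Irr f ∧ ∃ p, n ≤ p ∧ p.Prime ∧ WeakAt p f)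
      ((E.filter fun f => ∃ p, n ≤ p ∧ p.Prime ∧ (p : ℝ) ≤ R * r ∧ StrongAt p f) ∪
      (E.filter fun f => Irr f ∧ ∃ p : ℕ, p.Prime ∧ R * r < p ∧ StrongAt p f))
    have h4 := Finset.card_union_le
      (E.filter fun f => ∃ p, n ≤ p ∧ p.Prime ∧ (p : ℝ) ≤ R * r ∧ StrongAt p f)
      (E.filter fun f => Irr f ∧ ∃ p : ℕ, p.Prime ∧ R * r < p ∧ StrongAt p f)
    exact_mod_cast (by omega)
  rw [← hE, Set.ncard_coe_finset, boxErr]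
  linarith

end BCF

namespace BCF

open MeasureTheory

/-! ### Asymptotics -/

theorem boxErr_isLittleO : boxErr =o[atTop] fun L : ℝ => L ^ 4 := by
  have h : (fun L : ℝ => 297 + 108 * Real.log L + 54 * Real.log L ^ 2) =o[atTop] fun L : ℝ => L :=
    ((Asymptotics.isLittleO_const_id_atTop 297).add
      (Real.isLittleO_log_id_atTop.const_mul_left 108)).add
      ((Real.isLittleO_pow_log_id_atTop (n := 2)).const_mul_left 54)
  refine ((Asymptotics.isBigO_refl (fun L : ℝ => L ^ 3) atTop).mul_isLittleO h).congr
    (fun L => ?_) fun L => ?_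
  · rw [boxErr]
    ring
  · ring

/-- The limit of the normalised volumes. -/
noncomputable def volLim (s : Bool) : ℝ := cJ s * Real.pi / (2 * cκ s) * (Real.pi / 6)

theorem vol_nonneg (s : Bool) {T : ℝ} (hT : 1 ≤ T) : 0 ≤ vol s T := by
  have h1 := cJ_pos s
  have h2 := cκ_pos s
  have h3 : (2 * T)⁻¹ ≤ 1 / 2 := by
    rw [inv_eq_one_div]
    exact one_div_le_one_div_of_le two_pos (by linarith)
  have h4 : 0 ≤ Real.pi / 6 - (2 * T)⁻¹ := by linarith [Real.pi_gt_three]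
  rw [vol]
  positivity

theorem vol_le_volLim (s : Bool) {T : ℝ} (hT : 1 ≤ T) : vol s T ≤ volLim s := by
  have h1 := cJ_pos s
  have h2 := cκ_pos s
  have : 0 ≤ (2 * T)⁻¹ := by positivity
  exact mul_le_mul_of_nonneg_left (by linarith) (by positivity)

theorem tendsto_vol (s : Bool) : Tendsto (vol s) atTop (nhds (volLim s)) := by
  have h : Tendsto (fun T : ℝ => (2 * T)⁻¹) atTop (nhds 0) :=
    tendsto_inv_atTop_zero.comp (tendsto_id.const_mul_atTop two_pos)
  have h1 := ((tendsto_const_nhds (x := Real.pi / 6)).sub h).const_mul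
    (cJ s * Real.pi / (2 * cκ s))
  rw [sub_zero] at h1
  exact h1

theorem eventually_classes_le (s : Bool) {c : ℝ} (hc : (6 / Real.pi ^ 2) ^ 2 * volLim s < c) :
    ∀ᶠ r : ℝ in atTop, 2 * (Nat.card (Quot (classRel s (r ^ 4))) : ℝ) ≤ c * r ^ 4 := by
  obtain ⟨ε, hε, rfl⟩ : ∃ ε, 0 < ε ∧ c = (6 / Real.pi ^ 2) ^ 2 * volLim s + 2 * ε :=
    ⟨(c - (6 / Real.pi ^ 2) ^ 2 * volLim s) / 2, by linarith, by ring⟩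
  obtain ⟨T, hT, hT'⟩ : ∃ T : ℝ, 1 ≤ T ∧ 2 * 10 ^ 8 / T ≤ ε := by
    refine ⟨max 1 (2 * 10 ^ 8 / ε), le_max_left _ _, ?_⟩
    have h := le_max_right 1 (2 * 10 ^ 8 / ε)
    rw [div_le_iff₀ hε] at h
    rw [div_le_iff₀ (by positivity)]
    linarith
  have h1 := tendsto_prod_density.mul_const (vol s T)
  obtain ⟨n, hn⟩ := (h1.eventually_lt_const (u := (6 / Real.pi ^ 2) ^ 2 * volLim s + ε) (by
    have := mul_le_mul_of_nonneg_left (vol_le_volLim s hT) (sq_nonneg (6 / Real.pi ^ 2))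
    linarith)).exists
  obtain ⟨m, hm, -, G, hG, hGc⟩ := exists_residues n.primesBelow
    fun p hp => Nat.prime_of_mem_primesBelow hp
  rw [← hGc] at hn
  have hvol : volume.real (Phi s '' closedDom s T) ≤ vol s T :=
    ENNReal.toReal_le_of_le_ofReal (vol_nonneg s hT) (volume_image_closedDom_le s hT)
  have h2 := eventually_ncard_latt_le hm G (isCompact_image_closedDom s hT)
    ((mul_le_mul_of_nonneg_left hvol (by positivity)).trans_lt hn)
  filter_upwards [h2, eventually_gt_atTop 0] with r hr hr0
  have h3 := classes_le s hr0 hT (G := G) fun f hf =>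
    (hG f).2 fun p hp => (fund_disc_iff f).1 hf p (Nat.prime_of_mem_primesBelow hp)
  have h4 : 2 * 10 ^ 8 * r ^ 4 / T ≤ ε * r ^ 4 := by
    rw [mul_div_right_comm]
    gcongr
  linarith

theorem eventually_le_classes (s : Bool) {c : ℝ} (hc : c < (6 / Real.pi ^ 2) ^ 2 * volLim s) :
    ∀ᶠ r : ℝ in atTop, c * r ^ 4 ≤ 2 * (Nat.card (Quot (classRel s (r ^ 4))) : ℝ) := by
  obtain ⟨ε, hε, rfl⟩ : ∃ ε, 0 < ε ∧ c = (6 / Real.pi ^ 2) ^ 2 * volLim s - 3 * ε :=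
    ⟨((6 / Real.pi ^ 2) ^ 2 * volLim s - c) / 3, by linarith, by ring⟩
  obtain ⟨T, hT', hT⟩ := ((((tendsto_vol s).const_mul ((6 / Real.pi ^ 2) ^ 2)).eventually_const_lt
    (u := (6 / Real.pi ^ 2) ^ 2 * volLim s - ε) (by linarith)).and (eventually_ge_atTop 1)).exists
  obtain ⟨R, hR0, hR⟩ := (isBounded_image_openDom s hT).exists_pos_norm_le
  have hlim : Tendsto (fun n : ℕ => (32 * 10 ^ 8 + 162 * R ^ 4) * (2 / (n : ℝ))) atTop (nhds 0) := by
    simpa using (tendsto_const_div_atTop_nhds_zero_nat (2 : ℝ)).const_mul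
      (32 * 10 ^ 8 + 162 * R ^ 4)
  obtain ⟨n, ⟨hn, hn'⟩, hn4⟩ := (((tendsto_prod_density.mul_const (vol s T)).eventually_const_lt
    hT').and (hlim.eventually_lt_const hε)).and (eventually_ge_atTop 4) |>.exists
  obtain ⟨m, hm, -, G, hG, hGc⟩ := exists_residues n.primesBelow
    fun p hp => Nat.prime_of_mem_primesBelow hp
  have hvol : volume.real (Phi s '' openDom s T) = vol s T := by
    rw [Measure.real, volume_image_openDom s hT, ENNReal.toReal_ofReal (vol_nonneg s hT)]
  rw [← hGc, ← hvol] at hn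
  have h2 := eventually_le_ncard_latt hm G (isOpen_image_openDom s T)
    (isBounded_image_openDom s hT) hn
  have hRr : Tendsto (fun r : ℝ => R * r) atTop atTop := tendsto_id.const_mul_atTop hR0
  have h3 := hRr.eventually ((Asymptotics.isLittleO_iff.1 boxErr_isLittleO)
    (c := ε / R ^ 4) (by positivity))
  filter_upwards [h2, h3, hRr.eventually_ge_atTop 5] with r h2 h3 h5
  have hr0 : 0 < r := by
    by_contra h
    nlinarith
  have h4 := le_classes s hr0 hR h5 hn4 (G := G) fun f hf => (hG f).1 hf
  have h6 : boxErr (R * r) ≤ ε * r ^ 4 := by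
    refine (le_abs_self _).trans (h3.trans (le_of_eq ?_))
    rw [Real.norm_of_nonneg (by positivity)]
    field_simp
  have h7 : (32 * 10 ^ 8 * r ^ 4 + 162 * (R * r) ^ 4) * (2 / n) ≤ ε * r ^ 4 := by
    calc _ = (32 * 10 ^ 8 + 162 * R ^ 4) * (2 / (n : ℝ)) * r ^ 4 := by ring
      _ ≤ _ := by gcongr
  linarith

theorem count_isLittleO (s : Bool) :
    (fun X : ℝ => (cubicFieldCountNTR (if s then 0 else -X) (if s then X else 0) : ℝ)
      - (6 / Real.pi ^ 2) ^ 2 * volLim s / 2 * X) =o[atTop] fun X : ℝ => X := by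
  refine Asymptotics.isLittleO_iff.2 fun ε hε => ?_
  have hlim : Tendsto (fun X : ℝ => X ^ ((1 : ℝ) / 4)) atTop atTop :=
    tendsto_rpow_atTop (by norm_num)
  filter_upwards [hlim.eventually (eventually_classes_le s
      (c := (6 / Real.pi ^ 2) ^ 2 * volLim s + 2 * ε) (by linarith)),
    hlim.eventually (eventually_le_classes s
      (c := (6 / Real.pi ^ 2) ^ 2 * volLim s - 2 * ε) (by linarith)),
    eventually_gt_atTop 0] with X h1 h2 hX
  have e : (X ^ ((1 : ℝ) / 4)) ^ 4 = X := by
    rw [← Real.rpow_natCast, ← Real.rpow_mul hX.le]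
    norm_num
  rw [e] at h1 h2
  rw [cubicFieldCountNTR_eq_classRel, Real.norm_eq_abs, Real.norm_of_nonneg hX.le, abs_le]
  constructor <;> linarith

end BCF

theorem nowhere_totally_ramified_count :
    ((fun X : ℝ => (cubicFieldCountNTR 0 X : ℝ) - X / (2 * Real.pi ^ 2)) =o[atTop]
      fun X : ℝ => X) ∧
    ((fun X : ℝ => (cubicFieldCountNTR (-X) 0 : ℝ) - 3 * X / (2 * Real.pi ^ 2)) =o[atTop]
      fun X : ℝ => X) := by
  have hπ := Real.pi_ne_zero
  constructor
  · refine (BCF.count_isLittleO true).congr_left fun X => ?_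
    simp only [if_true, BCF.volLim, BCF.cJ, BCF.cκ]
    congr 1
    field_simp
    norm_num
  · refine (BCF.count_isLittleO false).congr_left fun X => ?_
    simp only [Bool.false_eq_true, if_false, BCF.volLim, BCF.cJ, BCF.cκ]
    congr 1
    field_simp
    ring
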